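/- arXiv:2112.14960 — 2 statements merged into one kernel-verified Lean document; each statement's English description precedes it below -/
import Mathlib

section
/- Let G be a bipartite graph with parts of equal size M, let C be a longest cycle in G with |V(C)| = 2c, and suppose G contains no C_{2n}. If c ≤ n−1 ≤ M/2, then e(G) ≤ (n−1)(2M − 2n + 3); moreover, if equality holds, then the subgraph of G induced on V(C) is a complete bipartite graph K_{c,c}. -/
def hasCycleLength {V : Type*} (G : SimpleGraph V) (l : ℕ) : Prop :=
  ∃ (v : V) (p : G.Walk v v), p.IsCycle ∧ p.length = l

set_option linter.unusedSectionVars false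
set_option linter.unusedDecidableInType false

namespace LongCycle

open scoped Classical

variable {V : Type*} [DecidableEq V]

/-- `r 0, …, r n` is a path of `G`. -/
def IP (G : SimpleGraph V) (r : ℕ → V) (n : ℕ) : Prop :=
  (∀ i < n, G.Adj (r i) (r (i + 1))) ∧ ∀ i ≤ n, ∀ j ≤ n, r i = r j → i = j

/-- The set `{r a, …, r b}`. -/
def seg (r : ℕ → V) (a b : ℕ) : Finset V := (Finset.Icc a b).image r

/-- There is a path of `G` from `u` to `v` with vertex set `S`. -/
def Pth (G : SimpleGraph V) (u v : V) (S : Finset V) : Prop :=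
  ∃ r n, IP G r n ∧ r 0 = u ∧ r n = v ∧ S = seg r 0 n

variable {G : SimpleGraph V}

lemma mem_seg {r : ℕ → V} {a b : ℕ} {x : V} :
    x ∈ seg r a b ↔ ∃ t, a ≤ t ∧ t ≤ b ∧ r t = x := by
  simp [seg, and_assoc]

lemma seg_mem {r : ℕ → V} {a b t : ℕ} (h1 : a ≤ t) (h2 : t ≤ b) : r t ∈ seg r a b :=
  mem_seg.2 ⟨t, h1, h2, rfl⟩

lemma IP.mem_seg_iff {r : ℕ → V} {n a b t : ℕ} (h : IP G r n) (hb : b ≤ n) (ht : t ≤ n) :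
    r t ∈ seg r a b ↔ a ≤ t ∧ t ≤ b := by
  refine ⟨fun hm => ?_, fun hm => seg_mem hm.1 hm.2⟩
  obtain ⟨s, h1, h2, h3⟩ := mem_seg.1 hm
  have := h.2 s (by omega) t ht h3
  omega

lemma IP.card_seg {r : ℕ → V} {n : ℕ} (h : IP G r n) {a b : ℕ} (hb : b ≤ n) :
    (seg r a b).card = b + 1 - a := by
  unfold seg
  rw [Finset.card_image_of_injOn, Nat.card_Icc]
  intro i hi j hj hij
  simp only [Finset.coe_Icc, Set.mem_Icc] at hi hj
  exact h.2 i (by omega) j (by omega) hij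

lemma IP.pth_seg {r : ℕ → V} {n : ℕ} (h : IP G r n) {a b : ℕ} (hab : a ≤ b) (hb : b ≤ n) :
    Pth G (r a) (r b) (seg r a b) := by
  refine ⟨fun t => r (a + t), b - a, ⟨fun i hi => ?_, fun i hi j hj hij => ?_⟩, by simp, ?_, ?_⟩
  · exact h.1 (a + i) (by omega)
  · have := h.2 _ (by omega) _ (by omega) hij
    omega
  · simp only; congr 1; omega
  · ext x
    rw [mem_seg, mem_seg]
    constructor
    · rintro ⟨t, h1, h2, h3⟩
      exact ⟨t - a, by omega, by omega, by rw [← h3]; congr 1; omega⟩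
    · rintro ⟨t, h1, h2, h3⟩
      exact ⟨a + t, by omega, by omega, h3⟩

lemma IP.pth {r : ℕ → V} {n : ℕ} (h : IP G r n) : Pth G (r 0) (r n) (seg r 0 n) :=
  ⟨r, n, h, rfl, rfl, rfl⟩

lemma IP.reverse {r : ℕ → V} {n : ℕ} (h : IP G r n) : IP G (fun t => r (n - t)) n := by
  refine ⟨fun i hi => ?_, fun i hi j hj hij => ?_⟩
  · have := (h.1 (n - (i + 1)) (by omega)).symm
    rwa [show n - (i + 1) + 1 = n - i by omega] at this
  · have := h.2 _ (by omega) _ (by omega) hij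
    omega

lemma seg_reverse (r : ℕ → V) (n : ℕ) : seg (fun t => r (n - t)) 0 n = seg r 0 n := by
  ext x
  rw [mem_seg, mem_seg]
  constructor
  · rintro ⟨t, _, h2, h3⟩
    exact ⟨n - t, by omega, by omega, h3⟩
  · rintro ⟨t, _, h2, h3⟩
    exact ⟨n - t, by omega, by omega, by rw [← h3]; congr 1; omega⟩

lemma Pth.symm {u v : V} {S : Finset V} (h : Pth G u v S) : Pth G v u S := by
  obtain ⟨r, n, hr, rfl, rfl, rfl⟩ := h
  exact ⟨_, n, hr.reverse, by simp, by simp, (seg_reverse r n).symm⟩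

lemma Pth.single (v : V) : Pth G v v {v} :=
  ⟨fun _ => v, 0, ⟨fun i hi => absurd hi (by omega), fun i hi j hj _ => by omega⟩, rfl, rfl, by
    ext x; simp [mem_seg, eq_comm]⟩

lemma Pth.left_mem {u v : V} {S : Finset V} (h : Pth G u v S) : u ∈ S := by
  obtain ⟨r, n, hr, rfl, rfl, rfl⟩ := h
  exact seg_mem le_rfl (Nat.zero_le _)

lemma Pth.right_mem {u v : V} {S : Finset V} (h : Pth G u v S) : v ∈ S := h.symm.left_mem

lemma Pth.card_pos {u v : V} {S : Finset V} (h : Pth G u v S) : 0 < S.card :=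
  Finset.card_pos.2 ⟨u, h.left_mem⟩

/-- Concatenation of two sequences, the first one being used up to index `n`. -/
def cat (f : ℕ → V) (n : ℕ) (g : ℕ → V) : ℕ → V := fun t => if t ≤ n then f t else g (t - (n + 1))

lemma cat_left {f g : ℕ → V} {n t : ℕ} (h : t ≤ n) : cat f n g t = f t := by simp [cat, h]

lemma cat_right {f g : ℕ → V} {n t : ℕ} (h : n < t) : cat f n g t = g (t - (n + 1)) := by
  simp [cat, Nat.not_le.2 h]

lemma seg_cat (f g : ℕ → V) (n m : ℕ) :
    seg (cat f n g) 0 (n + 1 + m) = seg f 0 n ∪ seg g 0 m := by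
  ext x
  rw [Finset.mem_union, mem_seg, mem_seg, mem_seg]
  constructor
  · rintro ⟨t, _, h2, h3⟩
    by_cases h : t ≤ n
    · exact Or.inl ⟨t, by omega, h, by rwa [cat_left h] at h3⟩
    · exact Or.inr ⟨t - (n + 1), by omega, by omega, by rwa [cat_right (by omega)] at h3⟩
  · rintro (⟨t, _, h2, h3⟩ | ⟨t, _, h2, h3⟩)
    · exact ⟨t, by omega, by omega, by rwa [cat_left h2]⟩
    · exact ⟨n + 1 + t, by omega, by omega, by
        rw [cat_right (by omega), show n + 1 + t - (n + 1) = t by omega]; exact h3⟩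

lemma IP.cat {f g : ℕ → V} {n m : ℕ} (hf : IP G f n) (hg : IP G g m) (ha : G.Adj (f n) (g 0))
    (hd : Disjoint (seg f 0 n) (seg g 0 m)) : IP G (cat f n g) (n + 1 + m) := by
  refine ⟨fun i hi => ?_, fun i hi j hj hij => ?_⟩
  · rcases lt_trichotomy i n with h | h | h
    · rw [cat_left (by omega), cat_left (by omega)]; exact hf.1 i h
    · subst h
      rw [cat_left le_rfl, cat_right (by omega)]; simpa using ha
    · rw [cat_right (by omega), cat_right (by omega)]
      have := hg.1 (i - (n + 1)) (by omega)
      rwa [show i - (n + 1) + 1 = i + 1 - (n + 1) by omega] at this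
  · have key : ∀ i j, i ≤ n → n < j → j ≤ n + 1 + m → LongCycle.cat f n g i ≠ LongCycle.cat f n g j := by
      intro i j h1 h2 h3 h
      rw [cat_left h1, cat_right h2] at h
      refine Finset.disjoint_left.1 hd (seg_mem (Nat.zero_le i) h1) ?_
      rw [h]
      exact seg_mem (Nat.zero_le _) (by omega)
    by_cases h1 : i ≤ n <;> by_cases h2 : j ≤ n
    · rw [cat_left h1, cat_left h2] at hij
      exact hf.2 i h1 j h2 hij
    · exact absurd hij (key i j h1 (by omega) hj)
    · exact absurd hij.symm (key j i h2 (by omega) hi)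
    · rw [cat_right (by omega), cat_right (by omega)] at hij
      have := hg.2 _ (by omega) _ (by omega) hij
      omega

lemma Pth.append {a b b' d : V} {S T : Finset V} (h1 : Pth G a b S) (h2 : Pth G b' d T)
    (ha : G.Adj b b') (hd : Disjoint S T) : Pth G a d (S ∪ T) := by
  obtain ⟨f, n, hf, rfl, rfl, rfl⟩ := h1
  obtain ⟨g, m, hg, rfl, rfl, rfl⟩ := h2
  refine ⟨_, _, hf.cat hg ha hd, cat_left (Nat.zero_le _), ?_, (seg_cat f g n m).symm⟩
  rw [cat_right (by omega)]
  congr 1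
  omega

lemma Pth.snoc {a b d : V} {S : Finset V} (h1 : Pth G a b S) (ha : G.Adj b d) (hd : d ∉ S) :
    Pth G a d (insert d S) := by
  have := h1.append (Pth.single d) ha (by simpa using hd)
  rwa [Finset.union_comm, ← Finset.insert_eq] at this

lemma Pth.strip {u v : V} {S : Finset V} (h : Pth G u v S) (huv : u ≠ v) :
    ∃ w, G.Adj w v ∧ Pth G u w (S.erase v) := by
  obtain ⟨r, n, hr, rfl, rfl, rfl⟩ := h
  have hn : n ≠ 0 := by rintro rfl; exact huv rfl
  refine ⟨r (n - 1), ?_, ?_⟩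
  · have := hr.1 (n - 1) (by omega)
    rwa [show n - 1 + 1 = n by omega] at this
  · have := hr.pth_seg (Nat.zero_le (n - 1)) (by omega)
    convert this using 1
    ext x
    rw [Finset.mem_erase, mem_seg, mem_seg]
    constructor
    · rintro ⟨h0, t, h1, h2, h3⟩
      refine ⟨t, h1, ?_, h3⟩
      rcases Nat.lt_or_ge t n with h | h
      · omega
      · exact absurd (by rw [← h3]; congr 1; omega) h0
    · rintro ⟨t, h1, h2, h3⟩
      refine ⟨?_, t, h1, by omega, h3⟩
      rintro rfl
      have := hr.2 _ (by omega) _ (by omega) h3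
      omega

lemma Pth.join {a b d : V} {S T : Finset V} (h1 : Pth G a b S) (h2 : Pth G b d T)
    (hd : ∀ x ∈ S, x ∈ T → x = b) : Pth G a d (S ∪ T) := by
  by_cases hbd : b = d
  · subst hbd
    obtain ⟨r, n, hr, h0, hn, rfl⟩ := h2
    have : n = 0 := (hr.2 0 (Nat.zero_le _) n le_rfl (h0.trans hn.symm)).symm
    subst this
    have : S ∪ seg r 0 0 = S := by
      rw [Finset.union_eq_left]
      intro x hx
      obtain ⟨t, _, ht, rfl⟩ := mem_seg.1 hx
      have : t = 0 := by omega
      subst this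
      rw [h0]; exact h1.right_mem
    rwa [this]
  · obtain ⟨w, hw, hp⟩ := h2.symm.strip (Ne.symm hbd)
    have := h1.append hp.symm hw.symm (by
      rw [Finset.disjoint_left]
      intro x hx hx'
      rw [Finset.mem_erase] at hx'
      exact hx'.1 (hd x hx hx'.2))
    convert this using 1
    ext x
    simp only [Finset.mem_union, Finset.mem_erase]
    constructor
    · rintro (h | h)
      · exact Or.inl h
      · by_cases hx : x = b
        · left; rw [hx]; exact h1.right_mem
        · exact Or.inr ⟨hx, h⟩
    · rintro (h | h)
      · exact Or.inl h
      · exact Or.inr h.2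

/-- The part of a path after its last vertex in `K`. -/
lemma Pth.last_in {a b : V} {I : Finset V} (h : Pth G a b I) (K : V → Prop) (ha : K a) :
    ∃ a' I', K a' ∧ I' ⊆ I ∧ Pth G a' b I' ∧ ∀ x ∈ I', K x → x = a' := by
  classical
  obtain ⟨r, n, hr, rfl, rfl, rfl⟩ := h
  let m := Nat.findGreatest (fun t => K (r t)) n
  have hm : K (r m) := Nat.findGreatest_spec (P := fun t => K (r t)) (Nat.zero_le n) ha
  have hmn : m ≤ n := Nat.findGreatest_le n
  refine ⟨r m, seg r m n, hm, ?_, hr.pth_seg hmn le_rfl, ?_⟩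
  · intro x hx
    obtain ⟨t, h1, h2, rfl⟩ := mem_seg.1 hx
    exact seg_mem (Nat.zero_le _) h2
  · intro x hx hK
    obtain ⟨t, h1, h2, rfl⟩ := mem_seg.1 hx
    rcases h1.eq_or_lt with h | h
    · rw [h]
    · exact absurd hK (Nat.findGreatest_is_greatest h h2)

/-- `v` can be reached from `u` by a walk whose vertices after `u` satisfy `Q`. -/
def Conn (G : SimpleGraph V) (Q : V → Prop) (u v : V) : Prop :=
  Relation.ReflTransGen (fun x y => G.Adj x y ∧ Q y) u v

lemma Conn.prop {Q : V → Prop} {u v : V} (h : Conn G Q u v) (hu : Q u) : Q v := by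
  induction h with
  | refl => exact hu
  | tail _ h _ => exact h.2

lemma Conn.trans {Q : V → Prop} {u v w : V} (h : Conn G Q u v) (h' : Conn G Q v w) :
    Conn G Q u w := Relation.ReflTransGen.trans h h'

lemma Conn.snoc {Q : V → Prop} {u v w : V} (h : Conn G Q u v) (h' : G.Adj v w) (hw : Q w) :
    Conn G Q u w := Relation.ReflTransGen.tail h ⟨h', hw⟩

lemma Conn.symm {Q : V → Prop} {u v : V} (h : Conn G Q u v) (hu : Q u) : Conn G Q v u := by
  induction h with
  | refl => exact Relation.ReflTransGen.refl
  | tail h1 h2 ih =>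
    exact Conn.trans (Relation.ReflTransGen.single ⟨h2.1.symm, Conn.prop h1 hu⟩) ih

lemma Conn.pth {Q : V → Prop} {u v : V} (h : Conn G Q u v) (hu : Q u) :
    ∃ I, Pth G u v I ∧ ∀ x ∈ I, Conn G Q u x ∧ Q x := by
  induction h with
  | refl =>
    exact ⟨{u}, Pth.single u, fun x hx => by
      rw [Finset.mem_singleton.1 hx]; exact ⟨Relation.ReflTransGen.refl, hu⟩⟩
  | @tail b d h1 h2 ih =>
    obtain ⟨I, hI, hQ⟩ := ih
    by_cases hd : d ∈ I
    · obtain ⟨r, n, hr, rfl, rfl, rfl⟩ := hI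
      obtain ⟨t, _, ht, rfl⟩ := mem_seg.1 hd
      refine ⟨seg r 0 t, hr.pth_seg (Nat.zero_le t) ht, fun x hx => hQ x ?_⟩
      obtain ⟨s, _, hs, rfl⟩ := mem_seg.1 hx
      exact seg_mem (Nat.zero_le _) (by omega)
    · refine ⟨_, hI.snoc h2.1 hd, fun x hx => ?_⟩
      rcases Finset.mem_insert.1 hx with rfl | hx
      · exact ⟨Conn.snoc h1 h2.1 h2.2, h2.2⟩
      · exact hQ x hx

lemma Conn.mono {Q Q' : V → Prop} (hQ : ∀ x, Q x → Q' x) {u v : V} (h : Conn G Q u v) :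
    Conn G Q' u v := by
  induction h with
  | refl => exact Relation.ReflTransGen.refl
  | tail _ h2 ih => exact Conn.snoc ih h2.1 (hQ _ h2.2)

/-- Two vertices of a cycle are joined by an arc containing more than half of it. -/
lemma Pth.long_arc {a b p q : V} {Z : Finset V} (h : Pth G a b Z) (hab : G.Adj a b)
    (hp : p ∈ Z) (hq : q ∈ Z) (hpq : p ≠ q) :
    ∃ S ⊆ Z, Pth G p q S ∧ Z.card + 2 ≤ 2 * S.card := by
  obtain ⟨r, n, hr, rfl, rfl, rfl⟩ := h
  have key : ∀ i j, i < j → j ≤ n → ∃ S ⊆ seg r 0 n, Pth G (r i) (r j) S ∧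
      (seg r 0 n).card + 2 ≤ 2 * S.card := by
    intro i j hij hj
    have c0 := hr.card_seg (a := 0) le_rfl
    by_cases hl : n + 3 ≤ 2 * (j + 1 - i)
    · refine ⟨seg r i j, ?_, hr.pth_seg hij.le hj, ?_⟩
      · intro x hx
        obtain ⟨t, h1, h2, rfl⟩ := mem_seg.1 hx
        exact seg_mem (Nat.zero_le _) (by omega)
      · rw [hr.card_seg hj]; omega
    · have hd : Disjoint (seg r 0 i) (seg r j n) := by
        rw [Finset.disjoint_left]
        intro x hx hx'
        obtain ⟨t, h1, h2, rfl⟩ := mem_seg.1 hx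
        rw [hr.mem_seg_iff le_rfl (by omega)] at hx'
        omega
      refine ⟨seg r 0 i ∪ seg r j n, ?_,
        (hr.pth_seg (Nat.zero_le i) (by omega)).symm.append (hr.pth_seg hj le_rfl).symm hab hd, ?_⟩
      · intro x hx
        rcases Finset.mem_union.1 hx with hx | hx <;>
        · obtain ⟨t, h1, h2, rfl⟩ := mem_seg.1 hx
          exact seg_mem (Nat.zero_le _) (by omega)
      · have c1 := hr.card_seg (a := 0) (b := i) (by omega)
        have c2 := hr.card_seg (a := j) (b := n) le_rfl
        rw [Finset.card_union_of_disjoint hd]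
        omega
  obtain ⟨i, _, hi, rfl⟩ := mem_seg.1 hp
  obtain ⟨j, _, hj, rfl⟩ := mem_seg.1 hq
  rcases lt_trichotomy i j with h | h | h
  · exact key i j h hj
  · exact absurd (by rw [h]) hpq
  · obtain ⟨S, h1, h2, h3⟩ := key j i h hi
    exact ⟨S, h1, h2.symm, h3⟩

/-- A cycle can be opened at consecutive vertices `r i`, `r (i + 1)`. -/
lemma IP.open_at {r : ℕ → V} {n i : ℕ} (h : IP G r n) (hc : G.Adj (r 0) (r n)) (hi : i < n) :
    Pth G (r i) (r (i + 1)) (seg r 0 n) := by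
  have hd : Disjoint (seg r 0 i) (seg r (i + 1) n) := by
    rw [Finset.disjoint_left]
    intro x hx hx'
    obtain ⟨t, h1, h2, rfl⟩ := mem_seg.1 hx
    rw [h.mem_seg_iff le_rfl (by omega)] at hx'
    omega
  have := (h.pth_seg (Nat.zero_le i) (by omega)).symm.append
    (h.pth_seg (a := i + 1) hi le_rfl).symm hc hd
  convert this using 1
  ext x
  rw [Finset.mem_union, mem_seg, mem_seg, mem_seg]
  constructor
  · rintro ⟨t, h1, h2, h3⟩
    by_cases h : t ≤ i
    · exact Or.inl ⟨t, h1, h, h3⟩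
    · exact Or.inr ⟨t, by omega, h2, h3⟩
  · rintro (⟨t, h1, h2, h3⟩ | ⟨t, h1, h2, h3⟩)
    · exact ⟨t, h1, by omega, h3⟩
    · exact ⟨t, by omega, h2, h3⟩

lemma Pth.rotate {a b v : V} {Z : Finset V} (h : Pth G a b Z) (hab : G.Adj a b) (hv : v ∈ Z) :
    ∃ v', G.Adj v' v ∧ Pth G v' v Z := by
  obtain ⟨r, n, hr, rfl, rfl, rfl⟩ := h
  obtain ⟨i, _, hi, rfl⟩ := mem_seg.1 hv
  rcases hi.eq_or_lt with h | h
  · subst h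
    exact ⟨r 0, hab, hr.pth⟩
  · exact ⟨r (i + 1), (hr.1 i h).symm, (hr.open_at hab h).symm⟩

/-- The neighbours of `v` in `U`. -/
noncomputable def nb (G : SimpleGraph V) (U : Finset V) (v : V) : Finset V := U.filter (G.Adj v)

lemma mem_nb {U : Finset V} {v x : V} : x ∈ nb G U v ↔ x ∈ U ∧ G.Adj v x := by simp [nb]

/-- `G` is properly 2-coloured by `col`, the `2c`-periodic sequence `z` runs around a cycle of
length `2c`, and `G` has no longer cycle. -/
structure Ctx (G : SimpleGraph V) (col : V → Bool) (c : ℕ) (z : ℕ → V) : Prop where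
  hcol : ∀ u v, G.Adj u v → col u ≠ col v
  hc : 2 ≤ c
  zadj : ∀ i, G.Adj (z i) (z (i + 1))
  zper : ∀ i, z (i + 2 * c) = z i
  zinj : ∀ i j, i < j → j < i + 2 * c → z i ≠ z j
  nolong : ∀ u v S, Pth G u v S → G.Adj u v → S.card ≤ 2 * c

/-- The vertex set of the cycle run through by `z`. -/
def cyc (c : ℕ) (z : ℕ → V) : Finset V := seg z 0 (2 * c - 1)

lemma IP.col_eq {r : ℕ → V} {n : ℕ} {col : V → Bool} (hcol : ∀ u v, G.Adj u v → col u ≠ col v)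
    (h : ∀ i < n, G.Adj (r i) (r (i + 1))) {i j : ℕ} (hi : i ≤ n) (hj : j ≤ n) :
    col (r i) = col (r j) ↔ i % 2 = j % 2 := by
  have key : ∀ t ≤ n, col (r t) = if t % 2 = 0 then col (r 0) else !col (r 0) := by
    intro t ht
    induction t with
    | zero => simp
    | succ t ih =>
      have h1 := ih (by omega)
      have h2 := hcol _ _ (h t (by omega))
      rcases Nat.mod_two_eq_zero_or_one t with h3 | h3
      · rw [if_pos h3] at h1
        rw [if_neg (by omega)]
        revert h1 h2
        cases col (r t) <;> cases col (r (t + 1)) <;> cases col (r 0) <;> simp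
      · rw [if_neg (by omega)] at h1
        rw [if_pos (by omega)]
        revert h1 h2
        cases col (r t) <;> cases col (r (t + 1)) <;> cases col (r 0) <;> simp
  rw [key i hi, key j hj]
  rcases Nat.mod_two_eq_zero_or_one i with h3 | h3 <;>
  rcases Nat.mod_two_eq_zero_or_one j with h4 | h4 <;> simp [h3, h4]

namespace Ctx

variable {col : V → Bool} {c : ℕ} {z : ℕ → V}

lemma col_z (h : Ctx G col c z) {i j : ℕ} : col (z i) = col (z j) ↔ i % 2 = j % 2 :=
  IP.col_eq (n := i + j) h.hcol (fun i _ => h.zadj i) (by omega) (by omega)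

lemma col_nb (h : Ctx G col c z) {u v x : V} (h1 : G.Adj u x) (h2 : G.Adj v x) :
    col u = col v := by
  have h3 := h.hcol _ _ h1
  have h4 := h.hcol _ _ h2
  revert h3 h4
  cases col u <;> cases col v <;> cases col x <;> simp

lemma zmem (h : Ctx G col c z) (i : ℕ) : z i ∈ cyc c z := by
  have hc := h.hc
  induction i using Nat.strong_induction_on with
  | _ i ih =>
    by_cases hi : i < 2 * c
    · exact seg_mem (Nat.zero_le _) (by omega)
    · have := ih (i - 2 * c) (by omega)
      rwa [← h.zper, show i - 2 * c + 2 * c = i by omega] at this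

lemma surj (h : Ctx G col c z) {x : V} (hx : x ∈ cyc c z) (a : ℕ) :
    ∃ t, a < t ∧ t ≤ a + 2 * c ∧ z t = x := by
  have hc := h.hc
  induction a with
  | zero =>
    obtain ⟨t, _, h2, h3⟩ := mem_seg.1 hx
    rcases Nat.eq_zero_or_pos t with h4 | h4
    · exact ⟨2 * c, by omega, by omega, by rw [← h3, h4, ← h.zper 0]; simp⟩
    · exact ⟨t, h4, by omega, h3⟩
  | succ a ih =>
    obtain ⟨t, h1, h2, h3⟩ := ih
    by_cases h4 : t = a + 1
    · exact ⟨t + 2 * c, by omega, by omega, by rw [h.zper, h3]⟩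
    · exact ⟨t, by omega, by omega, h3⟩

lemma inj (h : Ctx G col c z) {i j : ℕ} (hij : z i = z j) (h1 : i < j + 2 * c)
    (h2 : j < i + 2 * c) : i = j := by
  rcases lt_trichotomy i j with h3 | h3 | h3
  · exact absurd hij (h.zinj i j h3 h2)
  · exact h3
  · exact absurd hij.symm (h.zinj j i h3 h1)

lemma ip (h : Ctx G col c z) (a : ℕ) {n : ℕ} (hn : n < 2 * c) : IP G (fun t => z (a + t)) n :=
  ⟨fun i _ => h.zadj (a + i), fun i hi j hj hij => by
    have := h.inj hij (by omega) (by omega)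
    omega⟩

lemma arc (h : Ctx G col c z) {a b : ℕ} (hab : a ≤ b) (hb : b < a + 2 * c) :
    Pth G (z a) (z b) (seg z a b) ∧ (seg z a b).card = b + 1 - a ∧ seg z a b ⊆ cyc c z := by
  have h1 := h.ip a (n := b - a) (by omega)
  have e : seg (fun t => z (a + t)) 0 (b - a) = seg z a b := by
    ext x
    rw [mem_seg, mem_seg]
    constructor
    · rintro ⟨t, _, h2, h3⟩; exact ⟨a + t, by omega, by omega, h3⟩
    · rintro ⟨t, h1, h2, h3⟩
      exact ⟨t - a, by omega, by omega, by rw [← h3]; congr 1; omega⟩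
  refine ⟨?_, ?_, ?_⟩
  · have := h1.pth
    rw [e] at this
    simpa [show a + (b - a) = b by omega] using this
  · rw [← e, h1.card_seg le_rfl]; omega
  · intro x hx
    obtain ⟨t, _, _, rfl⟩ := mem_seg.1 hx
    exact h.zmem t

lemma card_cyc (h : Ctx G col c z) : (cyc c z).card = 2 * c := by
  have hc := h.hc
  have := (h.arc (a := 0) (b := 2 * c - 1) (by omega) (by omega)).2.1
  unfold cyc
  omega

/-- A path outside the cycle and an arc of the cycle with adjacent ends form a cycle. -/
lemma attach (h : Ctx G col c z) {v w : V} {S : Finset V} (hS : Pth G v w S)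
    (hd : Disjoint S (cyc c z)) {a b : ℕ} (hv : G.Adj v (z a)) (hw : G.Adj w (z b))
    (hab : a < b) (hb : b < a + 2 * c) : a + S.card + 1 ≤ b := by
  obtain ⟨h1, h2, h3⟩ := h.arc (a := b) (b := a + 2 * c) (by omega) (by omega)
  have hd' : Disjoint (seg z b (a + 2 * c)) S := (hd.mono_right h3).symm
  have := h.nolong _ _ _ (h1.append hS (by rw [h.zper]; exact hv.symm) hd') hw.symm
  rw [Finset.card_union_of_disjoint hd'] at this
  omega

lemma card_nb_erase_le (h : Ctx G col c z) {v w : V} {S : Finset V} (hS : Pth G v w S)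
    (hd : Disjoint S (cyc c z)) {a : ℕ} (hv : G.Adj v (z a)) :
    ((nb G (cyc c z) w).erase (z a)).card ≤ c - S.card := by
  have hc := h.hc
  set A := (Finset.Ioo a (a + 2 * c)).filter (fun t => G.Adj w (z t)) with hA
  have h1 : (nb G (cyc c z) w).erase (z a) ⊆ A.image z := by
    intro x hx
    rw [Finset.mem_erase, mem_nb] at hx
    obtain ⟨t, h1, h2, rfl⟩ := h.surj hx.2.1 a
    refine Finset.mem_image_of_mem _ ?_
    rw [hA, Finset.mem_filter, Finset.mem_Ioo]
    refine ⟨⟨h1, ?_⟩, hx.2.2⟩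
    rcases h2.eq_or_lt with h3 | h3
    · rw [h3, h.zper] at hx
      exact absurd rfl hx.1
    · exact h3
  refine (Finset.card_le_card h1).trans (Finset.card_image_le.trans ?_)
  have h2 : ∀ t ∈ A, a + S.card + 1 ≤ t ∧ t + S.card + 1 ≤ a + 2 * c ∧ G.Adj w (z t) := by
    intro t ht
    rw [hA, Finset.mem_filter, Finset.mem_Ioo] at ht
    refine ⟨h.attach hS hd hv ht.2 ht.1.1 ht.1.2, ?_, ht.2⟩
    exact h.attach (a := t) (b := a + 2 * c) hS.symm hd ht.2 (by rw [h.zper]; exact hv)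
      ht.1.2 (by omega)
  rw [← Finset.card_range (c - S.card)]
  refine Finset.card_le_card_of_injOn (fun t => (t - a - S.card - 1) / 2) ?_ ?_
  · intro t ht
    have := h2 t ht
    simp only [Finset.coe_range, Set.mem_Iio]
    omega
  · intro t ht s hs hts
    have h3 := h2 t ht
    have h4 := h2 s hs
    have := (h.col_z (i := t) (j := s)).1 (h.col_nb h3.2.2.symm h4.2.2.symm)
    simp only at hts
    omega

end Ctx

lemma spaced {A : Finset ℕ} {p q : ℕ} (hpq : p ≤ q) (h1 : ∀ t ∈ A, p ≤ t ∧ t ≤ q)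
    (h2 : ∀ t ∈ A, t + 1 ∉ A) : 2 * A.card + p ≤ q + 2 := by
  have : A.card ≤ (Finset.range ((q - p) / 2 + 1)).card := by
    refine Finset.card_le_card_of_injOn (fun t => (t - p) / 2) ?_ ?_
    · intro t ht
      have := h1 t ht
      simp only [Finset.coe_range, Set.mem_Iio]
      omega
    · intro t ht s hs hts
      have h3 := h1 t ht
      have h4 := h1 s hs
      simp only at hts
      by_contra hne
      rcases lt_or_gt_of_ne hne with h | h
      · exact h2 t ht (by rwa [show t + 1 = s by omega])
      · exact h2 s hs (by rwa [show s + 1 = t by omega])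
  rw [Finset.card_range] at this
  omega

namespace Ctx

variable {col : V → Bool} {c : ℕ} {z : ℕ → V}

lemma card_nb_add_le (h : Ctx G col c z) {u w : V} {S : Finset V} (hS : Pth G u w S)
    (hd : Disjoint S (cyc c z)) (huw : col u ≠ col w) (hu : (nb G (cyc c z) u).Nonempty)
    (hw : (nb G (cyc c z) w).Nonempty) :
    (nb G (cyc c z) u).card + (nb G (cyc c z) w).card + S.card ≤ c + 1 := by
  have hc := h.hc
  have hpos := hS.card_pos
  have hT : ∀ t, G.Adj u (z t) → ¬ G.Adj w (z t) := fun t h1 h2 => huw (h.col_nb h1 h2)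
  obtain ⟨x, hx⟩ := hw
  obtain ⟨y, hy⟩ := hu
  rw [mem_nb] at hx hy
  obtain ⟨a, -, -, rfl⟩ := h.surj hx.1 0
  have hwa := hx.2
  have hwa' : G.Adj w (z (a + 2 * c)) := by rw [h.zper]; exact hwa
  -- first neighbour of `u` after `a`
  have e1 : ∃ m, a < m ∧ G.Adj u (z m) := by
    obtain ⟨t, h1, h2, rfl⟩ := h.surj hy.1 a
    exact ⟨t, h1, hy.2⟩
  obtain ⟨m, ⟨hm1, hm2⟩, hm3⟩ : ∃ m, (a < m ∧ G.Adj u (z m)) ∧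
      ∀ t, t < m → ¬ (a < t ∧ G.Adj u (z t)) := ⟨_, Nat.find_spec e1, fun t => Nat.find_min e1⟩
  have hmb : m < a + 2 * c := by
    obtain ⟨t, h1, h2, rfl⟩ := h.surj hy.1 a
    by_contra hcon
    refine hm3 t ?_ ⟨h1, hy.2⟩
    rcases h2.eq_or_lt with h3 | h3
    · rw [h3] at hy; exact absurd hwa' (hT _ hy.2)
    · omega
  -- last neighbour of `w` before `m`
  let l := Nat.findGreatest (fun t => G.Adj w (z t)) m
  have hl1 : G.Adj w (z l) := Nat.findGreatest_spec (P := fun t => G.Adj w (z t)) hm1.le hwa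
  have hl2 : a ≤ l := Nat.le_findGreatest hm1.le hwa
  have hl3 : l < m := lt_of_le_of_ne (Nat.findGreatest_le m) (by
    intro h1; rw [h1] at hl1; exact hT _ hm2 hl1)
  have hl4 : ∀ t, l < t → t ≤ m → ¬ G.Adj w (z t) := fun t h1 h2 =>
    Nat.findGreatest_is_greatest h1 h2
  -- first neighbour of `w` after `m`
  have e2 : ∃ m', m < m' ∧ G.Adj w (z m') := ⟨a + 2 * c, hmb, hwa'⟩
  obtain ⟨m', ⟨hn1, hn2⟩, hn3⟩ : ∃ m', (m < m' ∧ G.Adj w (z m')) ∧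
      ∀ t, t < m' → ¬ (m < t ∧ G.Adj w (z t)) := ⟨_, Nat.find_spec e2, fun t => Nat.find_min e2⟩
  have hnb : m' ≤ a + 2 * c := by
    by_contra hcon
    exact hn3 (a + 2 * c) (by omega) ⟨hmb, hwa'⟩
  -- last neighbour of `u` before that neighbour
  let l' := Nat.findGreatest (fun t => G.Adj u (z t)) m'
  have hk1 : G.Adj u (z l') := Nat.findGreatest_spec (P := fun t => G.Adj u (z t)) hn1.le hm2
  have hk2 : m ≤ l' := Nat.le_findGreatest hn1.le hm2
  have hk3 : l' < m' := lt_of_le_of_ne (Nat.findGreatest_le m') (by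
    intro h1; rw [h1] at hk1; exact hT _ hk1 hn2)
  have hk4 : ∀ t, l' < t → t ≤ m' → ¬ G.Adj u (z t) := fun t h1 h2 =>
    Nat.findGreatest_is_greatest h1 h2
  have g1 := h.attach hS.symm hd hl1 hm2 hl3 (by omega)
  have g2 := h.attach hS hd hk1 hn2 hk3 (by omega)
  set A := (Finset.Ioc l (l + 2 * c)).filter (fun t => G.Adj u (z t) ∨ G.Adj w (z t)) with hA
  have hcons : ∀ t, (G.Adj u (z t) ∨ G.Adj w (z t)) →
      ¬ (G.Adj u (z (t + 1)) ∨ G.Adj w (z (t + 1))) := by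
    rintro t (h1 | h1) (h2 | h2)
    · have := (h.col_z (i := t) (j := t + 1)).1 (h.col_nb h1.symm h2.symm)
      omega
    · have := h.attach hS hd h1 h2 (by omega) (by omega)
      omega
    · have := h.attach hS.symm hd h1 h2 (by omega) (by omega)
      omega
    · have := (h.col_z (i := t) (j := t + 1)).1 (h.col_nb h1.symm h2.symm)
      omega
  have c1 : 2 * (A.filter (fun t => t ≤ l')).card + m ≤ l' + 2 := by
    refine spaced hk2 (fun t ht => ?_) (fun t ht ht' => ?_)
    · simp only [hA, Finset.mem_filter, Finset.mem_Ioc] at ht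
      refine ⟨?_, ht.2⟩
      by_contra hcon
      rcases ht.1.2 with h1 | h1
      · exact hm3 t (by omega) ⟨by omega, h1⟩
      · exact hl4 t (by omega) (by omega) h1
    · simp only [hA, Finset.mem_filter] at ht ht'
      exact hcons t ht.1.2 ht'.1.2
  have c2 : 2 * (A.filter (fun t => ¬ t ≤ l')).card + m' ≤ l + 2 * c + 2 := by
    refine spaced (by omega) (fun t ht => ?_) (fun t ht ht' => ?_)
    · simp only [hA, Finset.mem_filter, Finset.mem_Ioc] at ht
      refine ⟨?_, ht.1.1.2⟩
      by_contra hcon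
      rcases ht.1.2 with h1 | h1
      · exact hk4 t (by omega) (by omega) h1
      · exact hn3 t (by omega) ⟨by omega, h1⟩
    · simp only [hA, Finset.mem_filter] at ht ht'
      exact hcons t ht.1.2 ht'.1.2
  have c3 := Finset.card_filter_add_card_filter_not (s := A) (fun t => t ≤ l')
  have c4 : (nb G (cyc c z) u).card + (nb G (cyc c z) w).card ≤ A.card := by
    rw [← Finset.card_union_of_disjoint]
    · refine (Finset.card_le_card (t := A.image z) ?_).trans Finset.card_image_le
      intro x hx
      have hx' : x ∈ cyc c z := by
        rw [Finset.mem_union, mem_nb, mem_nb] at hx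
        rcases hx with hx | hx <;> exact hx.1
      obtain ⟨t, h1, h2, rfl⟩ := h.surj hx' l
      refine Finset.mem_image_of_mem _ ?_
      rw [Finset.mem_union, mem_nb, mem_nb] at hx
      rw [hA, Finset.mem_filter, Finset.mem_Ioc]
      exact ⟨⟨h1, h2⟩, hx.imp And.right And.right⟩
    · rw [Finset.disjoint_left]
      intro x hx hx'
      rw [mem_nb] at hx hx'
      exact huw (h.col_nb hx.2 hx'.2)
  omega

end Ctx

lemma nb_union {A B : Finset V} (h : Disjoint A B) (v : V) :
    (nb G (A ∪ B) v).card = (nb G A v).card + (nb G B v).card := by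
  unfold nb
  rw [Finset.filter_union, Finset.card_union_of_disjoint]
  exact Finset.disjoint_filter_filter h

lemma nb_mono {A B : Finset V} (h : A ⊆ B) (v : V) : nb G A v ⊆ nb G B v :=
  Finset.filter_subset_filter _ h

namespace Ctx

variable {col : V → Bool} {c : ℕ} {z : ℕ → V}

/-- The neighbours of the first vertex of a path have indices of the same parity. -/
lemma last_nb (h : Ctx G col c z) {r : ℕ → V} {n : ℕ} (hr : IP G r n) {W : Finset V}
    (h0 : nb G W (r 0) ⊆ seg r 0 n) (hne : (nb G W (r 0)).Nonempty) :
    ∃ t, t ≤ n ∧ G.Adj (r 0) (r t) ∧ 2 * (nb G W (r 0)).card ≤ t + 1 ∧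
      nb G W (r 0) ⊆ seg r 1 t := by
  obtain ⟨x, hx⟩ := hne
  obtain ⟨s, _, hs, rfl⟩ := mem_seg.1 (h0 hx)
  rw [mem_nb] at hx
  let t := Nat.findGreatest (fun t => G.Adj (r 0) (r t)) n
  have h1 : G.Adj (r 0) (r t) := Nat.findGreatest_spec (P := fun t => G.Adj (r 0) (r t)) hs hx.2
  have h2 : t ≤ n := Nat.findGreatest_le n
  have h3 : ∀ s, t < s → s ≤ n → ¬ G.Adj (r 0) (r s) := fun s h1 h2 =>
    Nat.findGreatest_is_greatest h1 h2
  have hodd : ∀ s ≤ n, G.Adj (r 0) (r s) → s % 2 = 1 := by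
    intro s hs ha
    have h4 := h.hcol _ _ ha
    rw [Ne, IP.col_eq h.hcol hr.1 (Nat.zero_le _) hs] at h4
    omega
  have h4 : nb G W (r 0) ⊆ seg r 1 t := by
    intro x hx
    obtain ⟨s, _, hs, rfl⟩ := mem_seg.1 (h0 hx)
    rw [mem_nb] at hx
    have := hodd s hs hx.2
    refine seg_mem (by omega) ?_
    by_contra hcon
    exact h3 s (by omega) hs hx.2
  refine ⟨t, h2, h1, ?_, h4⟩
  have ht := hodd t h2 h1
  set A := (Finset.Icc 1 t).filter (fun s => G.Adj (r 0) (r s)) with hA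
  have h5 : (nb G W (r 0)).card ≤ A.card := by
    refine (Finset.card_le_card (t := A.image r) ?_).trans Finset.card_image_le
    intro x hx
    obtain ⟨s, h5, h6, rfl⟩ := mem_seg.1 (h4 hx)
    refine Finset.mem_image_of_mem _ ?_
    rw [hA, Finset.mem_filter, Finset.mem_Icc]
    exact ⟨⟨h5, h6⟩, (mem_nb.1 hx).2⟩
  have h6 := spaced (A := A) (p := 1) (q := t) (by omega) (fun s hs => by
    rw [hA, Finset.mem_filter, Finset.mem_Icc] at hs; exact hs.1) (fun s hs hs' => by
    rw [hA, Finset.mem_filter, Finset.mem_Icc] at hs hs'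
    have := hodd s (by omega) hs.2
    have := hodd (s + 1) (by omega) hs'.2
    omega)
  omega

lemma card_nb_le (h : Ctx G col c z) {r : ℕ → V} {n : ℕ} (hr : IP G r n) {W : Finset V}
    (h0 : nb G W (r 0) ⊆ seg r 0 n) :
    (nb G W (r 0)).card ≤ c ∧ 2 * (nb G W (r 0)).card ≤ n + 1 := by
  rcases (nb G W (r 0)).eq_empty_or_nonempty with he | hne
  · simp [he]
  · obtain ⟨t, h1, h2, h3, -⟩ := h.last_nb hr h0 hne
    have h4 := h.nolong _ _ _ (hr.pth_seg (Nat.zero_le t) h1) h2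
    rw [hr.card_seg h1] at h4
    omega

/-- A path outside the cycle cannot have all the neighbours outside the cycle of both of its
ends on itself if the ends have degrees larger than `c`. -/
lemma not_saturated (h : Ctx G col c z) {r : ℕ → V} {n : ℕ} (hr : IP G r n) {W : Finset V}
    (hW : Disjoint W (cyc c z)) (hrW : seg r 0 n ⊆ W) (h0 : nb G W (r 0) ⊆ seg r 0 n)
    (hn : nb G W (r n) ⊆ seg r 0 n)
    (d0 : c + 1 ≤ (nb G (cyc c z ∪ W) (r 0)).card)
    (dn : c + 1 ≤ (nb G (cyc c z ∪ W) (r n)).card) : False := by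
  have hc := h.hc
  rw [nb_union hW.symm] at d0 dn
  have b0 := h.card_nb_le hr h0
  have bn := h.card_nb_le hr.reverse (W := W) (by rw [seg_reverse]; simpa using hn)
  simp only [Nat.sub_zero] at bn
  have hd : Disjoint (seg r 0 n) (cyc c z) := hW.mono_left hrW
  obtain ⟨x, hx⟩ : (nb G (cyc c z) (r n)).Nonempty := by
    rw [← Finset.card_pos]; omega
  rw [mem_nb] at hx
  obtain ⟨a, -, -, rfl⟩ := h.surj hx.1 0
  have h1 := h.card_nb_erase_le hr.pth.symm hd hx.2
  have h2 := Finset.pred_card_le_card_erase (s := nb G (cyc c z) (r 0)) (a := z a)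
  rw [hr.card_seg le_rfl] at h1
  by_cases hn : n + 1 ≤ c
  · omega
  · have h3 : (nb G (cyc c z) (r 0)).erase (z a) = ∅ := by
      rw [← Finset.card_eq_zero]; omega
    obtain ⟨y, hy⟩ : (nb G (cyc c z) (r 0)).Nonempty := by
      rw [← Finset.card_pos]; omega
    have hya : y = z a := by
      by_contra hcon
      have : y ∈ (nb G (cyc c z) (r 0)).erase (z a) := Finset.mem_erase.2 ⟨hcon, hy⟩
      simp [h3] at this
    subst hya
    have hnot : z a ∉ seg r 0 n := fun hm => Finset.disjoint_left.1 hd hm (h.zmem a)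
    have h5 := h.nolong _ _ _ (hr.pth.snoc hx.2 hnot) (mem_nb.1 hy).2
    rw [Finset.card_insert_of_notMem hnot, hr.card_seg le_rfl] at h5
    omega

end Ctx

/-- A minimal violator of Hall's condition. -/
lemma exists_violator {W Y : Finset V} (hY : (Y.biUnion (nb G W)).card < Y.card) :
    ∃ Y' ⊆ Y, Y'.Nonempty ∧ (Y'.biUnion (nb G W)).card + 1 = Y'.card ∧
      ∀ y ∈ Y', ∃ f : V → V, Set.InjOn f (Y'.biUnion (nb G W)) ∧
        ∀ x ∈ Y'.biUnion (nb G W), f x ∈ Y'.erase y ∧ G.Adj x (f x) := by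
  obtain ⟨Y', h1, h2⟩ := Finset.exists_min_image
    (Y.powerset.filter (fun A => (A.biUnion (nb G W)).card < A.card)) Finset.card
    ⟨Y, by simp [hY]⟩
  rw [Finset.mem_filter, Finset.mem_powerset] at h1
  have hmin : ∀ A ⊆ Y', A ≠ Y' → A.card ≤ (A.biUnion (nb G W)).card := by
    intro A hA hne
    by_contra hcon
    have h3 := h2 A (by
      rw [Finset.mem_filter, Finset.mem_powerset]
      exact ⟨hA.trans h1.1, by omega⟩)
    exact hne (Finset.eq_of_subset_of_card_le hA h3)
  have hne : Y'.Nonempty := Finset.card_pos.1 (by omega)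
  have hcard : (Y'.biUnion (nb G W)).card + 1 = Y'.card := by
    obtain ⟨y, hy⟩ := hne
    have h3 := hmin (Y'.erase y) (Finset.erase_subset _ _) (by
      intro he; rw [← he] at hy; simp at hy)
    have h4 := Finset.card_le_card
      (Finset.biUnion_subset_biUnion_of_subset_left (nb G W) (Finset.erase_subset y Y'))
    rw [Finset.card_erase_of_mem hy] at h3
    omega
  refine ⟨Y', h1.1, hne, hcard, fun y hy => ?_⟩
  have hall : ∀ s : Finset {a // a ∈ Y'.erase y},
      s.card ≤ (s.biUnion (fun a => nb G W a.1)).card := by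
    intro s
    have h3 := hmin (s.map (Function.Embedding.subtype _)) (by
      intro a ha
      simp only [Finset.mem_map, Function.Embedding.coe_subtype] at ha
      obtain ⟨b, _, rfl⟩ := ha
      exact Finset.mem_of_mem_erase b.2) (by
      intro he
      rw [← he] at hy
      simp only [Finset.mem_map, Function.Embedding.coe_subtype] at hy
      obtain ⟨b, _, hb⟩ := hy
      exact Finset.ne_of_mem_erase b.2 hb)
    rw [Finset.card_map] at h3
    refine h3.trans (Finset.card_le_card ?_)
    intro a ha
    simp only [Finset.mem_biUnion, Finset.mem_map, Function.Embedding.coe_subtype] at ha ⊢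
    obtain ⟨b, ⟨b', hb', rfl⟩, hab⟩ := ha
    exact ⟨b', hb', hab⟩
  obtain ⟨g, hg1, hg2⟩ := (Finset.all_card_le_biUnion_card_iff_exists_injective _).1 hall
  have himg : Finset.univ.image g = Y'.biUnion (nb G W) := by
    refine Finset.eq_of_subset_of_card_le ?_ ?_
    · intro x hx
      obtain ⟨a, _, rfl⟩ := Finset.mem_image.1 hx
      exact Finset.mem_biUnion.2 ⟨a.1, Finset.mem_of_mem_erase a.2, hg2 a⟩
    · rw [Finset.card_image_of_injective _ hg1, Finset.card_univ, Fintype.card_coe,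
        Finset.card_erase_of_mem hy]
      omega
  have hsurj : ∀ x, ∃ a : V, x ∈ Y'.biUnion (nb G W) →
      ∃ ha : a ∈ Y'.erase y, g ⟨a, ha⟩ = x := by
    intro x
    by_cases hx : x ∈ Y'.biUnion (nb G W)
    · have hx' := hx
      rw [← himg] at hx'
      obtain ⟨a, _, ha⟩ := Finset.mem_image.1 hx'
      exact ⟨a.1, fun _ => ⟨a.2, ha⟩⟩
    · exact ⟨x, fun h => absurd h hx⟩
  choose f hf using hsurj
  refine ⟨f, fun x hx x' hx' he => ?_, fun x hx => ?_⟩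
  · obtain ⟨ha, hga⟩ := hf x hx
    obtain ⟨ha', hga'⟩ := hf x' hx'
    rw [← hga, ← hga']
    congr 1
    exact Subtype.ext he
  · obtain ⟨ha, hga⟩ := hf x hx
    refine ⟨ha, ?_⟩
    have := (mem_nb.1 (hg2 ⟨f x, ha⟩)).2
    rw [hga] at this
    exact this.symm

/-- The vertices of `X` outside `S` can be matched into `Y` outside `S`. -/
def Mt (G : SimpleGraph V) (X Y S : Finset V) : Prop :=
  ∃ f : V → V, Set.InjOn f (X \ S : Finset V) ∧ ∀ x ∈ X \ S, f x ∈ Y \ S ∧ G.Adj x (f x)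

/-- A path ending in `Y` can be prolonged until its end has all its neighbours on the path. -/
lemma Mt.saturate {W X Y : Finset V} (hXY : Disjoint X Y) (hN : ∀ y ∈ Y, nb G W y ⊆ X) (k : ℕ) :
    ∀ {S : Finset V} {h w : V}, (X \ S).card ≤ k → Pth G h w S → w ∈ Y → Mt G X Y S →
    ∃ w' S', S ⊆ S' ∧ Pth G h w' S' ∧ w' ∈ Y ∧ Mt G X Y S' ∧ nb G W w' ⊆ S' ∧
      S' ⊆ S ∪ (X ∪ Y) := by
  induction k with
  | zero =>
    intro S h w hk hp hw hm
    refine ⟨w, S, subset_rfl, hp, hw, hm, ?_, Finset.subset_union_left⟩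
    have : X \ S = ∅ := Finset.card_eq_zero.1 (by omega)
    exact (hN w hw).trans (Finset.sdiff_eq_empty_iff_subset.1 this)
  | succ k ih =>
    intro S h w hk hp hw hm
    by_cases hs : nb G W w ⊆ S
    · exact ⟨w, S, subset_rfl, hp, hw, hm, hs, Finset.subset_union_left⟩
    · obtain ⟨x, hx, hxS⟩ := Finset.not_subset.1 hs
      have hxX := hN w hw hx
      have hxs : x ∈ X \ S := Finset.mem_sdiff.2 ⟨hxX, hxS⟩
      obtain ⟨f, hf1, hf2⟩ := hm
      obtain ⟨hfx, hfa⟩ := hf2 x hxs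
      rw [Finset.mem_sdiff] at hfx
      have p1 := hp.snoc (mem_nb.1 hx).2 hxS
      have p2 := p1.snoc hfa (by
        rw [Finset.mem_insert, not_or]
        exact ⟨hfa.ne', hfx.2⟩)
      obtain ⟨w', S', g1, g2, g3, g4, g5, g6⟩ := ih (S := insert (f x) (insert x S)) (by
          have : X \ insert (f x) (insert x S) ⊆ (X \ S).erase x := by
            intro a ha
            simp only [Finset.mem_sdiff, Finset.mem_insert, not_or, Finset.mem_erase] at ha ⊢
            tauto
          have h1 := Finset.card_le_card this
          rw [Finset.card_erase_of_mem hxs] at h1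
          omega) p2 hfx.1 ⟨f, fun a ha b hb hab => hf1 (by
            simp only [Finset.coe_sdiff, Set.mem_sdiff, Finset.mem_coe, Finset.mem_insert] at ha ⊢
            tauto) (by
            simp only [Finset.coe_sdiff, Set.mem_sdiff, Finset.mem_coe, Finset.mem_insert] at hb ⊢
            tauto) hab, fun a ha => by
            simp only [Finset.mem_sdiff, Finset.mem_insert, not_or] at ha
            have has : a ∈ X \ S := Finset.mem_sdiff.2 ⟨ha.1, ha.2.2.2⟩
            obtain ⟨q1, q2⟩ := hf2 a has
            rw [Finset.mem_sdiff] at q1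
            refine ⟨?_, q2⟩
            simp only [Finset.mem_sdiff, Finset.mem_insert, not_or]
            refine ⟨q1.1, ?_, ?_, q1.2⟩
            · exact fun he => ha.2.2.1 (hf1 (by simpa using has) (by simpa using hxs) he)
            · rintro rfl
              exact Finset.disjoint_left.1 hXY hxX q1.1⟩
      refine ⟨w', S', ?_, g2, g3, g4, g5, ?_⟩
      · exact (Finset.subset_insert _ _).trans ((Finset.subset_insert _ _).trans g1)
      · refine g6.trans ?_
        intro a ha
        simp only [Finset.mem_union, Finset.mem_insert] at ha ⊢
        rcases ha with (rfl | rfl | ha) | ha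
        · exact Or.inr (Or.inr hfx.1)
        · exact Or.inr (Or.inl hxX)
        · exact Or.inl ha
        · exact Or.inr ha

/-- Twice the number of edges inside `A`. -/
noncomputable def degSum (G : SimpleGraph V) (A : Finset V) : ℕ := ∑ v ∈ A, (nb G A v).card

/-- The number of vertices of `A` of colour `b`. -/
noncomputable def cnt (col : V → Bool) (b : Bool) (A : Finset V) : ℕ :=
  (A.filter (fun v => col v = b)).card

lemma sum_nb_comm (A B : Finset V) :
    ∑ v ∈ A, (nb G B v).card = ∑ v ∈ B, (nb G A v).card := by
  have := Finset.sum_card_bipartiteAbove_eq_sum_card_bipartiteBelow (s := A) (t := B) G.Adj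
  unfold Finset.bipartiteAbove Finset.bipartiteBelow at this
  unfold nb
  rw [this]
  refine Finset.sum_congr rfl fun v _ => ?_
  congr 1
  exact Finset.filter_congr fun x _ => G.adj_comm x v

lemma degSum_union {A B : Finset V} (h : Disjoint A B) :
    degSum G (A ∪ B) = degSum G A + 2 * ∑ v ∈ B, (nb G A v).card + degSum G B := by
  unfold degSum
  rw [Finset.sum_union h]
  simp only [nb_union h, Finset.sum_add_distrib]
  rw [sum_nb_comm A B]
  ring

lemma degSum_sdiff {U D : Finset V} (h : D ⊆ U) :
    degSum G U = degSum G (U \ D) + 2 * ∑ v ∈ D, (nb G (U \ D) v).card + degSum G D := by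
  rw [← degSum_union Finset.sdiff_disjoint, Finset.sdiff_union_of_subset h]

lemma cnt_add (col : V → Bool) (A : Finset V) : cnt col true A + cnt col false A = A.card := by
  have := Finset.card_filter_add_card_filter_not (s := A) (fun v => col v = true)
  simpa [cnt] using this

lemma cnt_add_not (col : V → Bool) (b : Bool) (A : Finset V) :
    cnt col b A + cnt col (!b) A = A.card := by
  rw [← cnt_add col A]
  cases b <;> simp [add_comm]

lemma cnt_sdiff {col : V → Bool} {b : Bool} {A D : Finset V} (h : D ⊆ A) :
    cnt col b (A \ D) = cnt col b A - cnt col b D := by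
  unfold cnt
  rw [← Finset.card_sdiff_of_subset (Finset.filter_subset_filter _ h)]
  congr 1
  ext x
  simp only [Finset.mem_filter, Finset.mem_sdiff]
  tauto

lemma cnt_mono {col : V → Bool} {b : Bool} {A D : Finset V} (h : D ⊆ A) :
    cnt col b D ≤ cnt col b A := Finset.card_le_card (Finset.filter_subset_filter _ h)

lemma card_nb_le_cnt {col : V → Bool} (hcol : ∀ u v, G.Adj u v → col u ≠ col v) (A : Finset V)
    (v : V) : (nb G A v).card ≤ cnt col (!col v) A := by
  refine Finset.card_le_card fun x hx => ?_
  rw [mem_nb] at hx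
  rw [Finset.mem_filter]
  have := hcol _ _ hx.2
  refine ⟨hx.1, ?_⟩
  revert this
  cases col v <;> cases col x <;> simp

lemma sum_col (col : V → Bool) (A : Finset V) (f : V → ℕ) :
    ∑ v ∈ A, f v = ∑ v ∈ A.filter (fun v => col v = true), f v +
      ∑ v ∈ A.filter (fun v => col v = false), f v := by
  rw [← Finset.sum_filter_add_sum_filter_not A (fun v => col v = true)]
  simp

lemma degSum_le {col : V → Bool} (hcol : ∀ u v, G.Adj u v → col u ≠ col v) (A : Finset V) :
    degSum G A ≤ 2 * (cnt col true A * cnt col false A) := by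
  unfold degSum
  rw [sum_col col A]
  have h1 : ∑ v ∈ A.filter (fun v => col v = true), (nb G A v).card ≤
      cnt col true A * cnt col false A := by
    rw [cnt, ← smul_eq_mul]
    refine Finset.sum_le_card_nsmul _ _ _ fun v hv => ?_
    have := card_nb_le_cnt hcol A v
    rwa [(Finset.mem_filter.1 hv).2] at this
  have h2 : ∑ v ∈ A.filter (fun v => col v = false), (nb G A v).card ≤
      cnt col false A * cnt col true A := by
    rw [cnt, ← smul_eq_mul]
    refine Finset.sum_le_card_nsmul _ _ _ fun v hv => ?_
    have := card_nb_le_cnt hcol A v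
    rwa [(Finset.mem_filter.1 hv).2] at this
  rw [mul_comm (cnt col false A)] at h2
  omega

/-- A balanced set `W` of at most `2c` vertices off the cycle such that every subset of `W` is
incident with many edges of the subgraph induced on the union of `W` and the cycle. -/
structure Core (G : SimpleGraph V) (col : V → Bool) (c : ℕ) (z : ℕ → V) (W : Finset V)
    (m : ℕ) : Prop extends Ctx G col c z where
  hW : Disjoint W (cyc c z)
  hcnt : ∀ b, cnt col b W = m
  hm : m ≤ c
  drop : ∀ D ⊆ W, D.Nonempty →
    2 * (c * min (cnt col true D) (cnt col false D) + max (cnt col true D) (cnt col false D)) <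
      2 * ∑ v ∈ D, (nb G ((cyc c z ∪ W) \ D) v).card + degSum G D

namespace Core

variable {col : V → Bool} {c m : ℕ} {z : ℕ → V} {W : Finset V}

lemma card_W (h : Core G col c z W m) : W.card = 2 * m := by
  rw [← cnt_add col W, h.hcnt, h.hcnt]; ring

lemma two_le_card_nb_add (h : Core G col c z W m) {u w : V} (hu : u ∈ W) (hw : w ∈ W)
    (huw : col u ≠ col w) :
    c + 2 ≤ (nb G (cyc c z ∪ W) u).card + (nb G (cyc c z ∪ W) w).card := by
  have hne : u ≠ w := fun e => huw (by rw [e])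
  have h1 := h.drop {u, w} (by intro x; simp only [Finset.mem_insert, Finset.mem_singleton]; rintro (rfl | rfl) <;> assumption) ⟨u, by simp⟩
  have hc : ∀ b, cnt col b {u, w} = 1 := by
    intro b
    rw [cnt, Finset.card_eq_one]
    by_cases hb : col u = b
    · refine ⟨u, ?_⟩
      ext x
      simp only [Finset.mem_filter, Finset.mem_insert, Finset.mem_singleton]
      constructor
      · rintro ⟨rfl | rfl, hx⟩
        · rfl
        · exact absurd (hb.trans hx.symm) huw
      · rintro rfl
        exact ⟨Or.inl rfl, hb⟩
    · refine ⟨w, ?_⟩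
      ext x
      simp only [Finset.mem_filter, Finset.mem_insert, Finset.mem_singleton]
      constructor
      · rintro ⟨rfl | rfl, hx⟩
        · exact absurd hx hb
        · rfl
      · rintro rfl
        refine ⟨Or.inr rfl, ?_⟩
        revert huw hb
        cases col u <;> cases col x <;> cases b <;> simp
  have hsp : ∀ v, (nb G (cyc c z ∪ W) v).card =
      (nb G ((cyc c z ∪ W) \ {u, w}) v).card + (nb G {u, w} v).card := by
    intro v
    rw [← nb_union Finset.sdiff_disjoint, Finset.sdiff_union_of_subset]
    intro x
    simp only [Finset.mem_insert, Finset.mem_singleton, Finset.mem_union]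
    rintro (rfl | rfl) <;> exact Or.inr (by assumption)
  rw [hc, hc, degSum, Finset.sum_pair hne, Finset.sum_pair hne] at h1
  rw [hsp u, hsp w]
  have b1 := card_nb_le_cnt h.hcol {u, w} u
  have b2 := card_nb_le_cnt h.hcol {u, w} w
  rw [hc] at b1 b2
  simp only [min_self, max_self] at h1
  omega

/-- No set of vertices off the cycle can be separated by one vertex. -/
lemma exists_boundary (h : Core G col c z W m) {D : Finset V} (hD : D ⊆ W) (hne : D.Nonempty)
    (q : V) : ∃ p ∈ (cyc c z ∪ W) \ D, p ≠ q ∧ ∃ v ∈ D, G.Adj v p := by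
  by_contra hcon
  push Not at hcon
  have h1 := h.drop D hD hne
  have h2 := degSum_le h.hcol D
  have h3 : ∑ v ∈ D, (nb G ((cyc c z ∪ W) \ D) v).card ≤
      max (cnt col true D) (cnt col false D) := by
    have : ∀ v ∈ D, (nb G ((cyc c z ∪ W) \ D) v).card ≤ if G.Adj q v then 1 else 0 := by
      intro v hv
      have hs : nb G ((cyc c z ∪ W) \ D) v ⊆ {q} := by
        intro x hx
        rw [mem_nb] at hx
        rw [Finset.mem_singleton]
        by_contra hx'
        exact hcon x hx.1 hx' v hv hx.2
      split_ifs with hq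
      · exact (Finset.card_le_card hs).trans (by simp)
      · rw [Nat.le_zero, Finset.card_eq_zero, Finset.eq_empty_iff_forall_notMem]
        intro x hx
        have := Finset.mem_singleton.1 (hs hx)
        subst this
        exact hq (mem_nb.1 hx).2.symm
    refine (Finset.sum_le_sum this).trans ?_
    rw [← Finset.sum_filter, Finset.sum_const, smul_eq_mul, mul_one]
    have h4 := card_nb_le_cnt h.hcol D q
    unfold nb at h4
    refine h4.trans ?_
    cases col q
    · exact le_max_left _ _
    · exact le_max_right _ _
  have h4 : max (cnt col true D) (cnt col false D) ≤ c :=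
    max_le ((cnt_mono hD).trans ((h.hcnt _).le.trans h.hm))
      ((cnt_mono hD).trans ((h.hcnt _).le.trans h.hm))
  have h5 := min_mul_max (cnt col true D) (cnt col false D)
  have h6 : min (cnt col true D) (cnt col false D) * max (cnt col true D) (cnt col false D) ≤
      min (cnt col true D) (cnt col false D) * c := Nat.mul_le_mul_left _ h4
  rw [mul_comm _ c] at h6
  omega

/-- From any vertex off the cycle the cycle can be reached without passing through `q`. -/
lemma reach_cyc (h : Core G col c z W m) {x : V} (hx : x ∈ W) (q : V) :
    ∃ g p, Conn G (fun y => y ∈ W ∧ y ≠ q) x g ∧ G.Adj g p ∧ p ∈ cyc c z ∧ p ≠ q ∧ g ∈ W := by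
  set D := W.filter (fun y => Conn G (fun y => y ∈ W ∧ y ≠ q) x y) with hD
  obtain ⟨p, hp, hpq, g, hg, hgp⟩ := h.exists_boundary (D := D) (Finset.filter_subset _ _)
    ⟨x, by rw [hD, Finset.mem_filter]; exact ⟨hx, Relation.ReflTransGen.refl⟩⟩ q
  rw [hD, Finset.mem_filter] at hg
  refine ⟨g, p, hg.2, hgp, ?_, hpq, hg.1⟩
  rw [Finset.mem_sdiff, Finset.mem_union] at hp
  rcases hp.1 with h1 | h1
  · exact h1
  · refine absurd ?_ hp.2
    rw [hD, Finset.mem_filter]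
    exact ⟨h1, hg.2.snoc hgp ⟨h1, hpq⟩⟩

end Core

lemma Ctx.conn_cyc {col : V → Bool} {c : ℕ} {z : ℕ → V} (h : Ctx G col c z) {x y q : V}
    (hx : x ∈ cyc c z) (hy : y ∈ cyc c z) (hxq : x ≠ q) (hyq : y ≠ q) :
    Conn G (fun p => p ∈ cyc c z ∧ p ≠ q) x y := by
  have hc := h.hc
  have key : ∀ a b, a ≤ b → (∀ t, a ≤ t → t ≤ b → z t ≠ q) →
      Conn G (fun p => p ∈ cyc c z ∧ p ≠ q) (z a) (z b) := by
    intro a b hab hq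
    induction b, hab using Nat.le_induction with
    | base => exact Relation.ReflTransGen.refl
    | succ b hb ih =>
      exact (ih fun t h1 h2 => hq t h1 (by omega)).snoc (h.zadj b)
        ⟨h.zmem _, hq _ (by omega) le_rfl⟩
  obtain ⟨o, ho⟩ : ∃ o, ∀ t, o < t → t < o + 2 * c → z t ≠ q := by
    by_cases hq : q ∈ cyc c z
    · obtain ⟨o, -, -, rfl⟩ := h.surj hq 0
      exact ⟨o, fun t h1 h2 => (h.zinj o t h1 h2).symm⟩
    · exact ⟨0, fun t _ _ e => hq (e ▸ h.zmem t)⟩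
  obtain ⟨a, a1, a2, rfl⟩ := h.surj hx o
  obtain ⟨b, b1, b2, rfl⟩ := h.surj hy o
  have ho' : ∀ t, o < t → t ≤ o + 2 * c → (t = o + 2 * c → z t ≠ q) → z t ≠ q := by
    intro t h1 h2 h3
    rcases h2.eq_or_lt with h4 | h4
    · exact h3 h4
    · exact ho t h1 h4
  rcases le_total a b with hab | hab
  · exact key a b hab fun t h1 h2 => ho' t (by omega) (by omega) fun h3 => by
      rwa [show t = b by omega]
  · exact (key b a hab fun t h1 h2 => ho' t (by omega) (by omega) fun h3 => by
      rwa [show t = a by omega]).symm ⟨h.zmem _, hyq⟩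

lemma Core.conn {col : V → Bool} {c m : ℕ} {z : ℕ → V} {W : Finset V} (h : Core G col c z W m)
    {x y q : V} (hx : x ∈ cyc c z ∪ W) (hy : y ∈ cyc c z ∪ W) (hxq : x ≠ q) (hyq : y ≠ q) :
    Conn G (fun p => p ∈ cyc c z ∪ W ∧ p ≠ q) x y := by
  have key : ∀ x ∈ cyc c z ∪ W, x ≠ q → ∃ p ∈ cyc c z, p ≠ q ∧
      Conn G (fun p => p ∈ cyc c z ∪ W ∧ p ≠ q) x p := by
    intro x hx hxq
    rcases Finset.mem_union.1 hx with h1 | h1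
    · exact ⟨x, h1, hxq, Relation.ReflTransGen.refl⟩
    · obtain ⟨g, p, h2, h3, h4, h5, -⟩ := h.reach_cyc h1 q
      refine ⟨p, h4, h5, (h2.mono fun x hx => ?_).snoc h3 ⟨Finset.mem_union_left _ h4, h5⟩⟩
      exact ⟨Finset.mem_union_right _ hx.1, hx.2⟩
  obtain ⟨p, p1, p2, p3⟩ := key x hx hxq
  obtain ⟨p', p1', p2', p3'⟩ := key y hy hyq
  refine p3.trans (Conn.trans ?_ (p3'.symm ⟨hy, hyq⟩))
  exact (h.conn_cyc p1 p1' p2 p2').mono fun x hx => ⟨Finset.mem_union_left _ hx.1, hx.2⟩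

/-- `x` is a vertex of `U` off the path `r 0, …, r N`. -/
def Off (U : Finset V) (r : ℕ → V) (N : ℕ) (x : V) : Prop := x ∈ U ∧ x ∉ seg r 0 N

/-- `r t` can be reached from `x` off the path. -/
def Reach (G : SimpleGraph V) (U : Finset V) (r : ℕ → V) (N : ℕ) (x : V) (t : ℕ) : Prop :=
  ∃ v, Conn G (Off U r N) x v ∧ G.Adj v (r t)

/-- `r a` and `r b` are joined by an edge or by a path whose interior is off the path `r`. -/
def Byp (G : SimpleGraph V) (U : Finset V) (r : ℕ → V) (N a b : ℕ) : Prop :=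
  G.Adj (r a) (r b) ∨ ∃ x, Off U r N x ∧ Reach G U r N x a ∧ Reach G U r N x b

lemma Byp.pth {U : Finset V} {r : ℕ → V} {N a b : ℕ} (h : Byp G U r N a b) (hr : IP G r N)
    (hab : a < b) (hb : b ≤ N) : ∃ I, Pth G (r a) (r b) I ∧ ∀ x ∈ I, x = r a ∨ x = r b ∨
      (Off U r N x ∧ Reach G U r N x a ∧ Reach G U r N x b) := by
  have hne : r a ≠ r b := fun e => by have := hr.2 a (by omega) b hb e; omega
  rcases h with h | ⟨x, hx, ⟨v, hv1, hv2⟩, ⟨v', hv1', hv2'⟩⟩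
  · refine ⟨_, (Pth.single (r a)).snoc h (by simpa using hne.symm), fun x hx => ?_⟩
    simp only [Finset.mem_insert, Finset.mem_singleton] at hx
    tauto
  · have hv := Conn.prop hv1 hx
    obtain ⟨I, hI, hI'⟩ := ((hv1.symm hx).trans hv1').pth hv
    have hIo : ∀ t ≤ N, r t ∉ I := fun t ht hm => (hI' _ hm).2.2 (seg_mem (Nat.zero_le _) ht)
    refine ⟨_, ((hI.snoc hv2' (hIo b hb)).symm.snoc hv2 ?_).symm, fun y hy => ?_⟩
    · rw [Finset.mem_insert, not_or]
      exact ⟨hne, hIo a (by omega)⟩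
    · simp only [Finset.mem_insert] at hy
      rcases hy with hy | hy | hy
      · exact Or.inl hy
      · exact Or.inr (Or.inl hy)
      · obtain ⟨h1, h2⟩ := hI' y hy
        exact Or.inr (Or.inr ⟨h2, ⟨v, h1.symm hv, hv2⟩,
          ⟨v', (h1.symm hv).trans ((hv1.symm hx).trans hv1'), hv2'⟩⟩)

lemma exists_byp {U : Finset V} {r : ℕ → V} {N j : ℕ} (h0 : 0 < j) (hj : j < N)
    (hr : IP G r N) (hc : Conn G (fun x => x ∈ U ∧ x ≠ r j) (r 0) (r N)) :
    ∃ a b, a < j ∧ j < b ∧ b ≤ N ∧ Byp G U r N a b := by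
  by_contra hcon
  push Not at hcon
  have key : ∀ x, Conn G (fun x => x ∈ U ∧ x ≠ r j) (r 0) x →
      (∃ t, t < j ∧ x = r t) ∨ (Off U r N x ∧ ∃ a, a < j ∧ Reach G U r N x a) := by
    intro x hx
    induction hx with
    | refl => exact Or.inl ⟨0, h0, rfl⟩
    | @tail y w h1 h2 ih =>
      by_cases hw : w ∈ seg r 0 N
      · obtain ⟨t, _, ht, rfl⟩ := mem_seg.1 hw
        rcases lt_trichotomy t j with h3 | h3 | h3
        · exact Or.inl ⟨t, h3, rfl⟩
        · exact absurd (by rw [h3]) h2.2.2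
        · exfalso
          rcases ih with ⟨a, ha, rfl⟩ | ⟨hy, a, ha, hya⟩
          · exact hcon a t ha h3 ht (Or.inl h2.1)
          · exact hcon a t ha h3 ht (Or.inr ⟨y, hy, hya, y, Relation.ReflTransGen.refl, h2.1⟩)
      · refine Or.inr ⟨⟨h2.2.1, hw⟩, ?_⟩
        rcases ih with ⟨a, ha, rfl⟩ | ⟨hy, a, ha, v, hv1, hv2⟩
        · exact ⟨a, ha, w, Relation.ReflTransGen.refl, h2.1.symm⟩
        · exact ⟨a, ha, v, Conn.trans (Relation.ReflTransGen.single ⟨h2.1.symm, hy⟩) hv1, hv2⟩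
  rcases key _ hc with ⟨t, ht, he⟩ | ⟨h1, -⟩
  · have := hr.2 N le_rfl t (by omega) he
    omega
  · exact h1.2 (seg_mem (Nat.zero_le _) le_rfl)

/-- The bypass reaching furthest among those over `j`. -/
lemma exists_max_byp {U : Finset V} {r : ℕ → V} {N j : ℕ} (h0 : 0 < j) (hj : j < N)
    (hr : IP G r N) (hc : Conn G (fun x => x ∈ U ∧ x ≠ r j) (r 0) (r N)) :
    ∃ a b, a < j ∧ j < b ∧ b ≤ N ∧ Byp G U r N a b ∧
      ∀ a' b', a' < j → b < b' → b' ≤ N → ¬ Byp G U r N a' b' := by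
  obtain ⟨a, b, h1, h2, h3, h4⟩ := exists_byp h0 hj hr hc
  let P : ℕ → Prop := fun b => ∃ a, a < j ∧ j < b ∧ Byp G U r N a b
  have hP : P (Nat.findGreatest P N) := Nat.findGreatest_spec h3 ⟨a, h1, h2, h4⟩
  obtain ⟨a', q1, q2, q3⟩ := hP
  refine ⟨a', _, q1, q2, Nat.findGreatest_le N, q3, fun a'' b'' p1 p2 p3 p4 => ?_⟩
  exact Nat.findGreatest_is_greatest p2 p3 ⟨a'', p1, by omega, p4⟩

/-- Starting from the first vertex `r 0` of a path and going along overlapping bypasses, one can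
jump over any index `ρ`. -/
structure Vine (G : SimpleGraph V) (U : Finset V) (r : ℕ → V) (N σ i j : ℕ) (S : Finset V) :
    Prop where
  hi : σ ≤ i
  hij : i < j
  hj : j ≤ N
  sub : S ⊆ U
  pth : Pth G (r i) (r j) S
  free : ∀ t, i < t → t ≤ N → r t ∈ S → t = j
  start : ∃ a y, a < y ∧ y ≤ σ ∧ seg r 0 a ⊆ S ∧ seg r y σ ⊆ S ∧
    ∀ t, t ≤ N → G.Adj (r 0) (r t) → t ≤ a ∨ y ≤ t ∧ t ≤ σ

lemma exists_vine {U : Finset V} {r : ℕ → V} {N σ ρ : ℕ} (hr : IP G r N) (hU : seg r 0 N ⊆ U)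
    (hc : ∀ j, 0 < j → j < N → Conn G (fun x => x ∈ U ∧ x ≠ r j) (r 0) (r N))
    (h1 : 1 ≤ σ) (hσ : G.Adj (r 0) (r σ)) (hmax : ∀ t, σ < t → t ≤ N → ¬ G.Adj (r 0) (r t))
    (hσρ : σ ≤ ρ) (hρ : ρ < N) :
    ∃ i j S, Vine G U r N σ i j S ∧ i ≤ ρ ∧ ρ < j := by
  have hmem : ∀ t, t ≤ N → r t ∈ seg r 0 N := fun t ht => seg_mem (Nat.zero_le _) ht
  have key : ∀ k, k ≤ ρ → σ ≤ k → ∃ i j S, Vine G U r N σ i j S ∧ i ≤ ρ ∧ k < j ∧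
      (∀ a b, a < i → j < b → b ≤ N → ¬ Byp G U r N a b) ∧
      (∀ x ∈ S, Off U r N x → ∀ t ≤ N, Reach G U r N x t → t ≤ j) := by
    intro k hk hσk
    induction k, hσk using Nat.le_induction with
    | base =>
      obtain ⟨a, b, ha, hb, hbN, hB, hm⟩ := exists_max_byp h1 (by omega) hr (hc σ h1 (by omega))
      obtain ⟨I, hI, hI'⟩ := hB.pth hr (by omega) hbN
      have ey : ∃ y, a < y ∧ G.Adj (r 0) (r y) := ⟨σ, ha, hσ⟩
      obtain ⟨y, ⟨hy1, hy2⟩, hy3⟩ : ∃ y, (a < y ∧ G.Adj (r 0) (r y)) ∧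
          ∀ t, t < y → ¬ (a < t ∧ G.Adj (r 0) (r t)) :=
        ⟨_, Nat.find_spec ey, fun t => Nat.find_min ey⟩
      have hyσ : y ≤ σ := by
        by_contra hcon
        exact hy3 σ (by omega) ⟨ha, hσ⟩
      have d1 : Disjoint (seg r y σ) (seg r 0 a) := by
        rw [Finset.disjoint_left]
        intro x hx hx'
        obtain ⟨t, t1, t2, rfl⟩ := mem_seg.1 hx
        rw [hr.mem_seg_iff (by omega) (by omega)] at hx'
        omega
      have p1 := (hr.pth_seg hyσ (by omega)).symm.append
        (hr.pth_seg (Nat.zero_le a) (by omega)) hy2.symm d1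
      have p2 := p1.join hI (by
        intro x hx hxI
        have hx' : ∃ t, t ≤ σ ∧ x = r t := by
          rcases Finset.mem_union.1 hx with hx | hx <;> obtain ⟨t, t1, t2, rfl⟩ := mem_seg.1 hx
          · exact ⟨t, t2, rfl⟩
          · exact ⟨t, by omega, rfl⟩
        obtain ⟨t, ht, rfl⟩ := hx'
        rcases hI' _ hxI with h2 | h2 | h2
        · exact h2
        · have := hr.2 _ (by omega) _ hbN h2
          omega
        · exact absurd (hmem t (by omega)) h2.1.2)
      have hS : ∀ x ∈ seg r y σ ∪ seg r 0 a ∪ I, (∃ t, t ≤ σ ∧ x = r t) ∨ x = r b ∨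
          (Off U r N x ∧ Reach G U r N x a) := by
        intro x hx
        simp only [Finset.mem_union] at hx
        rcases hx with (hx | hx) | hx
        · obtain ⟨t, t1, t2, rfl⟩ := mem_seg.1 hx
          exact Or.inl ⟨t, t2, rfl⟩
        · obtain ⟨t, t1, t2, rfl⟩ := mem_seg.1 hx
          exact Or.inl ⟨t, by omega, rfl⟩
        · rcases hI' x hx with h2 | h2 | h2
          · exact Or.inl ⟨a, by omega, h2⟩
          · exact Or.inr (Or.inl h2)
          · exact Or.inr (Or.inr ⟨h2.1, h2.2.1⟩)
      refine ⟨σ, b, _, ⟨le_rfl, hb, hbN, ?_, p2, ?_, a, y, hy1, hyσ, ?_, ?_, ?_⟩, hσρ, hb, ?_, ?_⟩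
      · intro x hx
        rcases hS x hx with ⟨t, ht, rfl⟩ | rfl | h2
        · exact hU (hmem t (by omega))
        · exact hU (hmem b hbN)
        · exact h2.1.1
      · intro t t1 t2 t3
        rcases hS _ t3 with ⟨s, hs, e⟩ | e | h2
        · have := hr.2 t t2 s (by omega) e
          omega
        · exact hr.2 t t2 b hbN e
        · exact absurd (hmem t t2) h2.1.2
      · exact fun x hx => Finset.mem_union_left _ (Finset.mem_union_right _ hx)
      · exact fun x hx => Finset.mem_union_left _ (Finset.mem_union_left _ hx)
      · intro t t1 t2
        by_cases h3 : t ≤ a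
        · exact Or.inl h3
        · refine Or.inr ⟨?_, ?_⟩
          · by_contra hcon
            exact hy3 t (by omega) ⟨by omega, t2⟩
          · by_contra hcon
            exact hmax t (by omega) t1 t2
      · exact fun a' b' h2 h3 h4 => hm a' b' h2 h3 h4
      · intro x hx hoff t ht hR
        by_contra hcon
        rcases hS x hx with ⟨s, hs, rfl⟩ | rfl | h2
        · exact hoff.2 (hmem s (by omega))
        · exact hoff.2 (hmem b hbN)
        · exact hm a t ha (by omega) ht (Or.inr ⟨x, hoff, h2.2, hR⟩)
    | succ k hk' ih =>
      obtain ⟨i, j, S, hv, hiρ, hkj, hM1, hM2⟩ := ih (by omega)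
      rcases Nat.lt_or_ge (k + 1) j with h2 | h2
      · exact ⟨i, j, S, hv, hiρ, h2, hM1, hM2⟩
      · have hjk : j = k + 1 := by omega
        obtain ⟨a, b, ha, hb, hbN, hB, hm⟩ :=
          exists_max_byp (j := j) (by omega) (by omega) hr (hc j (by omega) (by omega))
        obtain ⟨I, hI, hI'⟩ := hB.pth hr (by omega) hbN
        have hai : i ≤ a := by
          by_contra hcon
          exact hM1 a b (by omega) hb hbN hB
        have p1 := hv.pth.symm.join (hr.pth_seg hai (by omega)) (by
          intro x hx hx'
          obtain ⟨t, t1, t2, rfl⟩ := mem_seg.1 hx'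
          rcases t1.eq_or_lt with h3 | h3
          · rw [h3]
          · have := hv.free t h3 (by omega) hx
            omega)
        have p2 := p1.join hI (by
          intro x hx hxI
          rcases hI' x hxI with h3 | h3 | h3
          · exact h3
          · exfalso
            subst h3
            rcases Finset.mem_union.1 hx with hx | hx
            · have := hv.free b (by omega) hbN hx
              omega
            · rw [hr.mem_seg_iff (by omega) hbN] at hx
              omega
          · exfalso
            rcases Finset.mem_union.1 hx with hx | hx
            · have := hM2 x hx h3.1 b hbN h3.2.2
              omega
            · obtain ⟨t, t1, t2, rfl⟩ := mem_seg.1 hx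
              exact h3.1.2 (hmem t (by omega)))
        obtain ⟨a₀, y₀, w1, w2, w3, w4, w5⟩ := hv.start
        have hSS : S ⊆ S ∪ seg r i a ∪ I := fun x hx =>
          Finset.mem_union_left _ (Finset.mem_union_left _ hx)
        refine ⟨j, b, _, ⟨by have := hv.hi; have := hv.hij; omega, hb, hbN, ?_, p2, ?_, a₀, y₀, w1, w2,
          w3.trans hSS, w4.trans hSS, w5⟩, by omega, by omega, ?_, ?_⟩
        · intro x hx
          simp only [Finset.mem_union] at hx
          rcases hx with (hx | hx) | hx
          · exact hv.sub hx
          · obtain ⟨t, t1, t2, rfl⟩ := mem_seg.1 hx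
            exact hU (hmem t (by omega))
          · rcases hI' x hx with h3 | h3 | h3
            · rw [h3]; exact hU (hmem a (by omega))
            · rw [h3]; exact hU (hmem b hbN)
            · exact h3.1.1
        · intro t t1 t2 t3
          simp only [Finset.mem_union] at t3
          have := hv.hij
          rcases t3 with (hx | hx) | hx
          · have := hv.free t (by omega) t2 hx
            omega
          · rw [hr.mem_seg_iff (by omega) t2] at hx
            omega
          · rcases hI' _ hx with h3 | h3 | h3
            · have := hr.2 t t2 a (by omega) h3
              omega
            · exact hr.2 t t2 b hbN h3
            · exact absurd (hmem t t2) h3.1.2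
        · exact fun a' b' q1 q2 q3 => hm a' b' q1 q2 q3
        · intro x hx hoff t ht hR
          simp only [Finset.mem_union] at hx
          rcases hx with (hx | hx) | hx
          · have := hM2 x hx hoff t ht hR
            omega
          · obtain ⟨s, s1, s2, rfl⟩ := mem_seg.1 hx
            exact absurd (hmem s (by omega)) hoff.2
          · rcases hI' _ hx with h3 | h3 | h3
            · exact absurd (h3 ▸ hmem a (by omega)) hoff.2
            · exact absurd (h3 ▸ hmem b hbN) hoff.2
            · by_contra hcon
              exact hm a t ha (by omega) ht (Or.inr ⟨x, hoff, h3.2.1, hR⟩)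
  obtain ⟨i, j, S, hv, h2, h3, -, -⟩ := key ρ le_rfl hσρ
  exact ⟨i, j, S, hv, h2, h3⟩

/-- The indices of the neighbours of `v` on the path `r 0, …, r n`. -/
noncomputable def idx (G : SimpleGraph V) (r : ℕ → V) (n : ℕ) (v : V) : Finset ℕ :=
  (Finset.range (n + 1)).filter (fun t => G.Adj v (r t))

lemma mem_idx {r : ℕ → V} {n t : ℕ} {v : V} : t ∈ idx G r n v ↔ t ≤ n ∧ G.Adj v (r t) := by
  rw [idx, Finset.mem_filter, Finset.mem_range, Nat.lt_succ_iff]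

lemma idx_congr {r r' : ℕ → V} {n : ℕ} (h : ∀ t ≤ n, r' t = r t) (v : V) :
    idx G r' n v = idx G r n v := by
  ext t
  rw [mem_idx, mem_idx]
  exact and_congr_right fun ht => by rw [h t ht]

lemma card_nb_le_idx {r : ℕ → V} {n : ℕ} {v : V} {W : Finset V} (h : nb G W v ⊆ seg r 0 n) :
    (nb G W v).card ≤ (idx G r n v).card := by
  refine (Finset.card_le_card (t := (idx G r n v).image r) fun x hx => ?_).trans
    Finset.card_image_le
  obtain ⟨t, _, ht, rfl⟩ := mem_seg.1 (h hx)
  exact Finset.mem_image_of_mem _ (mem_idx.2 ⟨ht, (mem_nb.1 hx).2⟩)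

/-- The last vertex of the path is never adjacent to the predecessor of a neighbour of the first
vertex. -/
def NoGap (G : SimpleGraph V) (r : ℕ → V) (n : ℕ) : Prop :=
  ∀ t < n, G.Adj (r n) (r t) → ¬ G.Adj (r 0) (r (t + 1))

section

variable {col : V → Bool}

lemma idx_first (hcol : ∀ u v, G.Adj u v → col u ≠ col v) {r : ℕ → V} {n t : ℕ}
    (hr : ∀ i < n, G.Adj (r i) (r (i + 1))) (h : t ≤ n) (ha : G.Adj (r 0) (r t)) : t % 2 = 1 := by
  have h4 := hcol _ _ ha
  rw [Ne, IP.col_eq hcol hr (Nat.zero_le _) h] at h4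
  omega

lemma idx_last (hcol : ∀ u v, G.Adj u v → col u ≠ col v) {r : ℕ → V} {n t : ℕ}
    (hr : ∀ i < n, G.Adj (r i) (r (i + 1))) (hn : n % 2 = 1) (h : t ≤ n)
    (ha : G.Adj (r n) (r t)) : t % 2 = 0 ∧ t < n := by
  have h4 := hcol _ _ ha
  rw [Ne, IP.col_eq hcol hr le_rfl h] at h4
  have : t ≠ n := by rintro rfl; exact G.irrefl ha
  omega

lemma idx_disjoint {r : ℕ → V} {n : ℕ} (hcol : ∀ u v, G.Adj u v → col u ≠ col v)
    (hr : ∀ i < n, G.Adj (r i) (r (i + 1))) (hn : n % 2 = 1) (hg : NoGap G r n) :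
    Disjoint (idx G r n (r 0)) ((idx G r n (r n)).image Nat.succ) := by
  rw [Finset.disjoint_left]
  intro t ht ht'
  obtain ⟨s, hs, rfl⟩ := Finset.mem_image.1 ht'
  rw [mem_idx] at ht hs
  exact hg s (idx_last hcol hr hn hs.1 hs.2).2 hs.2 ht.2

lemma NoGap.two_mul_card_le (hcol : ∀ u v, G.Adj u v → col u ≠ col v) {r : ℕ → V} {n : ℕ}
    (hr : ∀ i < n, G.Adj (r i) (r (i + 1))) (hn : n % 2 = 1) (hg : NoGap G r n) :
    2 * ((idx G r n (r 0)).card + (idx G r n (r n)).card) ≤ n + 1 := by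
  have h1 := Finset.card_union_of_disjoint (idx_disjoint hcol hr hn hg)
  rw [Finset.card_image_of_injective _ Nat.succ_injective] at h1
  have h2 : ∀ t ∈ idx G r n (r 0) ∪ (idx G r n (r n)).image Nat.succ,
      (1 ≤ t ∧ t ≤ n) ∧ t % 2 = 1 := by
    intro t ht
    rcases Finset.mem_union.1 ht with ht | ht
    · rw [mem_idx] at ht
      have := idx_first hcol hr ht.1 ht.2
      omega
    · obtain ⟨s, hs, rfl⟩ := Finset.mem_image.1 ht
      rw [mem_idx] at hs
      have := idx_last hcol hr hn hs.1 hs.2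
      simp only [Nat.succ_eq_add_one]
      omega
  have h3 := spaced (by omega) (fun t ht => (h2 t ht).1) (fun t ht ht' => by
    have := (h2 t ht).2
    have := (h2 _ ht').2
    omega)
  omega

/-- A set containing the neighbours of both ends of a path, the predecessors of the neighbours of
the first vertex and the successors of those of the last one, up to two exceptions, is large. -/
lemma NoGap.two_mul_card_le_add (hcol : ∀ u v, G.Adj u v → col u ≠ col v) {r : ℕ → V} {n : ℕ}
    (hr : IP G r n) (hn : n % 2 = 1) (hg : NoGap G r n) {Z : Finset V} {α β : ℕ}
    (h0 : ∀ t ≤ n, G.Adj (r 0) (r t) → r t ∈ Z ∧ (t - 1 ≠ α → r (t - 1) ∈ Z))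
    (h1 : ∀ t ≤ n, G.Adj (r n) (r t) → r t ∈ Z ∧ (t + 1 ≠ β → r (t + 1) ∈ Z)) :
    2 * ((idx G r n (r 0)).card + (idx G r n (r n)).card) ≤ Z.card + 2 := by
  set I := (Finset.range (n + 1)).filter (fun t => r t ∈ Z) with hI
  have hmI : ∀ t, t ∈ I ↔ t ≤ n ∧ r t ∈ Z := by
    intro t
    rw [hI, Finset.mem_filter, Finset.mem_range, Nat.lt_succ_iff]
  have c1 : I.card ≤ Z.card := by
    refine Finset.card_le_card_of_injOn r (fun t ht => ((hmI t).1 ht).2) ?_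
    intro t ht s hs hts
    exact hr.2 t ((hmI t).1 ht).1 s ((hmI s).1 hs).1 hts
  have c2 := Finset.card_filter_add_card_filter_not (s := I) (fun t => t % 2 = 1)
  have c3 := Finset.card_union_of_disjoint (idx_disjoint hcol hr.1 hn hg)
  rw [Finset.card_image_of_injective _ Nat.succ_injective] at c3
  have c4 : (idx G r n (r 0) ∪ (idx G r n (r n)).image Nat.succ).card ≤
      (I.filter (fun t => t % 2 = 1)).card + 1 := by
    refine (Finset.card_le_card (t := insert β (I.filter (fun t => t % 2 = 1))) ?_).trans
      (Finset.card_insert_le _ _)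
    intro t ht
    rw [Finset.mem_insert, Finset.mem_filter, hmI]
    rcases Finset.mem_union.1 ht with ht | ht
    · rw [mem_idx] at ht
      have := idx_first hcol hr.1 ht.1 ht.2
      exact Or.inr ⟨⟨ht.1, (h0 t ht.1 ht.2).1⟩, this⟩
    · obtain ⟨s, hs, rfl⟩ := Finset.mem_image.1 ht
      rw [mem_idx] at hs
      have := idx_last hcol hr.1 hn hs.1 hs.2
      by_cases hb : s + 1 = β
      · exact Or.inl hb
      · exact Or.inr ⟨⟨this.2, (h1 s hs.1 hs.2).2 hb⟩, by simp only [Nat.succ_eq_add_one]; omega⟩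
  have c5 : ((idx G r n (r 0)).card + (idx G r n (r n)).card) ≤
      (I.filter (fun t => ¬ t % 2 = 1)).card + 1 := by
    have d1 : ((idx G r n (r 0)).image Nat.pred).card = (idx G r n (r 0)).card := by
      refine Finset.card_image_of_injOn fun t ht s hs hts => ?_
      rw [Finset.mem_coe, mem_idx] at ht hs
      have := idx_first hcol hr.1 ht.1 ht.2
      have := idx_first hcol hr.1 hs.1 hs.2
      simp only [Nat.pred_eq_sub_one] at hts
      omega
    rw [← d1, ← Finset.card_union_of_disjoint]
    · refine (Finset.card_le_card (t := insert α (I.filter (fun t => ¬ t % 2 = 1))) ?_).trans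
        (Finset.card_insert_le _ _)
      intro t ht
      rw [Finset.mem_insert, Finset.mem_filter, hmI]
      rcases Finset.mem_union.1 ht with ht | ht
      · obtain ⟨s, hs, rfl⟩ := Finset.mem_image.1 ht
        rw [mem_idx] at hs
        have := idx_first hcol hr.1 hs.1 hs.2
        simp only [Nat.pred_eq_sub_one]
        by_cases hb : s - 1 = α
        · exact Or.inl hb
        · exact Or.inr ⟨⟨by omega, (h0 s hs.1 hs.2).2 hb⟩, by omega⟩
      · rw [mem_idx] at ht
        have := idx_last hcol hr.1 hn ht.1 ht.2
        exact Or.inr ⟨⟨ht.1, (h1 t ht.1 ht.2).1⟩, by omega⟩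
    · rw [Finset.disjoint_left]
      intro t ht ht'
      obtain ⟨s, hs, rfl⟩ := Finset.mem_image.1 ht
      rw [mem_idx] at hs ht'
      have := idx_first hcol hr.1 hs.1 hs.2
      have h3 := (idx_last hcol hr.1 hn ht'.1 ht'.2).2
      refine hg _ h3 ht'.2 ?_
      simp only [Nat.pred_eq_sub_one]
      rw [show s - 1 + 1 = s by omega]
      exact hs.2
  omega

lemma NoGap.exists_cycle_of_crossing (hcol : ∀ u v, G.Adj u v → col u ≠ col v) {r : ℕ → V}
    {n : ℕ} (hr : IP G r n) (hn : n % 2 = 1) (hg : NoGap G r n)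
    (hX : ∃ i j, i < j ∧ j ≤ n ∧ G.Adj (r n) (r i) ∧ G.Adj (r 0) (r j)) :
    ∃ Z a b, Pth G a b Z ∧ G.Adj a b ∧ r 0 ∈ Z ∧ r n ∈ Z ∧ Z ⊆ seg r 0 n ∧
      2 * ((idx G r n (r 0)).card + (idx G r n (r n)).card) ≤ Z.card + 2 := by
  have hex : ∃ d, ∃ i, 0 < d ∧ i + d ≤ n ∧ G.Adj (r n) (r i) ∧ G.Adj (r 0) (r (i + d)) := by
    obtain ⟨i, j, h1, h2, h3, h4⟩ := hX
    exact ⟨j - i, i, by omega, by omega, h3, by rwa [show i + (j - i) = j by omega]⟩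
  obtain ⟨d, ⟨i, h1, h2, h3, h4⟩, hmin⟩ : ∃ d, (∃ i, 0 < d ∧ i + d ≤ n ∧ G.Adj (r n) (r i) ∧
      G.Adj (r 0) (r (i + d))) ∧ ∀ e, e < d → ¬ ∃ i, 0 < e ∧ i + e ≤ n ∧ G.Adj (r n) (r i) ∧
      G.Adj (r 0) (r (i + e)) := ⟨_, Nat.find_spec hex, fun e => Nat.find_min hex⟩
  have g0 : ∀ t ≤ n, G.Adj (r 0) (r t) → t ≤ i ∨ i + d ≤ t := by
    intro t ht ha
    by_contra hcon
    exact hmin (t - i) (by omega) ⟨i, by omega, by omega, h3, by rwa [show i + (t - i) = t by omega]⟩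
  have g1 : ∀ t ≤ n, G.Adj (r n) (r t) → t ≤ i ∨ i + d ≤ t := by
    intro t ht ha
    by_contra hcon
    exact hmin (i + d - t) (by omega) ⟨t, by omega, by omega, ha, by
      rwa [show t + (i + d - t) = i + d by omega]⟩
  have hd : Disjoint (seg r 0 i) (seg r (i + d) n) := by
    rw [Finset.disjoint_left]
    intro x hx hx'
    obtain ⟨t, t1, t2, rfl⟩ := mem_seg.1 hx
    rw [hr.mem_seg_iff le_rfl (by omega)] at hx'
    omega
  have hp := (hr.pth_seg (Nat.zero_le i) (by omega)).append
    (hr.pth_seg h2 le_rfl).symm h3.symm hd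
  refine ⟨_, _, _, hp, h4, Finset.mem_union_left _ (seg_mem le_rfl (Nat.zero_le _)),
    Finset.mem_union_right _ (seg_mem h2 le_rfl), ?_, ?_⟩
  · intro x hx
    rcases Finset.mem_union.1 hx with hx | hx <;> obtain ⟨t, t1, t2, rfl⟩ := mem_seg.1 hx <;>
      exact seg_mem (Nat.zero_le _) (by omega)
  · refine hg.two_mul_card_le_add hcol hr hn (α := i + d - 1) (β := i + 1) ?_ ?_
    · intro t ht ha
      have := idx_first hcol hr.1 ht ha
      rcases g0 t ht ha with h5 | h5
      · exact ⟨Finset.mem_union_left _ (seg_mem (Nat.zero_le _) h5), fun _ =>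
          Finset.mem_union_left _ (seg_mem (Nat.zero_le _) (by omega))⟩
      · exact ⟨Finset.mem_union_right _ (seg_mem h5 ht), fun _ =>
          Finset.mem_union_right _ (seg_mem (by omega) (by omega))⟩
    · intro t ht ha
      have := idx_last hcol hr.1 hn ht ha
      rcases g1 t ht ha with h5 | h5
      · exact ⟨Finset.mem_union_left _ (seg_mem (Nat.zero_le _) h5), fun _ =>
          Finset.mem_union_left _ (seg_mem (Nat.zero_le _) (by omega))⟩
      · exact ⟨Finset.mem_union_right _ (seg_mem h5 ht), fun _ =>
          Finset.mem_union_right _ (seg_mem (by omega) (by omega))⟩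

lemma NoGap.exists_cycle_of_vine (hcol : ∀ u v, G.Adj u v → col u ≠ col v) {r : ℕ → V}
    {n N σ i j ρ : ℕ} {S U : Finset V} (hr : IP G r N) (hnN : n ≤ N) (hn : n % 2 = 1)
    (hg : NoGap G r n) (hv : Vine G U r N σ i j S) (hj : j ≤ n) (hi : i ≤ ρ) (hρj : ρ < j)
    (hρ : G.Adj (r n) (r ρ)) (hmin : ∀ t ≤ n, G.Adj (r n) (r t) → ρ ≤ t) :
    ∃ Z a b, Pth G a b Z ∧ G.Adj a b ∧ r 0 ∈ Z ∧ r n ∈ Z ∧ Z ⊆ S ∪ seg r 0 n ∧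
      2 * ((idx G r n (r 0)).card + (idx G r n (r n)).card) ≤ Z.card + 2 := by
  have hrn : IP G r n := ⟨fun i hi => hr.1 i (by omega), fun i hi j hj =>
    hr.2 i (by omega) j (by omega)⟩
  have hij := hv.hij
  obtain ⟨a, y, ha, hy, hs1, hs2, hs3⟩ := hv.start
  -- the last neighbour of `r n` below `j`
  let l := Nat.findGreatest (fun t => G.Adj (r n) (r t)) (j - 1)
  have l1 : G.Adj (r n) (r l) :=
    Nat.findGreatest_spec (P := fun t => G.Adj (r n) (r t)) (by omega : ρ ≤ j - 1) hρ
  have l2 : ρ ≤ l := Nat.le_findGreatest (by omega) hρ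
  have l3 : l ≤ j - 1 := Nat.findGreatest_le _
  have l4 : ∀ t, l < t → t ≤ j - 1 → ¬ G.Adj (r n) (r t) := fun t h1 h2 =>
    Nat.findGreatest_is_greatest h1 h2
  have p1 := (hr.pth_seg (by omega : i ≤ l) (by omega)).symm.join hv.pth (by
    intro x hx hx'
    obtain ⟨t, t1, t2, rfl⟩ := mem_seg.1 hx
    rcases t1.eq_or_lt with h3 | h3
    · rw [h3]
    · have := hv.free t h3 (by omega) hx'
      omega)
  have p2 := p1.join (hr.pth_seg hj hnN) (by
    intro x hx hx'
    obtain ⟨t, t1, t2, rfl⟩ := mem_seg.1 hx'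
    rcases Finset.mem_union.1 hx with hx | hx
    · rw [hr.mem_seg_iff (by omega) (by omega)] at hx
      omega
    · rw [hv.free t (by omega) (by omega) hx])
  have m1 : ∀ t, i ≤ t → t ≤ l → r t ∈ seg r i l ∪ S ∪ seg r j n := fun t h1 h2 =>
    Finset.mem_union_left _ (Finset.mem_union_left _ (seg_mem h1 h2))
  have m2 : ∀ t, j ≤ t → t ≤ n → r t ∈ seg r i l ∪ S ∪ seg r j n := fun t h1 h2 =>
    Finset.mem_union_right _ (seg_mem h1 h2)
  have m3 : ∀ x ∈ S, x ∈ seg r i l ∪ S ∪ seg r j n := fun x hx =>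
    Finset.mem_union_left _ (Finset.mem_union_right _ hx)
  refine ⟨_, _, _, p2, l1.symm, m3 _ (hs1 (seg_mem le_rfl (Nat.zero_le _))), m2 n hj le_rfl, ?_, ?_⟩
  · intro x hx
    simp only [Finset.mem_union] at hx ⊢
    rcases hx with (hx | hx) | hx
    · obtain ⟨t, t1, t2, rfl⟩ := mem_seg.1 hx
      exact Or.inr (seg_mem (Nat.zero_le _) (by omega))
    · exact Or.inl hx
    · obtain ⟨t, t1, t2, rfl⟩ := mem_seg.1 hx
      exact Or.inr (seg_mem (Nat.zero_le _) (by omega))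
  · refine hg.two_mul_card_le_add hcol hrn hn (α := y - 1) (β := l + 1) ?_ ?_
    · intro t ht h2
      have := idx_first hcol hrn.1 ht h2
      rcases hs3 t (by omega) h2 with h3 | h3
      · exact ⟨m3 _ (hs1 (seg_mem (Nat.zero_le _) h3)), fun _ =>
          m3 _ (hs1 (seg_mem (Nat.zero_le _) (by omega)))⟩
      · exact ⟨m3 _ (hs2 (seg_mem h3.1 h3.2)), fun _ =>
          m3 _ (hs2 (seg_mem (by omega) (by omega)))⟩
    · intro t ht h2
      have := idx_last hcol hrn.1 hn ht h2
      have h3 := hmin t ht h2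
      by_cases h4 : t < j
      · have h5 : t ≤ l := by
          by_contra hcon
          exact l4 t (by omega) (by omega) h2
        exact ⟨m1 t (by omega) h5, fun _ => m1 _ (by omega) (by omega)⟩
      · exact ⟨m2 t (by omega) ht, fun _ => m2 _ (by omega) (by omega)⟩

end

lemma Ctx.ip_cat {col : V → Bool} {c : ℕ} {z : ℕ → V} (h : Ctx G col c z) {r : ℕ → V} {n τ : ℕ}
    (hr : IP G r n) (hd : Disjoint (seg r 0 n) (cyc c z)) (ha : G.Adj (r n) (z τ)) :
    ∃ R, IP G R (n + 2 * c) ∧ (∀ t ≤ n, R t = r t) ∧ (∀ t, n < t → R t ∈ cyc c z) ∧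
      ∀ x ∈ cyc c z, ∃ t, n < t ∧ t ≤ n + 2 * c ∧ R t = x := by
  have hc := h.hc
  have h1 := h.ip τ (n := 2 * c - 1) (by omega)
  have hs : seg (fun t => z (τ + t)) 0 (2 * c - 1) ⊆ cyc c z := by
    intro x hx
    obtain ⟨t, _, _, rfl⟩ := mem_seg.1 hx
    exact h.zmem _
  have h2 := hr.cat h1 ha (hd.mono_right hs)
  rw [show n + 1 + (2 * c - 1) = n + 2 * c by omega] at h2
  refine ⟨_, h2, fun t ht => cat_left ht, fun t ht => ?_, fun x hx => ?_⟩
  · rw [cat_right ht]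
    exact h.zmem _
  · obtain ⟨t, t1, t2, rfl⟩ := h.surj hx τ
    by_cases h3 : t = τ + 2 * c
    · refine ⟨n + 1, by omega, by omega, ?_⟩
      rw [cat_right (by omega), h3, h.zper]
      simp
    · refine ⟨n + 1 + (t - τ), by omega, by omega, ?_⟩
      rw [cat_right (by omega)]
      congr 1
      omega

namespace Core

variable {col : V → Bool} {c m : ℕ} {z : ℕ → V} {W : Finset V}

/-- Every vertex of a cycle off the long one is joined by a long path to a vertex having a
neighbour on the long cycle. -/
lemma exists_exit (h : Core G col c z W m) {Z : Finset V} {a b w x : V} (hZ : Z ⊆ W)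
    (hp : Pth G a b Z) (hab : G.Adj a b) (hw : w ∈ Z) (hx : x ∈ Z) (hxw : x ≠ w) :
    ∃ g o S, Pth G w g S ∧ S ⊆ W ∧ G.Adj g (z o) ∧ Z.card + 2 ≤ 2 * S.card := by
  obtain ⟨g, p, h1, h2, h3, h4, h5⟩ := h.reach_cyc (hZ hx) w
  obtain ⟨I, hI, hI'⟩ := h1.pth ⟨hZ hx, hxw⟩
  obtain ⟨a', I', ha', hsub, hp', hlast⟩ := hI.last_in (fun y => y ∈ Z) hx
  have haw : a' ≠ w := (hI' a' (hsub hp'.left_mem)).2.2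
  obtain ⟨S, hS, hpS, hcard⟩ := hp.long_arc hab hw ha' haw.symm
  have hj := hpS.join hp' fun y hy hy' => hlast y hy' (hS hy)
  obtain ⟨o, -, -, rfl⟩ := h.surj h3 0
  refine ⟨g, o, _, hj, ?_, h2, ?_⟩
  · intro y hy
    rcases Finset.mem_union.1 hy with hy | hy
    · exact hZ (hS hy)
    · exact (hI' y (hsub hy)).2.1
  · have := Finset.card_le_card (Finset.subset_union_left (s₁ := S) (s₂ := I'))
    omega

lemma exists_gap_aux (h : Core G col c z W m) {r : ℕ → V} {n : ℕ} (hr : IP G r n)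
    (hn : n % 2 = 1) (hW : seg r 0 n ⊆ W) (h0 : nb G W (r 0) ⊆ seg r 0 n)
    (h1 : nb G W (r n) ⊆ seg r 0 n) (hu : ¬ (nb G (cyc c z) (r 0)).Nonempty)
    (hw : (nb G (cyc c z) (r n)).Nonempty) : ¬ NoGap G r n := by
  intro hg
  have hc := h.hc
  have hd : Disjoint (seg r 0 n) (cyc c z) := h.hW.mono_left hW
  have hm : ∀ t ≤ n, r t ∈ W := fun t ht => hW (seg_mem (Nat.zero_le _) ht)
  have hcard := hg.two_mul_card_le h.hcol hr.1 hn
  have hc1 := card_nb_le_idx h0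
  have hc2 := card_nb_le_idx h1
  have hk := Finset.card_le_card hW
  rw [hr.card_seg le_rfl, h.card_W] at hk
  have hmc := h.hm
  have hcol01 : col (r 0) ≠ col (r n) := by
    rw [Ne, IP.col_eq h.hcol hr.1 (Nat.zero_le _) le_rfl]; omega
  have hdeg := h.two_le_card_nb_add (hm 0 (Nat.zero_le _)) (hm n le_rfl) hcol01
  rw [nb_union h.hW.symm, nb_union h.hW.symm] at hdeg
  rw [Finset.not_nonempty_iff_eq_empty] at hu
  rw [hu, Finset.card_empty] at hdeg
  -- a long path from `r n` to a vertex attached to the cycle is impossible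
  have hfin : ∀ g o S, Pth G (r n) g S → S ⊆ W → G.Adj g (z o) →
      (idx G r n (r 0)).card + (idx G r n (r n)).card ≤ S.card → False := by
    intro g o S hS hSW ho hle
    have h3 := h.card_nb_erase_le hS.symm (h.hW.mono_left hSW) ho
    have h4 := Finset.pred_card_le_card_erase (s := nb G (cyc c z) (r n)) (a := z o)
    omega
  have hcyc : ∀ Z a b, Pth G a b Z → G.Adj a b → r 0 ∈ Z → r n ∈ Z → Z ⊆ W →
      2 * ((idx G r n (r 0)).card + (idx G r n (r n)).card) ≤ Z.card + 2 → False := by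
    intro Z a b q1 q2 q3 q4 q5 q6
    obtain ⟨g, o, S, s1, s2, s3, s4⟩ := h.exists_exit q5 q1 q2 q4 q3
      (fun e => hcol01 (by rw [e]))
    exact hfin g o S s1 s2 s3 (by omega)
  by_cases hX : ∃ i j, i < j ∧ j ≤ n ∧ G.Adj (r n) (r i) ∧ G.Adj (r 0) (r j)
  · obtain ⟨Z, a, b, q1, q2, q3, q4, q5, q6⟩ := hg.exists_cycle_of_crossing h.hcol hr hn hX
    exact hcyc Z a b q1 q2 q3 q4 (q5.trans hW) q6
  push Not at hX
  have hnoC : ∀ x ∈ cyc c z, ¬ G.Adj (r 0) x := by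
    intro x hx ha
    have : x ∈ nb G (cyc c z) (r 0) := mem_nb.2 ⟨hx, ha⟩
    simp [hu] at this
  -- the last neighbour of `r 0`
  obtain ⟨s, hs1, hs2⟩ : ∃ s ≤ n, G.Adj (r 0) (r s) := by
    obtain ⟨p, hp1, hp2, v, hv, hvp⟩ := h.exists_boundary (D := {r 0})
      (by simpa using hm 0 (Nat.zero_le _)) ⟨r 0, by simp⟩ (r 0)
    rw [Finset.mem_singleton] at hv
    subst hv
    rw [Finset.mem_sdiff, Finset.mem_union] at hp1
    rcases hp1.1 with h3 | h3
    · exact absurd hvp (hnoC p h3)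
    · obtain ⟨s, _, hs, rfl⟩ := mem_seg.1 (h0 (mem_nb.2 ⟨h3, hvp⟩))
      exact ⟨s, hs, hvp⟩
  let σ := Nat.findGreatest (fun t => G.Adj (r 0) (r t)) n
  have σ1 : G.Adj (r 0) (r σ) := Nat.findGreatest_spec (P := fun t => G.Adj (r 0) (r t)) hs1 hs2
  have σ2 : σ ≤ n := Nat.findGreatest_le n
  have σ3 : ∀ t, σ < t → t ≤ n → ¬ G.Adj (r 0) (r t) := fun t h1 h2 =>
    Nat.findGreatest_is_greatest h1 h2
  have hex : ∃ t, G.Adj (r n) (r t) ∨ t = n := ⟨n, Or.inr rfl⟩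
  obtain ⟨ρ, ρ1, ρ2⟩ : ∃ ρ, (G.Adj (r n) (r ρ) ∨ ρ = n) ∧
      ∀ t, t < ρ → ¬ (G.Adj (r n) (r t) ∨ t = n) := ⟨_, Nat.find_spec hex, fun t => Nat.find_min hex⟩
  have ρ3 : ρ ≤ n := by
    by_contra hcon
    exact ρ2 n (by omega) (Or.inr rfl)
  have hσρ : σ ≤ ρ := by
    rcases ρ1 with h3 | h3
    · by_contra hcon
      exact hX ρ σ (by omega) σ2 h3 σ1
    · omega
  obtain ⟨x, hx⟩ := hw
  rw [mem_nb] at hx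
  obtain ⟨τ, -, -, rfl⟩ := h.surj hx.1 0
  obtain ⟨R, R1, R2, R3, R4⟩ := h.ip_cat hr hd hx.2
  have hR0 : R 0 = r 0 := R2 0 (Nat.zero_le _)
  have hRn : R n = r n := R2 n le_rfl
  have hRU : seg R 0 (n + 2 * c) ⊆ cyc c z ∪ W := by
    intro x hx
    obtain ⟨t, _, ht, rfl⟩ := mem_seg.1 hx
    by_cases h3 : t ≤ n
    · rw [R2 t h3]; exact Finset.mem_union_right _ (hm t h3)
    · exact Finset.mem_union_left _ (R3 t (by omega))
  have hRm : ∀ t ≤ n + 2 * c, R t ∈ cyc c z ∪ W := fun t ht => hRU (seg_mem (Nat.zero_le _) ht)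
  obtain ⟨i, j, S, hv, hiρ, hρj⟩ := exists_vine (σ := σ) (ρ := ρ) R1 hRU (fun j j1 j2 => by
      refine h.conn (hRm 0 (by omega)) (hRm _ le_rfl) (fun e => ?_) (fun e => ?_)
      · have := R1.2 0 (by omega) j (by omega) e
        omega
      · have := R1.2 _ le_rfl j (by omega) e
        omega) (by
      have := idx_first h.hcol hr.1 σ2 σ1
      omega) (by rwa [hR0, R2 σ σ2]) (fun t t1 t2 => by
      rw [hR0]
      by_cases h3 : t ≤ n
      · rw [R2 t h3]; exact σ3 t t1 h3
      · exact hnoC _ (R3 t (by omega))) hσρ (by omega)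
  have hSC : ∀ x ∈ S, x ∈ cyc c z → n < j ∧ x = R j := by
    intro x hx hxC
    obtain ⟨t, t1, t2, rfl⟩ := R4 x hxC
    have := hv.free t (by omega) t2 hx
    subst this
    exact ⟨t1, rfl⟩
  have hgR : NoGap G R n := by
    intro t ht
    rw [hRn, hR0, R2 t (by omega), R2 (t + 1) (by omega)]
    exact hg t ht
  have hi0 : idx G R n (R 0) = idx G r n (r 0) := by rw [hR0]; exact idx_congr R2 _
  have hin : idx G R n (R n) = idx G r n (r n) := by rw [hRn]; exact idx_congr R2 _
  have ρ4 : ∀ t ≤ n, G.Adj (R n) (R t) → ρ ≤ t := by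
    intro t ht ha
    rw [hRn, R2 t ht] at ha
    by_contra hcon
    exact ρ2 t (by omega) (Or.inl ha)
  have hsegR : seg R 0 n ⊆ W := by
    intro x hx
    obtain ⟨t, _, ht, rfl⟩ := mem_seg.1 hx
    rw [R2 t ht]; exact hm t ht
  by_cases hjn : j ≤ n
  · obtain ⟨Z, a, b, q1, q2, q3, q4, q5, q6⟩ := hgR.exists_cycle_of_vine h.hcol R1 (by omega) hn hv hjn
      hiρ hρj (by rw [hRn, R2 ρ ρ3]; exact ρ1.resolve_right (by omega)) ρ4
    rw [hi0, hin] at q6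
    rw [hR0] at q3
    rw [hRn] at q4
    refine hcyc Z a b q1 q2 q3 q4 (fun x hx => ?_) q6
    rcases Finset.mem_union.1 (q5 hx) with h3 | h3
    · rcases Finset.mem_union.1 (hv.sub h3) with h4 | h4
      · have := (hSC x h3 h4).1
        omega
      · exact h4
    · exact hsegR h3
  · have hj2 := hv.hj
    obtain ⟨g, g1, g2⟩ := hv.pth.strip (fun e => by
      have := R1.2 i (by omega) j (by omega) e
      omega)
    have p1 := (R1.pth_seg (by omega : i ≤ n) (by omega)).symm.join g2 (by
      intro x hx hx'
      obtain ⟨t, t1, t2, rfl⟩ := mem_seg.1 hx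
      rcases t1.eq_or_lt with h3 | h3
      · rw [h3]
      · have := hv.free t h3 (by omega) (Finset.mem_of_mem_erase hx')
        omega)
    rw [hRn] at p1
    obtain ⟨o, -, -, ho⟩ := h.surj (R3 j (by omega)) 0
    refine hfin g o _ p1 (fun x hx => ?_) (by rwa [ho]) ?_
    · rcases Finset.mem_union.1 hx with h3 | h3
      · obtain ⟨t, t1, t2, rfl⟩ := mem_seg.1 h3
        rw [R2 t t2]; exact hm t t2
      · rcases Finset.mem_union.1 (hv.sub (Finset.mem_of_mem_erase h3)) with h4 | h4
        · exact absurd (hSC x (Finset.mem_of_mem_erase h3) h4).2 (Finset.ne_of_mem_erase h3)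
        · exact h4
    · obtain ⟨a, y, ha, hy, hs3, hs4, hs5⟩ := hv.start
      have hRn' : IP G R n := ⟨fun i hi => R1.1 i (by omega), fun i hi j hj =>
        R1.2 i (by omega) j (by omega)⟩
      have hin' : ∀ t ≤ n, R t ∈ S → R t ∈ seg R i n ∪ S.erase (R j) := fun t ht hts =>
        Finset.mem_union_right _ (Finset.mem_erase.2 ⟨fun e => by
          have := R1.2 t (by omega) j (by omega) e
          omega, hts⟩)
      have hcnt := hgR.two_mul_card_le_add h.hcol hRn' hn (Z := seg R i n ∪ S.erase (R j))
        (α := y - 1) (β := 0) (by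
          intro t ht h2
          have := idx_first h.hcol hRn'.1 ht h2
          rcases hs5 t (by omega) h2 with h3 | h3
          · exact ⟨hin' _ ht (hs3 (seg_mem (Nat.zero_le _) h3)), fun _ =>
              hin' _ (by omega) (hs3 (seg_mem (Nat.zero_le _) (by omega)))⟩
          · exact ⟨hin' _ ht (hs4 (seg_mem h3.1 h3.2)), fun _ =>
              hin' _ (by omega) (hs4 (seg_mem (by omega) (by omega)))⟩) (by
          intro t ht h2
          have := idx_last h.hcol hRn'.1 hn ht h2
          have := ρ4 t ht h2
          exact ⟨Finset.mem_union_left _ (seg_mem (by omega) ht), fun _ =>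
            Finset.mem_union_left _ (seg_mem (by omega) (by omega))⟩)
      rw [hi0, hin] at hcnt
      have hpos := p1.card_pos
      omega

/-- A path off the cycle whose ends have opposite colours and all their neighbours off the cycle
on the path can be closed up to a cycle. -/
lemma exists_gap (h : Core G col c z W m) {r : ℕ → V} {n : ℕ} (hr : IP G r n)
    (hn : n % 2 = 1) (hW : seg r 0 n ⊆ W) (h0 : nb G W (r 0) ⊆ seg r 0 n)
    (h1 : nb G W (r n) ⊆ seg r 0 n) :
    ∃ t < n, G.Adj (r n) (r t) ∧ G.Adj (r 0) (r (t + 1)) := by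
  suffices ¬ NoGap G r n by
    unfold NoGap at this
    push Not at this
    exact this
  intro hg
  have hcard := hg.two_mul_card_le h.hcol hr.1 hn
  have hc1 := card_nb_le_idx h0
  have hc2 := card_nb_le_idx h1
  have hm : ∀ t ≤ n, r t ∈ W := fun t ht => hW (seg_mem (Nat.zero_le _) ht)
  have hd : Disjoint (seg r 0 n) (cyc c z) := h.hW.mono_left hW
  have hk := Finset.card_le_card hW
  rw [hr.card_seg le_rfl, h.card_W] at hk
  have hmc := h.hm
  have hcol01 : col (r 0) ≠ col (r n) := by
    rw [Ne, IP.col_eq h.hcol hr.1 (Nat.zero_le _) le_rfl]; omega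
  have hdeg := h.two_le_card_nb_add (hm 0 (Nat.zero_le _)) (hm n le_rfl) hcol01
  rw [nb_union h.hW.symm, nb_union h.hW.symm] at hdeg
  by_cases hu : (nb G (cyc c z) (r 0)).Nonempty <;> by_cases hw : (nb G (cyc c z) (r n)).Nonempty
  · have := h.card_nb_add_le hr.pth hd hcol01 hu hw
    rw [hr.card_seg le_rfl] at this
    omega
  · refine h.exists_gap_aux hr.reverse hn (by rwa [seg_reverse]) (by simpa [seg_reverse] using h1)
      (by simpa [seg_reverse] using h0) (by simpa using hw) (by simpa using hu) ?_
    intro t ht h3 h4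
    simp only [Nat.sub_self, Nat.sub_zero] at h3 h4
    refine hg (n - (t + 1)) (by omega) h4 ?_
    rwa [show n - (t + 1) + 1 = n - t by omega]
  · exact h.exists_gap_aux hr hn hW h0 h1 hu hw hg
  · rw [Finset.not_nonempty_iff_eq_empty] at hu hw
    rw [hu, hw, Finset.card_empty] at hdeg
    omega

end Core

/-- A path on an even number of vertices has equally many vertices of each colour. -/
lemma IP.cnt_seg {r : ℕ → V} {n k : ℕ} {col : V → Bool} (hcol : ∀ u v, G.Adj u v → col u ≠ col v)
    (h : IP G r n) (hn : n + 1 = 2 * k) (b : Bool) : cnt col b (seg r 0 n) = k := by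
  have key : ∀ b, k ≤ cnt col b (seg r 0 n) := by
    intro b
    obtain ⟨e, he, hb⟩ : ∃ e, e ≤ 1 ∧ col (r e) = b := by
      by_cases h0 : col (r 0) = b
      · exact ⟨0, by omega, h0⟩
      · refine ⟨1, le_rfl, ?_⟩
        have := hcol _ _ (h.1 0 (by omega))
        revert h0 this
        cases col (r 0) <;> cases col (r 1) <;> cases b <;> simp
    have hsub : (Finset.range k).image (fun i => r (2 * i + e)) ⊆
        (seg r 0 n).filter (fun v => col v = b) := by
      intro x hx
      obtain ⟨i, hi, rfl⟩ := Finset.mem_image.1 hx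
      have := Finset.mem_range.1 hi
      refine Finset.mem_filter.2 ⟨seg_mem (by omega) (by omega), ?_⟩
      rw [← hb]
      exact (IP.col_eq hcol h.1 (by omega) (by omega)).2 (by omega)
    have hcard := Finset.card_le_card hsub
    rw [Finset.card_image_of_injOn, Finset.card_range] at hcard
    · exact hcard
    · intro i hi j hj hij
      simp only [Finset.coe_range, Set.mem_Iio] at hi hj
      have := h.2 _ (by omega) _ (by omega) hij
      omega
  have h1 := key b
  have h2 := key (!b)
  have h3 := cnt_add_not col b (seg r 0 n)
  rw [h.card_seg le_rfl] at h3
  omega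

/-- If the last vertex of a path is adjacent to `r t`, then there is a path from `r 0` to
`r (t + 1)` with the same vertices. -/
lemma IP.pth_of_gap {r : ℕ → V} {n t : ℕ} (hr : IP G r n) (ht : t < n) (h1 : G.Adj (r n) (r t)) :
    Pth G (r 0) (r (t + 1)) (seg r 0 n) := by
  have h3 := (hr.pth_seg (Nat.zero_le t) ht.le).append (hr.pth_seg (by omega : t + 1 ≤ n)
    le_rfl).symm h1.symm (by
      rw [Finset.disjoint_left]
      intro x hx hx'
      obtain ⟨s, _, s2, rfl⟩ := mem_seg.1 hx
      have := (hr.mem_seg_iff le_rfl (by omega)).1 hx'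
      omega)
  convert h3 using 1
  ext x
  rw [Finset.mem_union, mem_seg, mem_seg, mem_seg]
  constructor
  · rintro ⟨s, s1, s2, s3⟩
    rcases le_or_gt s t with h4 | h4
    · exact Or.inl ⟨s, s1, h4, s3⟩
    · exact Or.inr ⟨s, h4, s2, s3⟩
  · rintro (⟨s, s1, s2, s3⟩ | ⟨s, s1, s2, s3⟩)
    · exact ⟨s, s1, by omega, s3⟩
    · exact ⟨s, by omega, s2, s3⟩

lemma sum_range_two_mul_le (f : ℕ → ℕ) (B : ℕ) :
    ∀ k, (∀ i, i + 1 < 2 * k → f i + f (i + 1) ≤ B) → ∑ i ∈ Finset.range (2 * k), f i ≤ k * B := by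
  intro k
  induction k with
  | zero => simp
  | succ k ih =>
    intro h
    have h1 := ih (fun i hi => h i (by omega))
    have h2 := h (2 * k) (by omega)
    rw [show 2 * (k + 1) = 2 * k + 1 + 1 by ring, Finset.sum_range_succ, Finset.sum_range_succ]
    linarith

namespace Core

variable {col : V → Bool} {c m : ℕ} {z : ℕ → V} {W : Finset V}

lemma disj (h : Core G col c z W m) {S : Finset V} (hS : S ⊆ W) : Disjoint S (cyc c z) :=
  Finset.disjoint_of_subset_left hS h.hW

lemma not_closed (h : Core G col c z W m) {Z : Finset V} {a b : V} (hZ : Z ⊆ W)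
    (hp : Pth G a b Z) (hab : G.Adj a b) (hcl : ∀ x ∈ Z, nb G W x ⊆ Z) : False := by
  obtain ⟨r, n, hr, rfl, rfl, rfl⟩ := hp
  have hodd : n % 2 = 1 := by
    have h1 := h.hcol _ _ hab
    rw [Ne, IP.col_eq h.hcol hr.1 (Nat.zero_le n) le_rfl] at h1
    omega
  obtain ⟨k, hk⟩ : ∃ k, n + 1 = 2 * k := ⟨(n + 1) / 2, by omega⟩
  have hct := hr.cnt_seg h.hcol hk
  have hkc : k ≤ c := by
    have h1 := Finset.card_le_card (Finset.filter_subset_filter (fun v => col v = true) hZ)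
    have h2 := hct true
    have h3 := h.hcnt true
    have h4 := h.hm
    unfold cnt at h2 h3
    omega
  have one : ∀ w x, w ∈ seg r 0 n → x ∈ seg r 0 n → x ≠ w →
      (nb G (cyc c z) w).card + k ≤ c + 1 := by
    intro w x hw hx hxw
    obtain ⟨g, o, S, h1, h2, h3, h4⟩ := h.exists_exit hZ hr.pth hab hw hx hxw
    rw [hr.card_seg le_rfl] at h4
    have h5 := h.card_nb_erase_le h1.symm (h.disj h2) h3
    have h6 := Finset.pred_card_le_card_erase (s := nb G (cyc c z) w) (a := z o)
    omega
  have pair : ∀ i, i + 1 < 2 * k →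
      (nb G (cyc c z) (r i)).card + (nb G (cyc c z) (r (i + 1))).card ≤ c + 1 - k := by
    intro i hi
    have hadj := hr.1 i (by omega)
    have hi1 : r i ∈ seg r 0 n := seg_mem (by omega) (by omega)
    have hi2 : r (i + 1) ∈ seg r 0 n := seg_mem (by omega) (by omega)
    rcases (nb G (cyc c z) (r i)).eq_empty_or_nonempty with he | he
    · have := one _ _ hi2 hi1 hadj.ne
      rw [he, Finset.card_empty]
      omega
    rcases (nb G (cyc c z) (r (i + 1))).eq_empty_or_nonempty with he' | he'
    · have := one _ _ hi1 hi2 hadj.ne'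
      rw [he', Finset.card_empty]
      omega
    have h1 := h.card_nb_add_le (hr.open_at hab (by omega : i < n)) (h.disj hZ) (h.hcol _ _ hadj)
      he he'
    rw [hr.card_seg le_rfl] at h1
    omega
  have hsum : ∑ v ∈ seg r 0 n, (nb G ((cyc c z ∪ W) \ seg r 0 n) v).card ≤ k * (c + 1 - k) := by
    have h1 : ∑ v ∈ seg r 0 n, (nb G ((cyc c z ∪ W) \ seg r 0 n) v).card ≤
        ∑ v ∈ seg r 0 n, (nb G (cyc c z) v).card := by
      refine Finset.sum_le_sum fun v hv => Finset.card_le_card fun x hx => ?_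
      rw [mem_nb, Finset.mem_sdiff, Finset.mem_union] at hx
      rw [mem_nb]
      rcases hx.1.1 with h2 | h2
      · exact ⟨h2, hx.2⟩
      · exact absurd (hcl v hv (mem_nb.2 ⟨h2, hx.2⟩)) hx.1.2
    have h2 := sum_range_two_mul_le _ _ k pair
    refine h1.trans (le_trans (le_of_eq ?_) h2)
    unfold seg
    rw [Finset.sum_image]
    · refine Finset.sum_congr ?_ fun _ _ => rfl
      ext t
      simp only [Finset.mem_Icc, Finset.mem_range]
      omega
    · intro i hi j hj hij
      simp only [Finset.coe_Icc, Set.mem_Icc] at hi hj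
      exact hr.2 i (by omega) j (by omega) hij
  have hdeg := degSum_le h.hcol (seg r 0 n)
  have hdrop := h.drop (seg r 0 n) hZ ⟨r 0, seg_mem (by omega) (by omega)⟩
  rw [hct, hct] at hdeg
  rw [hct, hct, min_self, max_self] at hdrop
  obtain ⟨d, hd⟩ : ∃ d, c + 1 = k + d := ⟨c + 1 - k, by omega⟩
  rw [hd, Nat.add_sub_cancel_left] at hsum
  have : c * k + k = k * k + k * d := by
    have : (c + 1) * k = (k + d) * k := by rw [hd]
    linarith
  linarith

end Core

/-- `G[R]` has a perfect matching. -/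
def PM (G : SimpleGraph V) (R : Finset V) : Prop :=
  ∃ f : V → V, ∀ x ∈ R, f x ∈ R ∧ f (f x) = x ∧ G.Adj x (f x)

lemma exists_pm {col : V → Bool} (hcol : ∀ u v, G.Adj u v → col u ≠ col v) {W : Finset V} {m : ℕ}
    (hcnt : ∀ b, cnt col b W = m)
    (hall : ∀ Y ⊆ W.filter (fun v => col v = true), Y.card ≤ (Y.biUnion (nb G W)).card) :
    PM G W := by
  have h1 := (Finset.all_card_le_biUnion_card_iff_exists_injective
    (fun v : {v // v ∈ W.filter (fun v => col v = true)} => nb G W v)).1 (by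
      intro s
      have h2 := hall (s.map (Function.Embedding.subtype _)) (by
        intro x hx
        obtain ⟨y, _, rfl⟩ := Finset.mem_map.1 hx
        exact y.2)
      rw [Finset.card_map] at h2
      refine h2.trans (le_of_eq ?_)
      congr 1
      ext x
      simp)
  obtain ⟨f, hf, hfm⟩ := h1
  let g : V → V := fun x => if hx : x ∈ W.filter (fun v => col v = true) then f ⟨x, hx⟩ else x
  have hg : ∀ x ∈ W, col x = true → g x ∈ W ∧ G.Adj x (g x) := by
    intro x hx hc
    have hx' : x ∈ W.filter (fun v => col v = true) := Finset.mem_filter.2 ⟨hx, hc⟩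
    have := hfm ⟨x, hx'⟩
    simp only [g, dif_pos hx']
    exact mem_nb.1 this
  have ginj : ∀ x ∈ W, ∀ y ∈ W, col x = true → col y = true → g x = g y → x = y := by
    intro x hx y hy hcx hcy hxy
    have hx' : x ∈ W.filter (fun v => col v = true) := Finset.mem_filter.2 ⟨hx, hcx⟩
    have hy' : y ∈ W.filter (fun v => col v = true) := Finset.mem_filter.2 ⟨hy, hcy⟩
    simp only [g, dif_pos hx', dif_pos hy'] at hxy
    simpa using hf hxy
  have himg : (W.filter (fun v => col v = true)).image g = W.filter (fun v => col v = false) := by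
    refine Finset.eq_of_subset_of_card_le ?_ ?_
    · intro y hy
      obtain ⟨x, hx, rfl⟩ := Finset.mem_image.1 hy
      rw [Finset.mem_filter] at hx
      have h2 := hg x hx.1 hx.2
      have h3 := hcol _ _ h2.2
      rw [hx.2] at h3
      rw [Finset.mem_filter]
      exact ⟨h2.1, by simpa using h3.symm⟩
    · rw [Finset.card_image_of_injOn]
      · have h2 := hcnt true
        have h3 := hcnt false
        unfold cnt at h2 h3
        omega
      · intro x hx y hy
        simp only [Finset.coe_filter, Set.mem_ofPred_eq] at hx hy
        exact ginj x hx.1 y hy.1 hx.2 hy.2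
  have hsurj : ∀ y : V, ∃ x, y ∈ W → col y = false → x ∈ W ∧ col x = true ∧ g x = y := by
    intro y
    by_cases hy : y ∈ W.filter (fun v => col v = false)
    · rw [← himg] at hy
      obtain ⟨x, hx, rfl⟩ := Finset.mem_image.1 hy
      rw [Finset.mem_filter] at hx
      exact ⟨x, fun _ _ => ⟨hx.1, hx.2, rfl⟩⟩
    · exact ⟨y, fun h1 h2 => absurd (Finset.mem_filter.2 ⟨h1, h2⟩) hy⟩
  choose k hk using hsurj
  refine ⟨fun x => if col x = true then g x else k x, fun x hx => ?_⟩
  by_cases hc : col x = true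
  · have h2 := hg x hx hc
    have h3 : col (g x) = false := by
      have := hcol _ _ h2.2
      rw [hc] at this
      simpa using this.symm
    have h4 := hk (g x) h2.1 h3
    simp only [hc, if_true, h3, Bool.false_eq_true, if_false]
    exact ⟨h2.1, ginj _ h4.1 _ hx h4.2.1 hc h4.2.2, h2.2⟩
  · have hc' : col x = false := by simpa using hc
    have h4 := hk x hx hc'
    simp only [hc', Bool.false_eq_true, if_false, h4.2.1, if_true]
    refine ⟨h4.1, h4.2.2, ?_⟩
    have := (hg _ h4.1 h4.2.1).2
    rw [h4.2.2] at this
    exact this.symm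

namespace Core

variable {col : V → Bool} {c m : ℕ} {z : ℕ → V} {W : Finset V}

lemma not_pm (h : Core G col c z W m) (hne : W.Nonempty) (hpm : PM G W) : False := by
  have hex : ∃ k S u w, Pth G u w S ∧ S ⊆ W ∧ col u ≠ col w ∧ PM G (W \ S) ∧ S.card = k := by
    obtain ⟨f, hf⟩ := hpm
    obtain ⟨x, hx⟩ := hne
    have h1 := hf x hx
    have hadj := h1.2.2
    refine ⟨_, insert (f x) {x}, x, f x, (Pth.single x).snoc hadj (by simpa using hadj.ne'), ?_,
      h.hcol _ _ hadj, ⟨f, fun y hy => ?_⟩, rfl⟩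
    · intro y hy
      rw [Finset.mem_insert, Finset.mem_singleton] at hy
      rcases hy with rfl | rfl
      · exact h1.1
      · exact hx
    · rw [Finset.mem_sdiff, Finset.mem_insert, Finset.mem_singleton] at hy ⊢
      have h2 := hf y hy.1
      refine ⟨⟨h2.1, ?_⟩, h2.2⟩
      rintro (h3 | h3)
      · exact hy.2 (Or.inr (by rw [← h2.2.1, h3, h1.2.1]))
      · exact hy.2 (Or.inl (by rw [← h2.2.1, h3]))
  have hb : ∀ k, (∃ S u w, Pth G u w S ∧ S ⊆ W ∧ col u ≠ col w ∧ PM G (W \ S) ∧ S.card = k) →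
      k ≤ W.card := by
    rintro k ⟨S, u, w, _, h2, _, _, rfl⟩
    exact Finset.card_le_card h2
  obtain ⟨k0, hk0⟩ := hex
  have hspec := Nat.findGreatest_spec (P := fun k => ∃ S u w, Pth G u w S ∧ S ⊆ W ∧
    col u ≠ col w ∧ PM G (W \ S) ∧ S.card = k) (hb k0 hk0) hk0
  obtain ⟨S, u, w, hp, hS, huw, ⟨f, hf⟩, hcard⟩ := hspec
  have hmax : ∀ T u w, Pth G u w T → T ⊆ W → col u ≠ col w → PM G (W \ T) → T.card ≤ S.card := by
    intro T u w h1 h2 h3 h4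
    rw [hcard]
    exact Nat.le_findGreatest (Finset.card_le_card h2) ⟨T, u, w, h1, h2, h3, h4, rfl⟩
  have hext : ∀ u w, Pth G u w S → col u ≠ col w → nb G W w ⊆ S := by
    intro u w hp hc x hx
    by_contra hxS
    rw [mem_nb] at hx
    obtain ⟨f1, f2, f3⟩ := hf x (Finset.mem_sdiff.2 ⟨hx.1, hxS⟩)
    rw [Finset.mem_sdiff] at f1
    have hfx : f x ∉ insert x S := by
      rw [Finset.mem_insert]
      rintro (h1 | h1)
      · exact f3.ne' h1
      · exact f1.2 h1
    have h1 := (hp.snoc hx.2 hxS).snoc f3 hfx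
    have h2 := hmax _ _ _ h1 (by
      intro y hy
      rw [Finset.mem_insert, Finset.mem_insert] at hy
      rcases hy with rfl | rfl | hy
      · exact f1.1
      · exact hx.1
      · exact hS hy) (by
      have h3 := h.hcol _ _ hx.2
      have h4 := h.hcol _ _ f3
      revert hc h3 h4
      cases col u <;> cases col w <;> cases col x <;> cases col (f x) <;> simp)
      ⟨f, fun y hy => by
        rw [Finset.mem_sdiff, Finset.mem_insert, Finset.mem_insert] at hy ⊢
        push Not at hy
        have h5 := hf y (Finset.mem_sdiff.2 ⟨hy.1, hy.2.2.2⟩)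
        have h6 := Finset.mem_sdiff.1 h5.1
        refine ⟨⟨h6.1, ?_⟩, h5.2⟩
        rintro (h7 | h7 | h7)
        · exact hy.2.2.1 (by rw [← h5.2.1, h7, f2])
        · exact hy.2.1 (by rw [← h5.2.1, h7])
        · exact h6.2 h7⟩
    rw [Finset.card_insert_of_notMem hfx, Finset.card_insert_of_notMem hxS] at h2
    omega
  have hsat0 := hext w u hp.symm huw.symm
  have hsatn := hext u w hp huw
  have hZ : ∃ a b, Pth G a b S ∧ G.Adj a b := by
    obtain ⟨r, n, hr, rfl, rfl, rfl⟩ := hp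
    have hodd : n % 2 = 1 := by
      rw [Ne, IP.col_eq h.hcol hr.1 (Nat.zero_le n) le_rfl] at huw
      omega
    obtain ⟨t, ht, h1, h2⟩ := h.exists_gap hr hodd hS hsat0 hsatn
    exact ⟨r 0, r (t + 1), hr.pth_of_gap ht h1, h2⟩
  obtain ⟨a, b, hab, hadj⟩ := hZ
  refine h.not_closed hS hab hadj fun v hv => ?_
  obtain ⟨v', h1, h2⟩ := hab.rotate hadj hv
  exact hext v' v h2 (h.hcol _ _ h1)

end Core

/-- `X` is the neighbourhood of `Y` in `W`, and can be matched into `Y` without any given vertex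
of `Y`. -/
structure Viol (G : SimpleGraph V) (W X Y : Finset V) : Prop where
  sub : Y ⊆ W
  ne : Y.Nonempty
  eq : X = Y.biUnion (nb G W)
  mt : ∀ y ∈ Y, ∃ f : V → V, Set.InjOn f X ∧ ∀ x ∈ X, f x ∈ Y.erase y ∧ G.Adj x (f x)

namespace Viol

variable {W X Y : Finset V}

lemma mem_left (h : Viol G W X Y) {x y : V} (hy : y ∈ Y) (hx : x ∈ W) (hxy : G.Adj x y) :
    x ∈ X := by
  rw [h.eq, Finset.mem_biUnion]
  exact ⟨y, hy, mem_nb.2 ⟨hx, hxy.symm⟩⟩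

lemma nb_sub (h : Viol G W X Y) {y : V} (hy : y ∈ Y) : nb G W y ⊆ X := fun _ hx =>
  h.mem_left hy (mem_nb.1 hx).1 (mem_nb.1 hx).2.symm

lemma left_sub (h : Viol G W X Y) : X ⊆ W := by
  intro x hx
  rw [h.eq, Finset.mem_biUnion] at hx
  obtain ⟨y, _, hx⟩ := hx
  exact (mem_nb.1 hx).1

lemma union_sub (h : Viol G W X Y) : X ∪ Y ⊆ W := Finset.union_subset h.left_sub h.sub

lemma col_left (h : Viol G W X Y) {col : V → Bool} (hcol : ∀ u v, G.Adj u v → col u ≠ col v)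
    {b : Bool} (hY : ∀ y ∈ Y, col y = b) : ∀ x ∈ X, col x = !b := by
  intro x hx
  rw [h.eq, Finset.mem_biUnion] at hx
  obtain ⟨y, hy, hx⟩ := hx
  have := hcol _ _ (mem_nb.1 hx).2
  rw [hY y hy] at this
  revert this
  cases b <;> cases col x <;> simp

lemma disj (h : Viol G W X Y) {col : V → Bool} (hcol : ∀ u v, G.Adj u v → col u ≠ col v)
    {b : Bool} (hY : ∀ y ∈ Y, col y = b) : Disjoint X Y := by
  rw [Finset.disjoint_left]
  intro x hx hy
  have := h.col_left hcol hY x hx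
  rw [hY x hy] at this
  cases b <;> simp at this

/-- From every vertex there is a path inside `X ∪ Y` to a vertex of `Y` having all its
neighbours on the path. -/
lemma exists_leg (h : Viol G W X Y) (hd : Disjoint X Y) {x : V} (hx : x ∈ X ∪ Y) :
    ∃ w S, Pth G x w S ∧ w ∈ Y ∧ S ⊆ X ∪ Y ∧ nb G W w ⊆ S := by
  suffices ∃ w S, Pth G x w S ∧ w ∈ Y ∧ S ⊆ X ∪ Y ∧ Mt G X Y S by
    obtain ⟨w, S, h1, h2, h3, h4⟩ := this
    obtain ⟨w', S', -, h6, h7, -, h9, h10⟩ :=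
      Mt.saturate hd (fun y hy => h.nb_sub hy) _ le_rfl h1 h2 h4
    exact ⟨w', S', h6, h7, h10.trans (Finset.union_subset h3 subset_rfl), h9⟩
  rcases Finset.mem_union.1 hx with hx' | hx'
  · obtain ⟨y, hy⟩ := h.ne
    obtain ⟨f, f1, f2⟩ := h.mt y hy
    have h1 := f2 x hx'
    have h2 := Finset.mem_of_mem_erase h1.1
    refine ⟨f x, insert (f x) {x}, (Pth.single x).snoc h1.2 (by simpa using h1.2.ne'), h2, ?_, f,
      f1.mono (by simp), ?_⟩
    · intro v hv
      rw [Finset.mem_insert, Finset.mem_singleton] at hv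
      rcases hv with rfl | rfl
      · exact Finset.mem_union_right _ h2
      · exact hx
    · intro v hv
      rw [Finset.mem_sdiff, Finset.mem_insert, Finset.mem_singleton] at hv
      have h3 := f2 v hv.1
      have h4 := Finset.mem_of_mem_erase h3.1
      refine ⟨?_, h3.2⟩
      rw [Finset.mem_sdiff, Finset.mem_insert, Finset.mem_singleton]
      refine ⟨h4, ?_⟩
      rintro (h5 | h5)
      · exact hv.2 (Or.inr (f1 hv.1 hx' h5))
      · exact Finset.disjoint_left.1 hd hx' (h5 ▸ h4)
  · obtain ⟨f, f1, f2⟩ := h.mt x hx'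
    refine ⟨x, {x}, Pth.single x, hx', by simpa using hx, f, f1.mono (by simp), ?_⟩
    intro v hv
    have h3 := f2 v (Finset.mem_sdiff.1 hv).1
    rw [Finset.mem_erase] at h3
    exact ⟨Finset.mem_sdiff.2 ⟨h3.1.2, by simpa using h3.1.1⟩, h3.2⟩

/-- Violators on different sides are disjoint from each other's neighbourhoods. -/
lemma inter_eq_empty {X' Y' : Finset V} (h : Viol G W X Y) (h' : Viol G W X' Y') :
    Y ∩ X' = ∅ ∧ Y' ∩ X = ∅ := by
  have key : ∀ {X Y X' Y' : Finset V}, Viol G W X Y → Viol G W X' Y' →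
      (Y' ∩ X).card ≤ (Y ∩ X').card ∧ ((Y ∩ X').Nonempty → (Y' ∩ X).card < (Y ∩ X').card) := by
    intro X Y X' Y' h h'
    have main : ∀ y ∈ Y, (Y' ∩ X).card ≤ ((Y ∩ X').erase y).card := by
      intro y hy
      obtain ⟨f, f1, f2⟩ := h.mt y hy
      refine Finset.card_le_card_of_injOn f (fun x hx => ?_) (f1.mono fun x hx => ?_)
      · rw [Finset.mem_coe, Finset.mem_inter] at hx
        have h1 := f2 x hx.2
        rw [Finset.mem_erase] at h1
        rw [Finset.mem_coe, Finset.mem_erase, Finset.mem_inter]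
        exact ⟨h1.1.1, h1.1.2, h'.mem_left hx.1 (h.sub h1.1.2) h1.2.symm⟩
      · exact (Finset.mem_inter.1 (Finset.mem_coe.1 hx)).2
    refine ⟨?_, fun ⟨y, hy⟩ => ?_⟩
    · obtain ⟨y, hy⟩ := h.ne
      exact (main y hy).trans (Finset.card_le_card (Finset.erase_subset _ _))
    · have h1 := main y (Finset.mem_inter.1 hy).1
      have h2 := Finset.card_erase_lt_of_mem hy
      omega
  have h1 := key h h'
  have h2 := key h' h
  have h3 : Y ∩ X' = ∅ := by
    by_contra hne
    have := h1.2 (Finset.nonempty_iff_ne_empty.2 hne)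
    omega
  refine ⟨h3, ?_⟩
  have := h1.1
  rw [h3, Finset.card_empty] at this
  exact Finset.card_eq_zero.1 (by omega)

end Viol

namespace Core

variable {col : V → Bool} {c m : ℕ} {z : ℕ → V} {W : Finset V}

/-- The violators provided by the failure of Hall's condition. -/
lemma exists_viol (h : Core G col c z W m) (hpm : ¬ PM G W) :
    ∃ X₁ Y₁ X₂ Y₂, Viol G W X₁ Y₁ ∧ (∀ y ∈ Y₁, col y = true) ∧ Viol G W X₂ Y₂ ∧
      ∀ y ∈ Y₂, col y = false := by
  have h1 : ∃ Y ⊆ W.filter (fun v => col v = true), (Y.biUnion (nb G W)).card < Y.card := by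
    by_contra hcon
    push Not at hcon
    exact hpm (exists_pm h.hcol h.hcnt hcon)
  obtain ⟨Y, hY, hYc⟩ := h1
  have hsub : Y.biUnion (nb G W) ⊆ W.filter (fun v => col v = false) := by
    intro x hx
    obtain ⟨y, hy, hx⟩ := Finset.mem_biUnion.1 hx
    have h2 := (Finset.mem_filter.1 (hY hy)).2
    rw [mem_nb] at hx
    have h3 := h.hcol _ _ hx.2
    rw [h2] at h3
    exact Finset.mem_filter.2 ⟨hx.1, by simpa using h3.symm⟩
  have hX : ((W.filter (fun v => col v = false) \ Y.biUnion (nb G W)).biUnion (nb G W)).card <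
      (W.filter (fun v => col v = false) \ Y.biUnion (nb G W)).card := by
    rw [Finset.card_sdiff_of_subset hsub]
    have h2 : (W.filter (fun v => col v = false) \ Y.biUnion (nb G W)).biUnion (nb G W) ⊆
        W.filter (fun v => col v = true) \ Y := by
      intro y hy
      obtain ⟨x, hx, hy⟩ := Finset.mem_biUnion.1 hy
      rw [Finset.mem_sdiff, Finset.mem_filter] at hx
      rw [mem_nb] at hy
      have h3 := h.hcol _ _ hy.2
      rw [hx.1.2] at h3
      refine Finset.mem_sdiff.2 ⟨Finset.mem_filter.2 ⟨hy.1, by simpa using h3.symm⟩, fun hy' => ?_⟩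
      exact hx.2 (Finset.mem_biUnion.2 ⟨y, hy', mem_nb.2 ⟨hx.1.1, hy.2.symm⟩⟩)
    have h3 := Finset.card_le_card h2
    rw [Finset.card_sdiff_of_subset hY] at h3
    have h4 := h.hcnt true
    have h5 := h.hcnt false
    have h6 := Finset.card_le_card hY
    unfold cnt at h4 h5
    omega
  have mk : ∀ {Y : Finset V}, Y ⊆ W → (Y.biUnion (nb G W)).card < Y.card →
      ∃ X' Y', Y' ⊆ Y ∧ Viol G W X' Y' := by
    intro Y hY hc
    obtain ⟨Y', h1, h2, -, h4⟩ := exists_violator hc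
    exact ⟨_, Y', h1, h1.trans hY, h2, rfl, h4⟩
  obtain ⟨X₁, Y₁, a1, a2⟩ := mk (hY.trans (Finset.filter_subset _ _)) hYc
  obtain ⟨X₂, Y₂, b1, b2⟩ := mk (Finset.sdiff_subset.trans (Finset.filter_subset _ _)) hX
  exact ⟨X₁, Y₁, X₂, Y₂, a2, fun y hy => (Finset.mem_filter.1 (hY (a1 hy))).2, b2, fun y hy =>
    (Finset.mem_filter.1 (Finset.mem_sdiff.1 (b1 hy)).1).2⟩

/-- A path without gaps whose ends have all their neighbours on it gives a long cycle. -/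
lemma not_noGap (h : Core G col c z W m) {r : ℕ → V} {n : ℕ} (hr : IP G r n) (hn : n % 2 = 1)
    (hU : seg r 0 n ⊆ cyc c z ∪ W) (h0 : nb G (cyc c z ∪ W) (r 0) ⊆ seg r 0 n)
    (h1 : nb G (cyc c z ∪ W) (r n) ⊆ seg r 0 n)
    (hd : c + 2 ≤ (nb G (cyc c z ∪ W) (r 0)).card + (nb G (cyc c z ∪ W) (r n)).card) :
    ¬ NoGap G r n := by
  intro hg
  have hc1 := card_nb_le_idx h0
  have hc2 := card_nb_le_idx h1
  have hm : ∀ t ≤ n, r t ∈ cyc c z ∪ W := fun t ht => hU (seg_mem (Nat.zero_le _) ht)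
  by_cases hX : ∃ i j, i < j ∧ j ≤ n ∧ G.Adj (r n) (r i) ∧ G.Adj (r 0) (r j)
  · obtain ⟨Z, a, b, q1, q2, -, -, -, q6⟩ := hg.exists_cycle_of_crossing h.hcol hr hn hX
    have := h.nolong _ _ _ q1 q2
    omega
  push Not at hX
  have hs : G.Adj (r 0) (r 1) := hr.1 0 (by omega)
  let σ := Nat.findGreatest (fun t => G.Adj (r 0) (r t)) n
  have σ1 : G.Adj (r 0) (r σ) :=
    Nat.findGreatest_spec (P := fun t => G.Adj (r 0) (r t)) (by omega : 1 ≤ n) hs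
  have σ2 : σ ≤ n := Nat.findGreatest_le n
  have σ3 : ∀ t, σ < t → t ≤ n → ¬ G.Adj (r 0) (r t) := fun t h1 h2 =>
    Nat.findGreatest_is_greatest h1 h2
  have hl : G.Adj (r n) (r (n - 1)) := by
    have := (hr.1 (n - 1) (by omega)).symm
    rwa [show n - 1 + 1 = n by omega] at this
  have hex : ∃ t, G.Adj (r n) (r t) := ⟨_, hl⟩
  obtain ⟨ρ, ρ1, ρ2⟩ : ∃ ρ, G.Adj (r n) (r ρ) ∧ ∀ t, t < ρ → ¬ G.Adj (r n) (r t) :=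
    ⟨_, Nat.find_spec hex, fun t => Nat.find_min hex⟩
  have ρ3 : ρ < n := by
    by_contra hcon
    exact ρ2 (n - 1) (by omega) hl
  have hσρ : σ ≤ ρ := by
    by_contra hcon
    exact hX ρ σ (by omega) σ2 ρ1 σ1
  obtain ⟨i, j, S, hv, hiρ, hρj⟩ := exists_vine hr hU (fun j j1 j2 => by
      refine h.conn (hm 0 (by omega)) (hm _ le_rfl) (fun e => ?_) (fun e => ?_)
      · have := hr.2 0 (by omega) j (by omega) e
        omega
      · have := hr.2 _ le_rfl j (by omega) e
        omega) (by
      have := idx_first h.hcol hr.1 σ2 σ1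
      omega) σ1 σ3 hσρ ρ3
  obtain ⟨Z, a, b, q1, q2, -, -, -, q6⟩ := hg.exists_cycle_of_vine h.hcol hr le_rfl hn hv hv.hj
    hiρ hρj ρ1 (fun t _ ha => by
      by_contra hcon
      exact ρ2 t (by omega) ha)
  have := h.nolong _ _ _ q1 q2
  omega

end Core

namespace Viol

variable {W X Y X' Y' : Finset V}

lemma union_disj (h : Viol G W X Y) (h' : Viol G W X' Y') {col : V → Bool}
    (hcol : ∀ u v, G.Adj u v → col u ≠ col v) (hY : ∀ y ∈ Y, col y = true)
    (hY' : ∀ y ∈ Y', col y = false) : Disjoint (X ∪ Y) (X' ∪ Y') := by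
  have h1 := h.inter_eq_empty h'
  have hX := h.col_left hcol hY
  have hX' := h'.col_left hcol hY'
  rw [Finset.disjoint_left]
  intro x hx hx'
  rcases Finset.mem_union.1 hx with h2 | h2 <;> rcases Finset.mem_union.1 hx' with h3 | h3
  · have h4 := hX x h2
    rw [hX' x h3] at h4
    simp at h4
  · have : x ∈ Y' ∩ X := Finset.mem_inter.2 ⟨h3, h2⟩
    rw [h1.2] at this
    simp at this
  · have : x ∈ Y ∩ X' := Finset.mem_inter.2 ⟨h2, h3⟩
    rw [h1.1] at this
    simp at this
  · have h4 := hY x h2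
    rw [hY' x h3] at h4
    simp at h4

end Viol

namespace Core

variable {col : V → Bool} {c m : ℕ} {z : ℕ → V} {W X₁ Y₁ X₂ Y₂ : Finset V}

/-- Violators on different sides are not connected outside the long cycle. -/
lemma not_conn_viol (h : Core G col c z W m) (v1 : Viol G W X₁ Y₁) (c1 : ∀ y ∈ Y₁, col y = true)
    (v2 : Viol G W X₂ Y₂) (c2 : ∀ y ∈ Y₂, col y = false) {h1 h2 : V} (hh1 : h1 ∈ X₁ ∪ Y₁)
    (hh2 : h2 ∈ X₂ ∪ Y₂) : ¬ Conn G (· ∈ W) h2 h1 := by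
  intro hconn
  have hd := v1.union_disj v2 h.hcol c1 c2
  rw [Finset.disjoint_left] at hd
  obtain ⟨I, i1, i2⟩ := hconn.pth (v2.union_sub hh2)
  obtain ⟨a, I', a1, a2, a3, a4⟩ := i1.last_in (· ∈ X₂ ∪ Y₂) hh2
  obtain ⟨b, E, b1, b2, b3, b4⟩ := a3.symm.last_in (· ∈ X₁ ∪ Y₁) hh1
  have hEW : E ⊆ W := fun x hx => (i2 x (a2 (b2 hx))).2
  have hab : a ≠ b := fun e => hd b1 (e ▸ a1)
  obtain ⟨e, e1, e2⟩ := b3.symm.strip hab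
  obtain ⟨w1, S1, p1, p2, p3, p4⟩ := v1.exists_leg (v1.disj h.hcol c1) b1
  obtain ⟨w2, S2, q1, q2, q3, q4⟩ := v2.exists_leg (v2.disj h.hcol c2) a1
  have hF := q1.symm.join e2 (fun x hx hx' => a4 x (b2 (Finset.mem_of_mem_erase hx')) (q3 hx))
  have hFd : ∀ x ∈ S2 ∪ E.erase b, x ∉ X₁ ∪ Y₁ := by
    intro x hx hx1
    rcases Finset.mem_union.1 hx with h3 | h3
    · exact hd hx1 (q3 h3)
    · exact Finset.ne_of_mem_erase h3 (b4 x (Finset.mem_of_mem_erase h3) hx1)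
  obtain ⟨f, n1, f1, f2, f3, f4⟩ := hF
  obtain ⟨g, n2, g1, g2, g3, g4⟩ := p1
  have hr := f1.cat g1 (by rw [f3, g2]; exact e1) (by
    rw [← f4, ← g4, Finset.disjoint_left]
    exact fun x hx hx' => hFd x hx (p3 hx'))
  have hs := seg_cat f g n1 n2
  have hr0 : cat f n1 g 0 = w2 := by rw [cat_left (Nat.zero_le _), f2]
  have hrn : cat f n1 g (n1 + 1 + n2) = w1 := by
    rw [cat_right (by omega), ← g3]
    congr 1
    omega
  rw [← f4, ← g4] at hs
  obtain ⟨t, ht, t1, t2⟩ := h.exists_gap hr (by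
      have := (IP.col_eq h.hcol hr.1 (Nat.zero_le _) le_rfl).2.mt (by
        rw [hr0, hrn, c1 w1 p2, c2 w2 q2]
        simp)
      omega) (by
      rw [hs]
      intro x hx
      rcases Finset.mem_union.1 hx with h3 | h3
      · rcases Finset.mem_union.1 h3 with h4 | h4
        · exact v2.union_sub (q3 h4)
        · exact hEW (Finset.mem_of_mem_erase h4)
      · exact v1.union_sub (p3 h3)) (by
      rw [hs, hr0]
      exact q4.trans (Finset.subset_union_left.trans Finset.subset_union_left)) (by
      rw [hs, hrn]
      exact p4.trans Finset.subset_union_right)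
  have hW : ∀ s ≤ n1 + 1 + n2, cat f n1 g s ∈ W := by
    intro s hs'
    have h3 : cat f n1 g s ∈ S2 ∪ E.erase b ∪ S1 := by
      rw [← hs]
      exact seg_mem (Nat.zero_le _) hs'
    rcases Finset.mem_union.1 h3 with h3 | h3
    · rcases Finset.mem_union.1 h3 with h4 | h4
      · exact v2.union_sub (q3 h4)
      · exact hEW (Finset.mem_of_mem_erase h4)
    · exact v1.union_sub (p3 h3)
  rw [hrn] at t1
  rw [hr0] at t2
  have k1 := p3 (p4 (mem_nb.2 ⟨hW t (by omega), t1⟩))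
  have k2 := q3 (q4 (mem_nb.2 ⟨hW (t + 1) (by omega), t2⟩))
  have htn : n1 < t := by
    by_contra hcon
    rw [cat_left (by omega)] at k1
    refine hFd _ ?_ k1
    rw [f4]
    exact seg_mem (Nat.zero_le _) (by omega)
  rw [cat_right (by omega)] at k2
  refine hd (p3 ?_) k2
  rw [g4]
  exact seg_mem (Nat.zero_le _) (by omega)

/-- The vertices reachable from `D` in `W`. -/
noncomputable def hull (G : SimpleGraph V) (W D : Finset V) : Finset V :=
  W.filter fun x => ∃ d ∈ D, Conn G (· ∈ W) d x

/-- Possible ends on the long cycle of paths leaving a violator. -/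
lemma exists_half (h : Core G col c z W m) {X Y : Finset V} {b : Bool} (v : Viol G W X Y)
    (hY : ∀ y ∈ Y, col y = b) :
    ∃ A ⊆ cyc c z, A.Nonempty ∧ (∀ y ∈ Y, nb G (cyc c z) y ⊆ A) ∧
      ((∀ q, ∃ p ∈ A, p ≠ q) ∨ ∀ p ∈ A, col p = !b) ∧
      ∀ p ∈ A, ∃ g w S, Pth G g w S ∧ S ⊆ hull G W (X ∪ Y) ∧ w ∈ Y ∧ G.Adj g p ∧ nb G W w ⊆ S := by
  have hsub : X ∪ Y ⊆ hull G W (X ∪ Y) := fun x hx =>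
    Finset.mem_filter.2 ⟨v.union_sub hx, x, hx, Relation.ReflTransGen.refl⟩
  by_cases hC : (Y.biUnion (nb G (cyc c z))).Nonempty
  · refine ⟨_, ?_, hC, fun y hy => Finset.subset_biUnion_of_mem _ hy, Or.inr ?_, ?_⟩
    · exact Finset.biUnion_subset.2 fun y _ x hx => (mem_nb.1 hx).1
    · intro p hp
      obtain ⟨y, hy, hp⟩ := Finset.mem_biUnion.1 hp
      have := h.hcol _ _ (mem_nb.1 hp).2
      rw [hY y hy] at this
      revert this
      cases b <;> cases col p <;> simp
    · intro p hp
      obtain ⟨y, hy, hp⟩ := Finset.mem_biUnion.1 hp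
      obtain ⟨w, S, p1, p2, p3, p4⟩ := v.exists_leg (v.disj h.hcol hY)
        (Finset.mem_union_right X hy)
      exact ⟨y, w, S, p1, p3.trans hsub, p2, (mem_nb.1 hp).2, p4⟩
  · have hb : ∀ q, ∃ p ∈ (hull G W (X ∪ Y)).biUnion (nb G (cyc c z)), p ≠ q := by
      intro q
      obtain ⟨y, hy⟩ := v.ne
      obtain ⟨p, p1, p2, x, p3, p4⟩ := h.exists_boundary (Finset.filter_subset _ _)
        ⟨y, hsub (Finset.mem_union_right X hy)⟩ q
      refine ⟨p, Finset.mem_biUnion.2 ⟨x, p3, mem_nb.2 ⟨?_, p4⟩⟩, p2⟩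
      rw [Finset.mem_sdiff] at p1
      rcases Finset.mem_union.1 p1.1 with h3 | h3
      · exact h3
      · obtain ⟨h4, d, h5, h6⟩ := Finset.mem_filter.1 p3
        exact absurd (Finset.mem_filter.2 ⟨h3, d, h5, h6.snoc p4 h3⟩) p1.2
    refine ⟨(hull G W (X ∪ Y)).biUnion (nb G (cyc c z)), ?_, ?_, ?_, Or.inl hb, ?_⟩
    · exact Finset.biUnion_subset.2 fun y _ x hx => (mem_nb.1 hx).1
    · obtain ⟨p, hp, _⟩ := hb (z 0)
      exact ⟨p, hp⟩
    · intro y hy x hx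
      exact absurd ⟨x, Finset.mem_biUnion.2 ⟨y, hy, hx⟩⟩ hC
    · intro p hp
      obtain ⟨g, hg, hp⟩ := Finset.mem_biUnion.1 hp
      obtain ⟨hgW, d, hd, hdg⟩ := Finset.mem_filter.1 hg
      obtain ⟨I, i1, i2⟩ := hdg.pth (v.union_sub hd)
      obtain ⟨a, I', a1, a2, a3, a4⟩ := i1.last_in (· ∈ X ∪ Y) hd
      obtain ⟨w, S, p1, p2, p3, p4⟩ := v.exists_leg (v.disj h.hcol hY) a1
      refine ⟨g, w, I' ∪ S, a3.symm.join p1 (fun x hx hx' => a4 x hx (p3 hx')), ?_, p2,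
        (mem_nb.1 hp).2, p4.trans Finset.subset_union_right⟩
      refine Finset.union_subset (fun x hx => ?_) (p3.trans hsub)
      have := i2 x (a2 hx)
      exact Finset.mem_filter.2 ⟨this.2, d, hd, this.1⟩

lemma disjoint_hull (h : Core G col c z W m) (v1 : Viol G W X₁ Y₁) (c1 : ∀ y ∈ Y₁, col y = true)
    (v2 : Viol G W X₂ Y₂) (c2 : ∀ y ∈ Y₂, col y = false) :
    Disjoint (hull G W (X₁ ∪ Y₁)) (hull G W (X₂ ∪ Y₂)) := by
  rw [Finset.disjoint_left]
  intro x hx hx'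
  obtain ⟨_, d, d1, d2⟩ := Finset.mem_filter.1 hx
  obtain ⟨_, e, e1, e2⟩ := Finset.mem_filter.1 hx'
  exact h.not_conn_viol v1 c1 v2 c2 d1 e1 (e2.trans (d2.symm (v1.union_sub d1)))

end Core

/-- Two sets of vertices of the long cycle contain distinct vertices at a minimal distance. -/
lemma Ctx.exists_min_dist {col : V → Bool} {c : ℕ} {z : ℕ → V} (h : Ctx G col c z)
    {A B : Finset V} (hA : A ⊆ cyc c z) (hB : B ⊆ cyc c z) (hne : ∃ p ∈ A, ∃ q ∈ B, p ≠ q) :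
    ∃ a d, 1 ≤ d ∧ d < 2 * c ∧ z a ∈ A ∧ z (a + d) ∈ B ∧
      ∀ a' d', 1 ≤ d' → d' < d → z a' ∈ A → z (a' + d') ∉ B := by
  have hex : ∃ d, ∃ a, 1 ≤ d ∧ d < 2 * c ∧ z a ∈ A ∧ z (a + d) ∈ B := by
    obtain ⟨p, hp, q, hq, hpq⟩ := hne
    obtain ⟨s, -, -, rfl⟩ := h.surj (hA hp) 0
    obtain ⟨t, t1, t2, rfl⟩ := h.surj (hB hq) s
    refine ⟨t - s, s, by omega, ?_, hp, by rwa [show s + (t - s) = t by omega]⟩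
    by_contra hcon
    refine hpq ?_
    rw [show t = s + 2 * c by omega, h.zper]
  obtain ⟨a, h1, h2, h3, h4⟩ := Nat.find_spec hex
  refine ⟨a, _, h1, h2, h3, h4, fun a' d' k1 k2 k3 k4 => ?_⟩
  exact Nat.find_min hex k2 ⟨a', k1, k2.trans h2, k3, k4⟩

/-- The whole cycle is covered by the neighbours on an arc. -/
lemma Ctx.mem_arc {col : V → Bool} {c : ℕ} {z : ℕ → V} (h : Ctx G col c z) {a d : ℕ} {x : V}
    (hx : x ∈ cyc c z) (hno : ∀ t, 1 ≤ t → t < d → x ≠ z (a + t)) :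
    x ∈ seg z (a + d) (a + 2 * c) := by
  obtain ⟨t, t1, t2, rfl⟩ := h.surj hx a
  refine seg_mem ?_ t2
  by_contra hcon
  refine hno (t - a) (by omega) (by omega) ?_
  congr 1
  omega

namespace Core

variable {col : V → Bool} {c m : ℕ} {z : ℕ → V} {W X₁ Y₁ X₂ Y₂ : Finset V}

lemma not_viol (h : Core G col c z W m) (v1 : Viol G W X₁ Y₁) (c1 : ∀ y ∈ Y₁, col y = true)
    (v2 : Viol G W X₂ Y₂) (c2 : ∀ y ∈ Y₂, col y = false) : False := by
  obtain ⟨A, a1, ⟨a₀, a2⟩, a3, a4, a5⟩ := h.exists_half v1 c1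
  obtain ⟨B, b1, ⟨b₀, b2⟩, b3, b4, b5⟩ := h.exists_half v2 c2
  have hH := h.disjoint_hull v1 c1 v2 c2
  have hc := h.hc
  have hHW : ∀ D, hull G W D ⊆ W := fun D => Finset.filter_subset _ _
  obtain ⟨a, d, d1, d2, ha, hb, hmin⟩ := h.exists_min_dist a1 b1 (by
    rcases a4 with a4 | a4
    · obtain ⟨p, p1, p2⟩ := a4 b₀
      exact ⟨p, p1, b₀, b2, p2⟩
    · rcases b4 with b4 | b4
      · obtain ⟨q, q1, q2⟩ := b4 a₀
        exact ⟨a₀, a2, q, q1, q2.symm⟩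
      · refine ⟨a₀, a2, b₀, b2, fun e => ?_⟩
        have h1 := a4 _ a2
        rw [e, b4 _ b2] at h1
        simp at h1)
  obtain ⟨g1, w, S1, p1, p2, p3, p4, p5⟩ := a5 _ ha
  obtain ⟨g2, u, S2, q1, q2, q3, q4, q5⟩ := b5 _ hb
  rw [Finset.disjoint_left] at hH
  have hS12 : ∀ x ∈ S1, x ∉ S2 := fun x h1 h2 => hH (p2 h1) (q2 h2)
  have hCW : ∀ x ∈ W, x ∉ cyc c z := fun x hx => Finset.disjoint_left.1 h.hW hx
  have hS1 : ∀ x ∈ S1, x ∉ cyc c z := fun x hx => hCW x (hHW _ (p2 hx))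
  have hS2 : ∀ x ∈ S2, x ∉ cyc c z := fun x hx => hCW x (hHW _ (q2 hx))
  obtain ⟨f, n2, f1, f2, f3, f4⟩ := q1.symm
  obtain ⟨g, n1, e1, e2, e3, e4⟩ := p1
  have hz := h.ip (a + d) (n := 2 * c - d) (by omega)
  have hzs : seg (fun t => z (a + d + t)) 0 (2 * c - d) = seg z (a + d) (a + 2 * c) := by
    ext x
    rw [mem_seg, mem_seg]
    constructor
    · rintro ⟨t, _, t2, t3⟩
      exact ⟨a + d + t, by omega, by omega, t3⟩
    · rintro ⟨t, t1, t2, t3⟩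
      exact ⟨t - (a + d), by omega, by omega, by rw [← t3]; congr 1; omega⟩
  have hsub : seg z (a + d) (a + 2 * c) ⊆ cyc c z := by
    intro x hx
    obtain ⟨t, _, _, rfl⟩ := mem_seg.1 hx
    exact h.zmem t
  have hr1 := f1.cat hz (by rw [f3]; simpa using q4) (by
    rw [← f4, hzs, Finset.disjoint_left]
    exact fun x hx hx' => hS2 x hx (hsub hx'))
  have hs1 := seg_cat f (fun t => z (a + d + t)) n2 (2 * c - d)
  set f' := cat f n2 (fun t => z (a + d + t)) with hf'
  have hf'0 : f' 0 = u := by rw [hf', cat_left (Nat.zero_le _), f2]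
  have hf'z : ∀ s, f' (n2 + 1 + s) = z (a + d + s) := by
    intro s
    rw [hf', cat_right (by omega)]
    congr 1
    omega
  rw [← f4, hzs] at hs1
  have hr := hr1.cat e1 (by
    rw [hf'z, e2, show a + d + (2 * c - d) = a + 2 * c by omega, h.zper]
    exact p4.symm) (by
    rw [← e4, hs1, Finset.disjoint_left]
    intro x hx hx'
    rcases Finset.mem_union.1 hx with h3 | h3
    · exact hS12 x hx' h3
    · exact hS1 x hx' (hsub h3))
  have hs := seg_cat f' g (n2 + 1 + (2 * c - d)) n1
  rw [← e4, hs1] at hs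
  set n := n2 + 1 + (2 * c - d) + 1 + n1 with hn
  set r := cat f' (n2 + 1 + (2 * c - d)) g with hrdef
  have hr0 : r 0 = u := by rw [hrdef, cat_left (Nat.zero_le _), hf'0]
  have hrn : r n = w := by
    rw [hrdef, cat_right (by omega), ← e3]
    congr 1
    omega
  have huW : u ∈ W := v2.sub q3
  have hwW : w ∈ W := v1.sub p3
  have huw : col u ≠ col w := by rw [c1 w p3, c2 u q3]; simp
  have hodd : n % 2 = 1 := by
    have := (IP.col_eq h.hcol hr.1 (Nat.zero_le _) le_rfl).2.mt (by rwa [hr0, hrn])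
    omega
  have hU : seg r 0 n ⊆ cyc c z ∪ W := by
    rw [hs]
    refine Finset.union_subset (Finset.union_subset ?_ ?_) ?_
    · exact (q2.trans (hHW _)).trans Finset.subset_union_right
    · exact hsub.trans Finset.subset_union_left
    · exact (p2.trans (hHW _)).trans Finset.subset_union_right
  have hNu : nb G (cyc c z ∪ W) u ⊆ seg z (a + d) (a + 2 * c) ∪ S2 := by
    intro x hx
    rw [mem_nb] at hx
    rcases Finset.mem_union.1 hx.1 with h3 | h3
    · refine Finset.mem_union_left _ (h.mem_arc h3 fun t t1 t2 e => ?_)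
      have h4 := b3 u q3 (mem_nb.2 ⟨h3, hx.2⟩)
      rw [e] at h4
      exact hmin a t t1 t2 ha h4
    · exact Finset.mem_union_right _ (q5 (mem_nb.2 ⟨h3, hx.2⟩))
  have hNw : nb G (cyc c z ∪ W) w ⊆ seg z (a + d) (a + 2 * c) ∪ S1 := by
    intro x hx
    rw [mem_nb] at hx
    rcases Finset.mem_union.1 hx.1 with h3 | h3
    · refine Finset.mem_union_left _ (h.mem_arc h3 fun t t1 t2 e => ?_)
      have h4 := a3 w p3 (mem_nb.2 ⟨h3, hx.2⟩)
      rw [e] at h4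
      refine hmin (a + t) (d - t) (by omega) (by omega) h4 ?_
      rwa [show a + t + (d - t) = a + d by omega]
    · exact Finset.mem_union_right _ (p5 (mem_nb.2 ⟨h3, hx.2⟩))
  have hgap : ∃ t < n, G.Adj w (r t) ∧ G.Adj u (r (t + 1)) := by
    by_contra hcon
    push Not at hcon
    refine h.not_noGap hr hodd hU ?_ ?_ ?_ (by rwa [NoGap, hr0, hrn])
    · rw [hr0, hs]
      refine hNu.trans fun x hx => ?_
      simp only [Finset.mem_union] at hx ⊢
      tauto
    · rw [hrn, hs]
      refine hNw.trans fun x hx => ?_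
      simp only [Finset.mem_union] at hx ⊢
      tauto
    · rw [hr0, hrn]
      exact h.two_le_card_nb_add huW hwW huw
  obtain ⟨t, ht, t1, t2⟩ := hgap
  have hrU : ∀ s ≤ n, r s ∈ cyc c z ∪ W := fun s hs => hU (seg_mem (Nat.zero_le _) hs)
  have k1 := hNw (mem_nb.2 ⟨hrU t (by omega), t1⟩)
  have k2 := hNu (mem_nb.2 ⟨hrU (t + 1) (by omega), t2⟩)
  have hlt : n2 < t := by
    by_contra hcon
    have h3 : r t ∈ S2 := by
      rw [hrdef, cat_left (by omega), hf', cat_left (by omega), f4]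
      exact seg_mem (Nat.zero_le _) (by omega)
    rcases Finset.mem_union.1 k1 with h4 | h4
    · exact hS2 _ h3 (hsub h4)
    · exact hS12 _ h4 h3
  have hgt : t + 1 ≤ n2 + 1 + (2 * c - d) := by
    by_contra hcon
    have h3 : r (t + 1) ∈ S1 := by
      rw [hrdef, cat_right (by omega), e4]
      exact seg_mem (Nat.zero_le _) (by omega)
    rcases Finset.mem_union.1 k2 with h4 | h4
    · exact hS1 _ h3 (hsub h4)
    · exact hS12 _ h3 h4
  obtain ⟨s, rfl⟩ : ∃ s, t = n2 + 1 + s := ⟨t - (n2 + 1), by omega⟩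
  have z1 : r (n2 + 1 + s) = z (a + d + s) := by rw [hrdef, cat_left (by omega), hf'z]
  have z2 : r (n2 + 1 + s + 1) = z (a + d + s + 1) := by
    rw [hrdef, cat_left hgt]
    exact hf'z (s + 1)
  have t1' := t1
  have t2' := t2
  rw [z1] at t1
  rw [z2] at t2
  have m1 := a3 w p3 (mem_nb.2 ⟨h.zmem _, t1⟩)
  have m2 := b3 u q3 (mem_nb.2 ⟨h.zmem _, t2⟩)
  have hd1 : d = 1 := by
    by_contra hne
    exact hmin _ 1 le_rfl (by omega) m1 m2
  have hfin := h.nolong _ _ _ (hr.pth_of_gap ht (by rw [hrn]; exact t1')) (by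
    rw [hr0]; exact t2')
  rw [hr.card_seg le_rfl] at hfin
  omega

lemma false_of_nonempty (h : Core G col c z W m) (hne : W.Nonempty) : False := by
  by_cases hpm : PM G W
  · exact h.not_pm hne hpm
  · obtain ⟨X₁, Y₁, X₂, Y₂, v1, c1, v2, c2⟩ := h.exists_viol hpm
    exact h.not_viol v1 c1 v2 c2

end Core

/-- The bound for the number of edges contributed by `x` and `y` vertices of the two colours
outside a longest cycle on `2c` vertices. -/
def ext (c x y : ℕ) : ℕ := c * max x y + min x y + (c - 1) * (min x y - c)

lemma ext_comm (c x y : ℕ) : ext c x y = ext c y x := by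
  simp only [ext, max_comm, min_comm]

lemma ext_of_lt {c x y : ℕ} (h : x < y) : ext c x (y - 1) + c = ext c x y := by
  obtain ⟨d, rfl⟩ : ∃ d, y = d + 1 := ⟨y - 1, by omega⟩
  simp only [ext, Nat.add_sub_cancel, max_eq_right h.le, max_eq_right (Nat.lt_succ_iff.1 h),
    min_eq_left h.le, min_eq_left (Nat.lt_succ_iff.1 h)]
  ring

lemma ext_of_eq {c m : ℕ} (hc : 1 ≤ c) (h : c < m) : ext c (m - 1) m + c = ext c m m := by
  obtain ⟨d, rfl⟩ : ∃ d, m = c + d + 1 := ⟨m - c - 1, by omega⟩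
  obtain ⟨e, rfl⟩ : ∃ e, c = e + 1 := ⟨c - 1, by omega⟩
  simp only [ext, Nat.add_sub_cancel, max_self, min_self, max_eq_right (Nat.le_add_right (e + 1 + d) 1),
    min_eq_left (Nat.le_add_right (e + 1 + d) 1)]
  rw [show e + 1 + d - (e + 1) = d by omega, show e + 1 + d + 1 - (e + 1) = d + 1 by omega]
  ring

lemma ext_of_le {c m i j : ℕ} (hm : m ≤ c) (hi : i ≤ m) (hj : j ≤ m) :
    ext c (m - i) (m - j) + (c * min i j + max i j) = ext c m m := by
  wlog hij : i ≤ j generalizing i j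
  · rw [ext_comm, min_comm, max_comm]
    exact this hj hi (by omega)
  simp only [ext, max_self, min_self, min_eq_left hij, max_eq_right hij]
  rw [max_eq_left (by omega : m - j ≤ m - i), min_eq_right (by omega : m - j ≤ m - i), show m - j - c = 0 by omega,
    Nat.sub_eq_zero_of_le hm]
  obtain ⟨e, rfl⟩ : ∃ e, m = i + e := ⟨m - i, by omega⟩
  rw [Nat.add_sub_cancel_left, Nat.mul_add]
  omega

lemma cnt_singleton (col : V → Bool) (b : Bool) (v : V) :
    cnt col b {v} = if col v = b then 1 else 0 := by
  unfold cnt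
  rw [Finset.filter_singleton]
  split_ifs <;> simp

namespace Ctx

variable {col : V → Bool} {c : ℕ} {z : ℕ → V} {W : Finset V}

/-- A graph in which all vertices outside the cycle have degree larger than `c` has no path
with all the neighbours of its ends on itself. -/
lemma not_saturated_pth (h : Ctx G col c z) (hW : Disjoint W (cyc c z)) {u w : V} {S : Finset V}
    (hp : Pth G u w S) (hS : S ⊆ W) (hu : nb G W u ⊆ S) (hw : nb G W w ⊆ S)
    (du : c + 1 ≤ (nb G (cyc c z ∪ W) u).card) (dw : c + 1 ≤ (nb G (cyc c z ∪ W) w).card) :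
    False := by
  obtain ⟨r, n, hr, rfl, rfl, rfl⟩ := hp
  exact h.not_saturated hr hW hS hu hw du dw

lemma false_of_large (h : Ctx G col c z) (hW : Disjoint W (cyc c z)) (hne : W.Nonempty)
    (hd : ∀ v ∈ W, c + 1 ≤ (nb G (cyc c z ∪ W) v).card) : False := by
  obtain ⟨x, hx⟩ := hne
  have hk0 : ∃ S u w, Pth G u w S ∧ S ⊆ W ∧ S.card = 1 :=
    ⟨{x}, x, x, Pth.single x, by simpa using hx, by simp⟩
  obtain ⟨S, u, w, hp, hS, hcard⟩ := Nat.findGreatest_spec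
    (P := fun k => ∃ S u w, Pth G u w S ∧ S ⊆ W ∧ S.card = k) (n := W.card)
    (Finset.card_pos.2 ⟨x, hx⟩) hk0
  have hext : ∀ u w, Pth G u w S → nb G W w ⊆ S := by
    intro u w hp y hy
    by_contra hyS
    rw [mem_nb] at hy
    have h1 := hp.snoc hy.2 hyS
    have h2 : insert y S ⊆ W := Finset.insert_subset hy.1 hS
    have h3 := Nat.le_findGreatest
      (P := fun k => ∃ S u w, Pth G u w S ∧ S ⊆ W ∧ S.card = k) (Finset.card_le_card h2)
      ⟨_, u, y, h1, h2, rfl⟩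
    rw [← hcard, Finset.card_insert_of_notMem hyS] at h3
    omega
  exact h.not_saturated_pth hW hp hS (hext w u hp.symm) (hext u w hp) (hd _ (hS hp.left_mem))
    (hd _ (hS hp.right_mem))

lemma false_of_unbalanced (h : Ctx G col c z) (hW : Disjoint W (cyc c z)) {b : Bool}
    (hb : cnt col (!b) W < cnt col b W)
    (hd : ∀ v ∈ W, col v = b → c + 1 ≤ (nb G (cyc c z ∪ W) v).card) : False := by
  have h1 : ((W.filter (fun v => col v = b)).biUnion (nb G W)).card <
      (W.filter (fun v => col v = b)).card := by
    refine lt_of_le_of_lt (Finset.card_le_card fun x hx => ?_) hb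
    obtain ⟨y, hy, hx⟩ := Finset.mem_biUnion.1 hx
    have h2 := (Finset.mem_filter.1 hy).2
    rw [mem_nb] at hx
    have h3 := h.hcol _ _ hx.2
    rw [h2] at h3
    refine Finset.mem_filter.2 ⟨hx.1, ?_⟩
    revert h3
    cases b <;> cases col x <;> simp
  obtain ⟨Y, y1, ⟨y, hy⟩, -, y4⟩ := exists_violator h1
  have hv : Viol G W (Y.biUnion (nb G W)) Y :=
    ⟨y1.trans (Finset.filter_subset _ _), ⟨y, hy⟩, rfl, y4⟩
  have hYb : ∀ y ∈ Y, col y = b := fun y hy => (Finset.mem_filter.1 (y1 hy)).2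
  have hdis := hv.disj h.hcol hYb
  have hMt : Mt G (Y.biUnion (nb G W)) Y {y} := by
    obtain ⟨f, f1, f2⟩ := y4 y hy
    refine ⟨f, f1.mono (by simp), fun x hx => ?_⟩
    have h3 := f2 x (Finset.mem_sdiff.1 hx).1
    rw [Finset.mem_erase] at h3
    exact ⟨Finset.mem_sdiff.2 ⟨h3.1.2, by simpa using h3.1.1⟩, h3.2⟩
  obtain ⟨w, S, -, s2, s3, s4, s5, s6⟩ :=
    Mt.saturate hdis (fun y hy => hv.nb_sub hy) _ le_rfl (Pth.single y) hy hMt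
  obtain ⟨u, T, t1, t2, t3, -, t5, t6⟩ :=
    Mt.saturate hdis (fun y hy => hv.nb_sub hy) _ le_rfl s2.symm hy s4
  have hTW : T ⊆ W := by
    refine t6.trans (Finset.union_subset (s6.trans (Finset.union_subset ?_ hv.union_sub))
      hv.union_sub)
    simpa using hv.sub hy
  exact h.not_saturated_pth hW t2 hTW (s5.trans t1) t5 (hd _ (hv.sub s3) (hYb _ s3))
    (hd _ (hv.sub t3) (hYb _ t3))

theorem degSum_le_add (h : Ctx G col c z) (W : Finset V) : Disjoint W (cyc c z) →
    degSum G (cyc c z ∪ W) ≤ degSum G (cyc c z) + 2 * ext c (cnt col true W) (cnt col false W) := by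
  induction W using Finset.strongInduction with
  | H W ih =>
    intro hW
    rcases W.eq_empty_or_nonempty with rfl | hne
    · simp
    by_contra hlt
    push Not at hlt
    have hdrop : ∀ D ⊆ W, D.Nonempty → 2 * ext c (cnt col true W) (cnt col false W) <
        2 * ext c (cnt col true W - cnt col true D) (cnt col false W - cnt col false D) +
        (2 * ∑ v ∈ D, (nb G ((cyc c z ∪ W) \ D) v).card + degSum G D) := by
      intro D hD hDne
      have h1 := ih (W \ D) (Finset.sdiff_ssubset hD hDne) (hW.mono_left Finset.sdiff_subset)
      rw [cnt_sdiff hD, cnt_sdiff hD] at h1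
      have h2 := degSum_sdiff (G := G) (hD.trans (Finset.subset_union_right (s₁ := cyc c z)))
      have h3 : (cyc c z ∪ W) \ D = cyc c z ∪ W \ D := by
        rw [Finset.union_sdiff_distrib, Finset.sdiff_eq_self_of_disjoint (hW.mono_left hD).symm]
      rw [h3] at h2 ⊢
      omega
    have hdeg : ∀ v ∈ W, 2 * ext c (cnt col true W) (cnt col false W) <
        2 * ext c (cnt col true W - if col v = true then 1 else 0)
          (cnt col false W - if col v = false then 1 else 0) +
        2 * (nb G (cyc c z ∪ W) v).card := by
      intro v hv
      have h1 := hdrop {v} (by simpa using hv) ⟨v, by simp⟩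
      rw [cnt_singleton, cnt_singleton, Finset.sum_singleton] at h1
      have h2 : degSum G {v} = 0 := by simp [degSum, nb]
      have h3 := Finset.card_le_card (nb_mono (G := G) (Finset.sdiff_subset (s := cyc c z ∪ W)
        (t := {v})) v)
      omega
    rcases lt_trichotomy (cnt col true W) (cnt col false W) with hlt | heq | hlt
    · refine h.false_of_unbalanced hW (b := false) hlt fun v hv hc => ?_
      have h1 := hdeg v hv
      rw [if_neg (by simp [hc]), if_pos hc, ← ext_of_lt hlt, Nat.sub_zero] at h1
      omega
    · rcases le_or_gt (cnt col true W) c with hm | hm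
      · refine Core.false_of_nonempty (m := cnt col true W)
          ⟨h, hW, fun b => ?_, hm, fun D hD hDne => ?_⟩ hne
        · cases b
          · exact heq.symm
          · rfl
        · have h1 := hdrop D hD hDne
          have h2 : ∀ b, cnt col b D ≤ cnt col b W := fun b =>
            Finset.card_le_card (Finset.filter_subset_filter _ hD)
          have h3 := h2 false
          rw [← heq] at h1 h3
          rw [← ext_of_le hm (h2 true) h3] at h1
          omega
      · refine h.false_of_large hW hne fun v hv => ?_
        have h1 := hdeg v hv
        have hc := h.hc
        rw [← heq] at h1
        have h2 := ext_of_eq (by omega) hm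
        rcases hcv : col v with - | -
        · rw [hcv, if_neg (by simp), if_pos rfl, Nat.sub_zero, ext_comm c _ (_ - 1)] at h1
          omega
        · rw [hcv, if_pos rfl, if_neg (by simp), Nat.sub_zero] at h1
          omega
    · refine h.false_of_unbalanced hW (b := true) hlt fun v hv hc => ?_
      have h1 := hdeg v hv
      rw [if_pos hc, if_neg (by simp [hc]), ext_comm, ext_comm c (_ - 1), ← ext_of_lt hlt,
        Nat.sub_zero] at h1
      omega

end Ctx

lemma IP.exists_walk {r : ℕ → V} : ∀ {n : ℕ}, IP G r n →
    ∃ q : G.Walk (r 0) (r n), q.IsPath ∧ q.length = n ∧ ∀ x ∈ q.support, x ∈ seg r 0 n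
  | 0, _ => ⟨.nil, by simp, rfl, fun x hx => by
      rw [SimpleGraph.Walk.support_nil, List.mem_singleton] at hx
      exact hx ▸ seg_mem le_rfl le_rfl⟩
  | n + 1, h => by
    obtain ⟨q, q1, q2, q3⟩ := IP.exists_walk (n := n)
      ⟨fun i hi => h.1 i (by omega), fun i hi j hj => h.2 i (by omega) j (by omega)⟩
    refine ⟨q.concat (h.1 n (by omega)), q1.concat (fun hm => ?_) _, by simp [q2], fun x hx => ?_⟩
    · have := (h.mem_seg_iff (by omega) le_rfl).1 (q3 _ hm)
      omega
    · rw [SimpleGraph.Walk.support_concat, List.mem_append,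
        List.mem_singleton] at hx
      rcases hx with hx | rfl
      · obtain ⟨t, t1, t2, rfl⟩ := mem_seg.1 (q3 x hx)
        exact seg_mem t1 (by omega)
      · exact seg_mem (by omega) le_rfl

lemma Pth.hasCycleLength {u v : V} {S : Finset V} (h : Pth G u v S) (huv : G.Adj u v)
    (hS : 3 ≤ S.card) : hasCycleLength G S.card := by
  obtain ⟨r, n, hr, rfl, rfl, rfl⟩ := h
  obtain ⟨q, q1, q2, -⟩ := hr.exists_walk
  rw [hr.card_seg le_rfl] at hS ⊢
  refine ⟨_, .cons huv.symm q, (SimpleGraph.Walk.cons_isCycle_iff _ _).2 ⟨q1, fun hm => ?_⟩, ?_⟩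
  · rw [Sym2.eq_swap] at hm
    have := q1.length_eq_one_of_mem_edges hm
    omega
  · rw [SimpleGraph.Walk.length_cons, q2]
    omega

/-- A longest cycle of a properly 2-coloured graph. -/
lemma Ctx.of_walk {col : V → Bool} (hcol : ∀ u v, G.Adj u v → col u ≠ col v) {v : V} {c : ℕ}
    (p : G.Walk v v) (hp : p.IsCycle) (hlen : p.length = 2 * c)
    (hmax : ∀ l, _root_.hasCycleLength G l → l ≤ 2 * c) :
    Ctx G col c fun i => p.getVert (i % (2 * c)) := by
  have h3 := hp.three_le_length
  rw [hlen] at h3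
  have hend : p.getVert (2 * c) = p.getVert 0 := by
    rw [← hlen, p.getVert_length, p.getVert_zero]
  refine ⟨hcol, by omega, fun i => ?_, fun i => ?_, fun i j hij hj e => ?_, fun u w S h1 h2 => ?_⟩
  · have hlt := Nat.mod_lt i (by omega : 0 < 2 * c)
    have h4 := p.adj_getVert_succ (i := i % (2 * c)) (by omega)
    have h5 : p.getVert ((i + 1) % (2 * c)) = p.getVert (i % (2 * c) + 1) := by
      rw [Nat.add_mod, Nat.mod_eq_of_lt (by omega : 1 < 2 * c)]
      rcases Nat.lt_or_ge (i % (2 * c) + 1) (2 * c) with h6 | h6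
      · rw [Nat.mod_eq_of_lt h6]
      · rw [show i % (2 * c) + 1 = 2 * c by omega, Nat.mod_self, hend]
    simp only [h5]
    exact h4
  · simp
  · have hi := Nat.mod_lt i (by omega : 0 < 2 * c)
    have hj' := Nat.mod_lt j (by omega : 0 < 2 * c)
    have h4 := hp.getVert_injOn' (by simp; omega) (by simp; omega) e
    have h5 : (j - i) % (2 * c) = 0 := Nat.sub_mod_eq_zero_of_mod_eq h4.symm
    rw [Nat.mod_eq_of_lt (by omega)] at h5
    omega
  · by_contra hcon
    have := hmax _ (h1.hasCycleLength h2 (by omega))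
    omega

namespace Ctx

variable {col : V → Bool} {c : ℕ} {z : ℕ → V}

lemma cnt_cyc (h : Ctx G col c z) (b : Bool) : cnt col b (cyc c z) = c := by
  have hc := h.hc
  have h1 := (h.ip 0 (n := 2 * c - 1) (by omega)).cnt_seg h.hcol (k := c) (by omega) b
  simpa [cyc] using h1

lemma card_nb_cyc_le (h : Ctx G col c z) (v : V) : (nb G (cyc c z) v).card ≤ c :=
  (card_nb_le_cnt h.hcol _ v).trans (h.cnt_cyc _).le

lemma degSum_cyc_le (h : Ctx G col c z) : degSum G (cyc c z) ≤ 2 * (c * c) := by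
  have := degSum_le h.hcol (cyc c z)
  rwa [h.cnt_cyc, h.cnt_cyc] at this

lemma degSum_cyc_lt (h : Ctx G col c z) {a b : V} (ha : a ∈ cyc c z) (hb : b ∈ cyc c z)
    (hab : col a ≠ col b) (hn : ¬ G.Adj a b) : degSum G (cyc c z) < 2 * (c * c) := by
  have h1 : degSum G (cyc c z) < ∑ _v ∈ cyc c z, c := by
    refine Finset.sum_lt_sum (fun v _ => h.card_nb_cyc_le v) ⟨a, ha, ?_⟩
    refine lt_of_lt_of_eq (Finset.card_lt_card
      ((Finset.ssubset_iff_of_subset fun x hx => ?_).2 ⟨b, ?_, ?_⟩)) (h.cnt_cyc (!col a))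
    · rw [mem_nb] at hx
      have := h.hcol _ _ hx.2
      refine Finset.mem_filter.2 ⟨hx.1, ?_⟩
      revert this
      cases col a <;> cases col x <;> simp
    · refine Finset.mem_filter.2 ⟨hb, ?_⟩
      revert hab
      cases col a <;> cases col b <;> simp
    · exact fun hx => hn (mem_nb.1 hx).2
  rw [Finset.sum_const, h.card_cyc, smul_eq_mul, mul_assoc] at h1
  exact h1

end Ctx

lemma degSum_univ [Fintype V] : degSum G Finset.univ = 2 * G.edgeSet.ncard := by
  rw [Set.ncard_eq_toFinset_card', ← SimpleGraph.edgeFinset, ← G.sum_degrees_eq_twice_card_edges]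
  refine Finset.sum_congr rfl fun v _ => ?_
  rw [← SimpleGraph.card_neighborFinset_eq_degree]
  congr 1
  ext x
  simp [mem_nb]

end LongCycle

open LongCycle in
/-- Let `G` be bipartite with parts of equal size `M`, let `C` (given by the closed
walk `p`) be a longest cycle of `G` with `2c` vertices, and suppose `G` has no
`C_{2n}`. If `c ≤ n - 1 ≤ M/2`, then `e(G) ≤ (n-1)(2M - 2n + 3)`, and in case of
equality the induced subgraph on `V(C)` is a complete bipartite `K_{c,c}`. -/
theorem edge_bound_short_cycle (M n c : ℕ)
    (G : SimpleGraph (Fin M ⊕ Fin M))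
    (hG : G ≤ completeBipartiteGraph (Fin M) (Fin M))
    (v : Fin M ⊕ Fin M) (p : G.Walk v v) (hp : p.IsCycle) (hplen : p.length = 2 * c)
    (hmax : ∀ l : ℕ, hasCycleLength G l → l ≤ 2 * c)
    (hno : ¬ hasCycleLength G (2 * n))
    (hcn : c ≤ n - 1) (hnM : 2 * (n - 1) ≤ M) :
    G.edgeSet.ncard ≤ (n - 1) * (2 * M - 2 * n + 3) ∧
    (G.edgeSet.ncard = (n - 1) * (2 * M - 2 * n + 3) →
      ∀ (a b : Fin M), Sum.inl a ∈ p.support → Sum.inr b ∈ p.support →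
        G.Adj (Sum.inl a) (Sum.inr b)) := by
  have hcol : ∀ u v, G.Adj u v → Sum.isLeft u ≠ Sum.isLeft v := by
    intro u v huv
    have := hG huv
    rcases u with u | u <;> rcases v with v | v <;> simp at this ⊢
  have h := Ctx.of_walk hcol p hp hplen hmax
  have hc := h.hc
  set C := cyc c fun i => p.getVert (i % (2 * c)) with hC
  have hcnt : ∀ b, cnt Sum.isLeft b (Finset.univ \ C) = M - c := by
    intro b
    rw [cnt_sdiff (Finset.subset_univ _), hC, h.cnt_cyc]
    congr 1
    have h1 : cnt Sum.isLeft b (Finset.univ : Finset (Fin M ⊕ Fin M)) =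
        Fintype.card (Fin M) := by
      have hl : ∀ f : Fin M ↪ Fin M ⊕ Fin M, (∀ x, Sum.isLeft x = b ↔ ∃ y, f y = x) →
          cnt Sum.isLeft b Finset.univ = Fintype.card (Fin M) := fun f hf => by
        rw [← Finset.card_univ, ← Finset.card_map f, cnt]
        congr 1
        ext x
        simp [hf]
      cases b
      · exact hl .inr fun x => by rcases x with x | x <;> simp
      · exact hl .inl fun x => by rcases x with x | x <;> simp
    rw [h1, Fintype.card_fin]
  have hsum := h.degSum_le_add (Finset.univ \ C) Finset.sdiff_disjoint
  rw [← hC, Finset.union_sdiff_of_subset (Finset.subset_univ _), degSum_univ, hcnt, hcnt] at hsum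
  have hmain : c * c + ext c (M - c) (M - c) ≤ (n - 1) * (2 * M - 2 * n + 3) := by
    obtain ⟨t, ht⟩ : ∃ t, n - 1 = c + t := ⟨n - 1 - c, by omega⟩
    obtain ⟨s, hs⟩ : ∃ s, M = 2 * (c + t) + s := ⟨M - 2 * (c + t), by omega⟩
    obtain ⟨e, rfl⟩ : ∃ e, c = e + 1 := ⟨c - 1, by omega⟩
    rw [ext, max_self, min_self, ht, show 2 * M - 2 * n + 3 = 2 * (e + 1) + 2 * t + 2 * s + 1 by omega,
      show M - (e + 1) = e + 1 + 2 * t + s by omega,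
      show e + 1 + 2 * t + s - (e + 1) = 2 * t + s by omega, Nat.add_sub_cancel]
    nlinarith [Nat.zero_le (t * t), Nat.zero_le (t * s), Nat.zero_le t]
  refine ⟨?_, fun heq a b ha hb => ?_⟩
  · have := h.degSum_cyc_le
    rw [← hC] at this
    omega
  · by_contra hn
    have hmem : ∀ x ∈ p.support, x ∈ C := by
      intro x hx
      obtain ⟨i, rfl, hi⟩ := SimpleGraph.Walk.mem_support_iff_exists_getVert.1 hx
      rcases hi.eq_or_lt with h1 | h1
      · have := h.zmem 0
        simp only [Nat.zero_mod, p.getVert_zero] at this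
        rw [h1, p.getVert_length]
        exact this
      · have := h.zmem i
        simp only [Nat.mod_eq_of_lt (hplen ▸ h1)] at this
        exact this
    have := h.degSum_cyc_lt (hmem _ ha) (hmem _ hb) (by simp) hn
    rw [← hC] at this
    omega
end

section
/- (Jackson) Let G be a bipartite graph with parts X, Y where |X| ≥ |Y|. If every vertex y ∈ Y satisfies deg(y) ≥ max{|Y|, |X|/2 + 1}, then G has a cycle containing all vertices of Y. -/
/-- A cyclic sequence of at least three distinct vertices, consecutive ones adjacent, is traversed
by a cycle of the graph. -/
theorem Cycle.Chain.exists_isCycle {V : Type*} {G : SimpleGraph V} {s : Cycle V}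
    (hc : s.Chain G.Adj) (hn : s.Nodup) (hl : 3 ≤ s.length) :
    ∃ (v : V) (p : G.Walk v v), p.IsCycle ∧ ∀ u ∈ s, u ∈ p.support := by
  induction s using Quotient.inductionOn with | _ l
  change Cycle.Chain G.Adj (l : Cycle V) at hc
  change l.Nodup at hn
  change 3 ≤ l.length at hl
  rcases l with _ | ⟨v, l⟩
  · simp at hl
  replace hc : List.IsChain G.Adj (v :: (l ++ [v])) := hc
  obtain ⟨p, hp⟩ : ∃ p : G.Walk v v, p.support = v :: (l ++ [v]) := by
    have hlast : (v :: (l ++ [v])).getLast (List.cons_ne_nil _ _) = v := by simp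
    exact ⟨(SimpleGraph.Walk.ofSupport _ (List.cons_ne_nil _ _) hc).copy List.head_cons hlast,
      (SimpleGraph.Walk.support_copy _ _ _).trans (SimpleGraph.Walk.support_ofSupport _ hc)⟩
  have hlen : 3 ≤ p.length := by
    have := p.length_support
    simp [hp] at this hl
    omega
  have hnil : ¬ p.Nil := by
    rw [← SimpleGraph.Walk.length_eq_zero_iff]
    omega
  refine ⟨v, p, ?_, fun u hu ↦ ?_⟩
  · refine SimpleGraph.Walk.isCycle_iff_isPath_tail_and_le_length.mpr ⟨?_, hlen⟩
    rw [SimpleGraph.Walk.isPath_def, SimpleGraph.Walk.support_tail_of_not_nil _ hnil, hp]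
    grind
  · have : u ∈ v :: l := hu
    grind

/-- The cyclic sequence `s` of vertices is closed under adjacency in `G` and meets the right part
exactly in `T`, with as many left vertices as right ones; a single edge traversed back and forth
is allowed. -/
structure SpansRight {X Y : Type*} (G : SimpleGraph (X ⊕ Y)) (T : Finset Y) (s : Cycle (X ⊕ Y)) :
    Prop where
  chain : s.Chain G.Adj
  nodup : s.Nodup
  mem_inr : ∀ y, Sum.inr y ∈ s ↔ y ∈ T
  length_eq : s.length = 2 * T.card

namespace SpansRight

variable {X Y : Type*} {G : SimpleGraph (X ⊕ Y)} {T : Finset Y} {s : Cycle (X ⊕ Y)}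

/-- `y` occurs immediately after `x` in the cyclic sequence `s`. -/
def Follows (s : Cycle (X ⊕ Y)) (x : X) (y : Y) : Prop :=
  ∃ t : List (X ⊕ Y), s = ↑(Sum.inl x :: Sum.inr y :: t)

theorem exists_follows (hs : SpansRight G T s) (hG : G ≤ completeBipartiteGraph X Y) {x : X}
    (hx : Sum.inl x ∈ s) : ∃ y, Follows s x y := by
  induction s using Quotient.inductionOn with | _ l
  obtain ⟨l₁, l₂, rfl⟩ := List.append_of_mem (show Sum.inl x ∈ l from hx)
  have he : ((l₁ ++ Sum.inl x :: l₂ : List (X ⊕ Y)) : Cycle (X ⊕ Y)) =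
      ↑(Sum.inl x :: (l₂ ++ l₁)) := by
    rw [Cycle.coe_eq_coe]
    exact ⟨l₁.length, by simp⟩
  have hc := hs.chain
  change Cycle.Chain G.Adj ((l₁ ++ Sum.inl x :: l₂ : List (X ⊕ Y)) : Cycle (X ⊕ Y)) at hc
  rw [he, Cycle.chain_coe_cons] at hc
  change ∃ y, Follows ((l₁ ++ Sum.inl x :: l₂ : List (X ⊕ Y)) : Cycle (X ⊕ Y)) x y
  rw [he]
  cases h : l₂ ++ l₁ with
  | nil => simp [h] at hc
  | cons v t =>
    rw [h] at hc
    have hv := hG hc.rel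
    rcases v with v | v
    · simp at hv
    · exact ⟨v, t, rfl⟩

theorem exists_eq_append_of_follows {x₁ x₂ : X} {y₁ y₂ : Y} (h₁ : Follows s x₁ y₁)
    (h₂ : Follows s x₂ y₂) (hne : x₁ ≠ x₂) : ∃ l₁ l₂ : List (X ⊕ Y),
      s = ↑(Sum.inl x₁ :: Sum.inr y₁ :: (l₁ ++ Sum.inl x₂ :: Sum.inr y₂ :: l₂)) := by
  obtain ⟨t₁, rfl⟩ := h₁
  obtain ⟨t₂, h₂⟩ := h₂
  rw [Cycle.coe_eq_coe] at h₂
  obtain ⟨n, hn, h₂⟩ := List.isRotated_iff_mod.mp h₂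
  rw [List.rotate_eq_drop_append_take hn] at h₂
  have hcat := List.take_append_drop n (Sum.inl x₁ :: Sum.inr y₁ :: t₁)
  generalize List.take n (Sum.inl x₁ :: Sum.inr y₁ :: t₁) = A at h₂ hcat
  generalize List.drop n (Sum.inl x₁ :: Sum.inr y₁ :: t₁) = B at h₂ hcat
  rcases A with _ | ⟨a, _ | ⟨a', A⟩⟩ <;> rcases B with _ | ⟨b, _ | ⟨b', B⟩⟩ <;>
    simp_all
  exact ⟨A, B, by rw [hcat.2.2]⟩

theorem exists_card_eq [Fintype X] (hs : SpansRight G T s) :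
    ∃ C : Finset X, (∀ x, x ∈ C ↔ Sum.inl x ∈ s) ∧ C.card = T.card := by
  classical
  have hmem (v : X ⊕ Y) : v ∈ s.toFinset ↔ v ∈ s := by
    induction s using Quotient.inductionOn with | _ l
    exact List.mem_toFinset
  have hcard : s.toFinset.card = s.length := by
    have := hs.nodup
    induction s using Quotient.inductionOn with | _ l
    exact List.toFinset_card_of_nodup this
  have h : s.toFinset = (Finset.univ.filter fun x : X ↦ Sum.inl x ∈ s).disjSum T := by
    ext v
    rcases v with v | v <;> simp [hmem, hs.mem_inr]
  have := hs.length_eq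
  rw [h, Finset.card_disjSum] at hcard
  exact ⟨Finset.univ.filter fun x ↦ Sum.inl x ∈ s, by simp, by omega⟩

/-- Insert `y` next to a neighbour `x` in the sequence, using a new vertex `z` adjacent to `y` and
to the successor of `x`. -/
theorem insert_of_follows [DecidableEq Y] (hs : SpansRight G T s) {x z : X} {y w : Y}
    (hw : Follows s x w) (hy : y ∉ T) (hz : Sum.inl z ∉ s) (hyx : G.Adj (Sum.inr y) (Sum.inl x))
    (hyz : G.Adj (Sum.inr y) (Sum.inl z)) (hwz : G.Adj (Sum.inr w) (Sum.inl z)) :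
    ∃ s', SpansRight G (insert y T) s' := by
  obtain ⟨t, rfl⟩ := hw
  obtain ⟨hc, hn, hm, hl⟩ := hs
  have hy' := mt (hm y).mp hy
  refine ⟨↑(Sum.inl z :: Sum.inr w :: (t ++ [Sum.inl x, Sum.inr y])), ?_, ?_, fun v ↦ ?_, ?_⟩
  · simp only [Cycle.chain_coe_cons, List.cons_append, List.append_assoc, List.nil_append,
      List.isChain_cons_cons] at hc ⊢
    refine ⟨hwz.symm, ?_⟩
    have := hc.2
    rw [← List.cons_append] at this ⊢
    rw [List.isChain_split]
    exact ⟨this, by simp [hyx.symm, hyz]⟩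
  · simp only [Cycle.nodup_coe_iff, Cycle.mem_coe_iff] at *
    grind
  · have := hm v
    simp only [Cycle.mem_coe_iff] at *
    grind
  · simp only [Cycle.length_coe, Finset.card_insert_of_notMem hy] at *
    grind

/-- Insert `y` by replacing a left vertex of the sequence by `y` and two new neighbours of it. -/
theorem insert_of_mem [Fintype X] [DecidableEq Y] (hs : SpansRight G T s)
    (hG : G ≤ completeBipartiteGraph X Y) (hT : T.Nonempty) {y : Y} (hy : y ∉ T)
    (h : ∀ w ∈ T, ∃ z z' : X, z ≠ z' ∧
      (Sum.inl z ∉ s ∧ G.Adj (Sum.inr y) (Sum.inl z) ∧ G.Adj (Sum.inr w) (Sum.inl z)) ∧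
      (Sum.inl z' ∉ s ∧ G.Adj (Sum.inr y) (Sum.inl z') ∧ G.Adj (Sum.inr w) (Sum.inl z'))) :
    ∃ s', SpansRight G (insert y T) s' := by
  obtain ⟨C, hC, hCcard⟩ := hs.exists_card_eq
  obtain ⟨x, hx⟩ := Finset.card_pos.mp (hCcard ▸ hT.card_pos)
  obtain ⟨w, t, rfl⟩ := hs.exists_follows hG ((hC x).mp hx)
  obtain ⟨hc, hn, hm, hl⟩ := hs
  have hy' := mt (hm y).mp hy
  obtain ⟨L, v, hL⟩ : ∃ L v, Sum.inr w :: t = L ++ [v] :=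
    ⟨_, _, (List.dropLast_concat_getLast (List.cons_ne_nil _ t)).symm⟩
  rw [Cycle.chain_coe_cons, List.cons_append, List.isChain_cons_cons, ← List.cons_append, hL,
    List.append_assoc, List.singleton_append, List.isChain_split, List.isChain_cons_cons] at hc
  obtain ⟨-, hLc, hvx, -⟩ := hc
  obtain ⟨u, rfl⟩ : ∃ u, v = Sum.inr u := by
    have := hG hvx
    rcases v with v | v
    · simp at this
    · exact ⟨v, rfl⟩
  have hwT : w ∈ T := (hm w).mp (by simp)
  have huT : u ∈ T := (hm u).mp (by rw [hL]; simp)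
  obtain ⟨z, z', hne, ⟨hz, hyz, hwz⟩, hz', hyz', huz'⟩ : ∃ z z' : X, z ≠ z' ∧
      (Sum.inl z ∉ (↑(Sum.inl x :: Sum.inr w :: t) : Cycle (X ⊕ Y)) ∧
        G.Adj (Sum.inr y) (Sum.inl z) ∧ G.Adj (Sum.inr w) (Sum.inl z)) ∧
      (Sum.inl z' ∉ (↑(Sum.inl x :: Sum.inr w :: t) : Cycle (X ⊕ Y)) ∧
        G.Adj (Sum.inr y) (Sum.inl z') ∧ G.Adj (Sum.inr u) (Sum.inl z')) := by
    obtain ⟨z, -, -, hz, -⟩ := h w hwT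
    obtain ⟨z₁, z₂, hne, h₁, h₂⟩ := h u huT
    by_cases hzz : z = z₁
    · exact ⟨z, z₂, hzz ▸ hne, hz, h₂⟩
    · exact ⟨z, z₁, hzz, hz, h₁⟩
  refine ⟨↑(Sum.inl z :: ((Sum.inr w :: t) ++ [Sum.inl z', Sum.inr y])), ?_, ?_, fun v ↦ ?_, ?_⟩
  · rw [Cycle.chain_coe_cons, List.cons_append, List.cons_append, List.isChain_cons_cons,
      ← List.cons_append, ← List.cons_append, hL, List.append_assoc, List.append_assoc,
      List.singleton_append, List.isChain_split]
    exact ⟨hwz.symm, hLc, by simp [huz', hyz'.symm, hyz]⟩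
  · simp only [Cycle.nodup_coe_iff, Cycle.mem_coe_iff] at *
    grind
  · have := hm v
    simp only [Cycle.mem_coe_iff] at *
    grind
  · simp only [Cycle.length_coe, Finset.card_insert_of_notMem hy] at *
    grind

/-- Insert `y` next to two of its neighbours in the sequence, using a new vertex adjacent to the
successors of both. -/
theorem insert_of_follows_of_follows [DecidableEq Y] (hs : SpansRight G T s) {x₁ x₂ z : X}
    {y w₁ w₂ : Y}
    (h₁ : Follows s x₁ w₁) (h₂ : Follows s x₂ w₂) (hne : x₁ ≠ x₂)
    (hy : y ∉ T) (hz : Sum.inl z ∉ s) (hyx₁ : G.Adj (Sum.inr y) (Sum.inl x₁))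
    (hyx₂ : G.Adj (Sum.inr y) (Sum.inl x₂)) (hwz₁ : G.Adj (Sum.inr w₁) (Sum.inl z))
    (hwz₂ : G.Adj (Sum.inr w₂) (Sum.inl z)) :
    ∃ s', SpansRight G (insert y T) s' := by
  obtain ⟨l₁, l₂, rfl⟩ := exists_eq_append_of_follows h₁ h₂ hne
  obtain ⟨hc, hn, hm, hl⟩ := hs
  have hy' := mt (hm y).mp hy
  refine ⟨↑(Sum.inl z :: Sum.inr w₁ :: (l₁ ++ Sum.inl x₂ :: Sum.inr y :: Sum.inl x₁ ::
    (l₂.reverse ++ [Sum.inr w₂]))), ?_, ?_, fun v ↦ ?_, ?_⟩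
  · simp only [Cycle.chain_coe_cons, List.cons_append, List.append_assoc, List.nil_append,
      List.isChain_cons_cons] at hc ⊢
    refine ⟨hwz₁.symm, ?_⟩
    have := hc.2
    rw [← List.cons_append, List.isChain_split] at this ⊢
    refine ⟨this.1, ?_⟩
    have h₃ := List.isChain_reverse.mpr (List.isChain_cons_cons.mp this.2).2
    simp only [List.reverse_cons, List.reverse_append, List.reverse_nil, List.nil_append,
      List.cons_append, List.isChain_cons_cons] at h₃ ⊢
    refine ⟨hyx₂.symm, hyx₁, ?_⟩
    rw [← List.cons_append, List.isChain_split]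
    refine ⟨h₃.imp fun _ _ h ↦ h.symm, by simp [hwz₂]⟩
  · simp only [Cycle.nodup_coe_iff, Cycle.mem_coe_iff, List.nodup_cons, List.nodup_append,
      List.mem_append, List.mem_cons, List.mem_reverse, List.nodup_reverse] at *
    grind
  · have := hm v
    simp only [Cycle.mem_coe_iff] at *
    grind
  · simp only [Cycle.length_coe, Finset.card_insert_of_notMem hy] at *
    grind

/-- A spanning sequence of `T` extends to one of `insert y T` when `y` and the vertices of `T` have
degree at least `k`, where `T.card < k` and `|X| + 2 ≤ 2 * k`. -/
theorem exists_insert [Fintype X] [DecidableEq Y] (hs : SpansRight G T s)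
    (hG : G ≤ completeBipartiteGraph X Y) (hT : T.Nonempty) {y : Y} (hy : y ∉ T) {k : ℕ} (hTk : T.card < k)
    (hXk : Fintype.card X + 2 ≤ 2 * k)
    (hdeg : ∀ w, k ≤ (G.neighborSet (Sum.inr w)).ncard) :
    ∃ s', SpansRight G (insert y T) s' := by
  classical
  by_contra hno
  obtain ⟨C, hC, hCcard⟩ := hs.exists_card_eq
  obtain ⟨N, hNmem⟩ : ∃ N : Y → Finset X, ∀ w x, x ∈ N w ↔ G.Adj (Sum.inr w) (Sum.inl x) :=
    ⟨fun w ↦ Finset.univ.filter fun x ↦ G.Adj (Sum.inr w) (Sum.inl x), by simp⟩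
  have hN (w : Y) : k ≤ (N w).card := by
    have h : G.neighborSet (Sum.inr w) = Sum.inl '' (N w : Set X) := by
      ext v
      rcases v with v | v
      · simp [hNmem]
      · simpa using fun h ↦ by simpa using hG h
    have := hdeg w
    rwa [h, Set.ncard_image_of_injective _ Sum.inl_injective, Set.ncard_coe_finset] at this
  have hout (w : Y) : (N w).card = (N w ∩ C).card + (N w \ C).card :=
    (Finset.card_inter_add_card_sdiff _ _).symm
  have hCc : C.card + Cᶜ.card = Fintype.card X := Finset.card_add_card_compl C
  rcases (N y ∩ C).eq_empty_or_nonempty with hd | hd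
  · refine hno (hs.insert_of_mem hG hT hy fun w hw ↦ ?_)
    have h₁ := Finset.card_union_add_card_inter (N y \ C) (N w \ C)
    have h₂ : (N y \ C ∪ N w \ C).card ≤ Cᶜ.card := Finset.card_le_card fun z hz ↦ by
      simp only [Finset.mem_union, Finset.mem_sdiff, Finset.mem_compl] at *
      grind
    have h₃ : (N w ∩ C).card ≤ C.card := Finset.card_le_card Finset.inter_subset_right
    have h₄ := hout w
    have h₅ := hout y
    have h₆ := hN w
    have h₇ := hN y
    rw [hd, Finset.card_empty] at h₅
    obtain ⟨z, hz, z', hz', hne⟩ := Finset.one_lt_card.mp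
      (show 1 < ((N y \ C) ∩ (N w \ C)).card by omega)
    exact ⟨z, z', hne, by grind, by grind⟩
  have hf : ∀ x : X, ∃ w, x ∈ C → Follows s x w := fun x ↦ by
    by_cases hx : x ∈ C
    · obtain ⟨w, hw⟩ := hs.exists_follows hG ((hC x).mp hx)
      exact ⟨w, fun _ ↦ hw⟩
    · exact ⟨y, fun h ↦ absurd h hx⟩
  choose f hf using hf
  have hdisj : Disjoint (N y \ C) ((N y ∩ C).biUnion fun x ↦ N (f x) \ C) := by
    rw [Finset.disjoint_biUnion_right]
    refine fun x hx ↦ Finset.disjoint_left.mpr fun z hz hz' ↦ hno ?_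
    simp only [Finset.mem_inter, Finset.mem_sdiff, hNmem, hC] at hx hz hz'
    exact hs.insert_of_follows (hf x ((hC x).mpr hx.2)) hy hz.2 hx.1 hz.1 hz'.1
  have hpair : ((N y ∩ C : Finset X) : Set X).PairwiseDisjoint fun x ↦ N (f x) \ C := by
    refine fun x hx x' hx' hne ↦ Finset.disjoint_left.mpr fun z hz hz' ↦ hno ?_
    simp only [Finset.mem_coe, Finset.mem_inter, Finset.mem_sdiff, hNmem, hC] at hx hx' hz hz'
    exact hs.insert_of_follows_of_follows (hf x ((hC x).mpr hx.2))
      (hf x' ((hC x').mpr hx'.2)) hne hy hz.2 hx.1 hx'.1 hz.1 hz'.1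
  have hunion : (N y \ C).card + ∑ x ∈ N y ∩ C, (N (f x) \ C).card ≤ Cᶜ.card := by
    rw [← Finset.card_biUnion hpair, ← Finset.card_union_of_disjoint hdisj]
    exact Finset.card_le_card <| by
      intro z
      simp only [Finset.mem_union, Finset.mem_biUnion, Finset.mem_sdiff, Finset.mem_compl]
      grind
  have hsum : (N y ∩ C).card * (k - T.card) ≤ ∑ x ∈ N y ∩ C, (N (f x) \ C).card := by
    rw [← smul_eq_mul]
    refine Finset.card_nsmul_le_sum _ _ _ fun x _ ↦ ?_
    have h₁ : (N (f x) ∩ C).card ≤ C.card := Finset.card_le_card Finset.inter_subset_right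
    have h₂ := hout (f x)
    have h₃ := hN (f x)
    omega
  have h₁ := hout y
  have h₂ := hN y
  obtain ⟨d, hd'⟩ := Nat.exists_eq_add_of_lt (Finset.card_pos.mpr hd)
  obtain ⟨e, he⟩ := Nat.exists_eq_add_of_lt hTk
  have hke : k - T.card = e + 1 := by omega
  rw [hke, hd'] at hsum
  have h₃ : d + e + 1 ≤ (0 + d + 1) * (e + 1) := by nlinarith [Nat.zero_le (d * e)]
  omega

theorem exists_of_card_le [Fintype X] (hG : G ≤ completeBipartiteGraph X Y) (hT : T.Nonempty)
    {k : ℕ} (hTk : T.card ≤ k) (hXk : Fintype.card X + 2 ≤ 2 * k)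
    (hdeg : ∀ w, k ≤ (G.neighborSet (Sum.inr w)).ncard) :
    ∃ s, SpansRight G T s := by
  classical
  induction hT using Finset.Nonempty.cons_induction with
  | singleton y =>
    obtain ⟨v, hv⟩ := Set.nonempty_of_ncard_ne_zero (s := G.neighborSet (Sum.inr y))
      (by have := hdeg y; omega)
    rw [SimpleGraph.mem_neighborSet] at hv
    rcases v with x | v
    · refine ⟨↑[Sum.inr y, Sum.inl x], ?_, ?_, fun w ↦ ?_, ?_⟩
      · simp [hv, hv.symm]
      · simp
      · simp
      · simp
    · simpa using hG hv
  | cons y T hy hT ih =>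
    rw [Finset.card_cons] at hTk
    obtain ⟨s, hs⟩ := ih (by omega)
    rw [Finset.cons_eq_insert]
    exact hs.exists_insert hG hT hy hTk hXk hdeg

end SpansRight

/-- (Jackson) Let `G` be bipartite with parts `X` of size `a` and `Y` of size `b`,
`a ≥ b ≥ 2`. If every `y ∈ Y` has degree at least `max(|Y|, |X|/2 + 1)` (the latter
expressed as `2·deg y ≥ a + 2`), then `G` has a cycle containing all vertices of `Y`. -/
theorem jackson (a b : ℕ) (hb : 2 ≤ b) (hab : b ≤ a)
    (G : SimpleGraph (Fin a ⊕ Fin b))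
    (hG : G ≤ completeBipartiteGraph (Fin a) (Fin b))
    (hdeg : ∀ y : Fin b, b ≤ (G.neighborSet (Sum.inr y)).ncard ∧
      a + 2 ≤ 2 * (G.neighborSet (Sum.inr y)).ncard) :
    ∃ (v : Fin a ⊕ Fin b) (p : G.Walk v v), p.IsCycle ∧
      ∀ y : Fin b, Sum.inr y ∈ p.support := by
  obtain ⟨s, hs⟩ := SpansRight.exists_of_card_le (T := Finset.univ) (k := max b ((a + 3) / 2)) hG
    ⟨⟨0, by omega⟩, Finset.mem_univ _⟩ (by simp) (by simp; omega)
    (fun w ↦ by have := hdeg w; omega)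
  obtain ⟨v, p, hp, h⟩ := hs.chain.exists_isCycle hs.nodup
    (by have := hs.length_eq; simp at this; omega)
  exact ⟨v, p, hp, fun y ↦ h _ ((hs.mem_inr y).mpr (Finset.mem_univ y))⟩
end
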